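/- arXiv:math/0109014 — 5 statements merged into one kernel-verified Lean document; each statement's English description precedes it below -/
import Mathlib

section
/- Let ℓ be a prime, let F be a field which is a finite extension of the ℓ-adic numbers ℚ_ℓ, let W be a finite-dimensional F-vector space (with its natural ℓ-adic topology), and let G be a compact subgroup of the topological group Aut_F(W) of F-linear automorphisms of W. Let M be a group of finite exponent (there exists n ≥ 1 with x^n = 1 for all x ∈ M). Then for every group homomorphism π : G → M, the kernel of π is an open subgroup of finite index in G (equivalently, π is continuous when M carries the discrete topology). -/
open NormedSpace Filter Topology

section PadicExp

variable {p : ℕ} [Fact p.Prime] {A : Type*} [NormedRing A] [NormedAlgebra ℚ_[p] A]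

theorem Padic.norm_factorial_inv_le (k : ℕ) : ‖((k.factorial : ℚ_[p]))⁻¹‖ ≤ (p : ℝ) ^ k := by
  have hp : p.Prime := Fact.out
  have hval : padicValNat p k.factorial ≤ k := by
    have h := sub_one_mul_padicValNat_factorial (p := p) k
    have h2 : 1 ≤ p - 1 := by have := hp.two_le; omega
    nlinarith [Nat.sub_le k (p.digits k).sum]
  rw [norm_inv, Padic.norm_eq_zpow_neg_valuation (by exact_mod_cast k.factorial_ne_zero),
    Padic.valuation_natCast, zpow_neg, inv_inv, zpow_natCast]
  exact pow_le_pow_right₀ (by exact_mod_cast hp.one_lt.le) hval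

variable (p A) in
theorem Padic.expSeries_radius_pos : 0 < (expSeries ℚ_[p] A).radius := by
  have hp : (0 : NNReal) < p := by exact_mod_cast (Fact.out : p.Prime).pos
  refine lt_of_lt_of_le (ENNReal.coe_pos.mpr (inv_pos.mpr hp))
    ((expSeries ℚ_[p] A).le_radius_of_bound (max 1 ‖(1 : A)‖) fun k => ?_)
  have hnorm : ‖expSeries ℚ_[p] A k‖ ≤ (p : ℝ) ^ k * max 1 ‖(1 : A)‖ := by
    refine (norm_smul_le ((k.factorial : ℚ_[p])⁻¹)
      (ContinuousMultilinearMap.mkPiAlgebraFin ℚ_[p] k A)).trans ?_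
    gcongr
    · exact Padic.norm_factorial_inv_le k
    · exact ContinuousMultilinearMap.norm_mkPiAlgebraFin_le
  have hp' : (0 : ℝ) < p := by exact_mod_cast hp
  calc ‖expSeries ℚ_[p] A k‖ * (((p : NNReal)⁻¹ : NNReal) : ℝ) ^ k
      ≤ ((p : ℝ) ^ k * max 1 ‖(1 : A)‖) * (((p : NNReal)⁻¹ : NNReal) : ℝ) ^ k := by gcongr
    _ = max 1 ‖(1 : A)‖ := by
      rw [mul_right_comm, NNReal.coe_inv, NNReal.coe_natCast, ← mul_pow,
        mul_inv_cancel₀ hp'.ne', one_pow, one_mul]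

theorem Padic.smul_mem_eball {r : ENNReal} {x : A} (hx : x ∈ Metric.eball (0 : A) r)
    {t : ℚ_[p]} (ht : ‖t‖ ≤ 1) : t • x ∈ Metric.eball (0 : A) r := by
  rw [Metric.mem_eball, edist_zero_right] at hx ⊢
  refine lt_of_le_of_lt ?_ hx
  rw [enorm_le_iff_norm_le, norm_smul]
  exact mul_le_of_le_one_left (norm_nonneg _) ht

variable [CompleteSpace A]

theorem Padic.exp_nsmul_of_mem_ball {x : A}
    (hx : x ∈ Metric.eball (0 : A) (expSeries ℚ_[p] A).radius) (m : ℕ) :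
    exp (m • x) = exp x ^ m := by
  induction m with
  | zero => simp
  | succ m ih =>
    have hm : m • x ∈ Metric.eball (0 : A) (expSeries ℚ_[p] A).radius := by
      rw [← Nat.cast_smul_eq_nsmul ℚ_[p]]
      exact Padic.smul_mem_eball hx (by simpa using Padic.norm_int_le_one (p := p) m)
    rw [succ_nsmul, exp_add_of_commute_of_mem_ball (𝕂 := ℚ_[p])
      ((Commute.refl x).smul_left m) hm hx, ih, pow_succ]

/-- A closed submonoid containing `exp x` contains the `p`-adic one-parameter family through it. -/
theorem Padic.exp_smul_mem_of_isClosed {K : Submonoid A} (hK : IsClosed (K : Set A)) {x : A}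
    (hx : x ∈ Metric.eball (0 : A) (expSeries ℚ_[p] A).radius) (hxK : exp x ∈ K)
    {t : ℚ_[p]} (ht : ‖t‖ ≤ 1) : exp (t • x) ∈ K := by
  have hcont : Continuous fun s : ℤ_[p] => exp ((s : ℚ_[p]) • x) :=
    (continuousOn_exp (𝕂 := ℚ_[p])).comp_continuous (by fun_prop)
      fun s => Padic.smul_mem_eball hx s.2
  refine PadicInt.denseRange_natCast.induction_on
    (p := fun s : ℤ_[p] => exp ((s : ℚ_[p]) • x) ∈ K) ⟨t, ht⟩
    (hK.preimage hcont) fun m => ?_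
  rw [PadicInt.coe_natCast, Nat.cast_smul_eq_nsmul, Padic.exp_nsmul_of_mem_ball hx]
  exact pow_mem hxK m

end PadicExp

theorem HasStrictFDerivAt.list_prod_of_eq_one {𝕜 E A ι : Type*} [NontriviallyNormedField 𝕜]
    [NormedAddCommGroup E] [NormedSpace 𝕜 E] [NormedRing A] [NormedAlgebra 𝕜 A]
    {f : ι → E → A} {f' : ι → E →L[𝕜] A} {x : E} (h1 : ∀ i, f i x = 1)
    (h : ∀ i, HasStrictFDerivAt (f i) (f' i) x) (l : List ι) :
    HasStrictFDerivAt (fun y => (l.map (f · y)).prod) (l.map f').sum x := by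
  induction l with
  | nil => simpa using hasStrictFDerivAt_const (1 : A) x
  | cons i l ih =>
    have hl : (l.map (f · x)).prod = 1 := by
      simp [h1]
    have := (h i).mul' ih
    rw [hl, h1] at this
    simp only [List.map_cons, List.prod_cons, List.sum_cons]
    rwa [one_smul, MulOpposite.op_one, one_smul, add_comm] at this

/-- In a finite-dimensional normed `ℚ_[p]`-algebra, every element of a closed submonoid `K` that is
close enough to `1` is a product of `n`-th powers of elements of `K`. -/
theorem Padic.eventually_mem_closure_pow (p : ℕ) [Fact p.Prime] {A : Type*} [NormedRing A]
    [NormedAlgebra ℚ_[p] A] [FiniteDimensional ℚ_[p] A] {K : Submonoid A} (hK : IsClosed (K : Set A))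
    {n : ℕ} (hn : 0 < n) :
    ∀ᶠ a in 𝓝 (1 : A), a ∈ K → a ∈ Submonoid.closure ((· ^ n) '' (K : Set A)) := by
  have : CompleteSpace A := FiniteDimensional.complete ℚ_[p] A
  have hrad := Padic.expSeries_radius_pos p A
  have hexp : HasStrictFDerivAt (exp : A → A)
      ((ContinuousLinearEquiv.refl ℚ_[p] A : A ≃L[ℚ_[p]] A) : A →L[ℚ_[p]] A) 0 :=
    hasStrictFDerivAt_exp_zero_of_radius_pos hrad
  obtain ⟨log, hlog, hlog_one, hexp_log⟩ : ∃ log : A → A,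
      HasStrictFDerivAt log (ContinuousLinearMap.id ℚ_[p] A) 1 ∧ log 1 = 0 ∧
        ∀ᶠ a in 𝓝 (1 : A), exp (log a) = a := by
    have h1 := hexp.to_localInverse
    have h2 := hexp.localInverse_apply_image
    have h3 := hexp.eventually_right_inverse
    rw [exp_zero] at h1 h2 h3
    exact ⟨_, h1, h2, h3⟩
  have hlog_tendsto : Tendsto log (𝓝 1) (𝓝 0) := by
    simpa [ContinuousAt, hlog_one] using hlog.continuousAt
  let U : Set A := {a | exp (log a) = a ∧
    log a ∈ Metric.eball (0 : A) (expSeries ℚ_[p] A).radius}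
  have hU : U ∈ 𝓝 (1 : A) :=
    hexp_log.and (hlog_tendsto.eventually (Metric.eball_mem_nhds _ hrad))
  let S : Set A := log '' (K ∩ U)
  have hS : ∀ x ∈ S, x ∈ Metric.eball (0 : A) (expSeries ℚ_[p] A).radius ∧ exp x ∈ K := by
    rintro _ ⟨a, ⟨haK, haU⟩, rfl⟩
    exact ⟨haU.2, haU.1.symm ▸ haK⟩
  let V : Submodule ℚ_[p] A := Submodule.span ℚ_[p] S
  obtain ⟨s, hsS, hsV⟩ := (Submodule.fg_span_iff_fg_span_finset_subset (R := ℚ_[p]) S).mp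
    (IsNoetherian.noetherian V)
  obtain ⟨P₀, hP₀⟩ := V.subtype.exists_leftInverse_of_injective V.ker_subtype
  let P : A →L[ℚ_[p]] V := P₀.toContinuousLinearMap
  have hP : ∀ x (hx : x ∈ V), P x = ⟨x, hx⟩ := fun x hx => LinearMap.congr_fun hP₀ ⟨x, hx⟩
  let D : s → (s → ℚ_[p]) →L[ℚ_[p]] A := fun i =>
    n • (ContinuousLinearMap.proj (R := ℚ_[p]) (φ := fun _ : s => ℚ_[p]) i).smulRight (i : A)
  let Φ : (s → ℚ_[p]) → A := fun t =>
    ((Finset.univ : Finset s).toList.map fun i => exp (D i t)).prod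
  have hΦ_zero : Φ 0 = 1 := by simp [Φ]
  have hΦ : HasStrictFDerivAt Φ (∑ i, D i) 0 := by
    have := HasStrictFDerivAt.list_prod_of_eq_one (𝕜 := ℚ_[p]) (x := (0 : s → ℚ_[p]))
      (f := fun i t => exp (D i t)) (f' := D) (by simp) (fun i => ?_)
      (Finset.univ : Finset s).toList
    · rwa [Finset.sum_map_toList] at this
    · have h0 : HasStrictFDerivAt (exp : A → A)
          ((ContinuousLinearEquiv.refl ℚ_[p] A : A ≃L[ℚ_[p]] A) : A →L[ℚ_[p]] A) (D i 0) := by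
        rwa [map_zero]
      exact h0.comp 0 (D i).hasStrictFDerivAt
  let ψ : (s → ℚ_[p]) → V := fun t => P (log (Φ t))
  have hψ : HasStrictFDerivAt ψ (P.comp (∑ i, D i)) 0 := by
    have h0 : HasStrictFDerivAt log (ContinuousLinearMap.id ℚ_[p] A) (Φ 0) := by rwa [hΦ_zero]
    exact P.hasStrictFDerivAt.comp 0 (h0.comp 0 hΦ)
  have hsurj : (P.comp (∑ i, D i)).range = ⊤ := by
    rw [LinearMap.range_eq_top]
    rintro ⟨v, hv⟩
    have hv' : v ∈ Submodule.span ℚ_[p] (s : Set A) := hsV ▸ hv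
    rw [← Subtype.range_coe (s := (s : Set A))] at hv'
    obtain ⟨c, hc⟩ := (Submodule.mem_span_range_iff_exists_fun ℚ_[p]).mp hv'
    have hn' : (n : ℚ_[p]) ≠ 0 := by exact_mod_cast hn.ne'
    have hD : (∑ i, D i) ((n : ℚ_[p])⁻¹ • c) = v := by
      rw [← hc, _root_.sum_apply]
      refine Finset.sum_congr rfl fun i _ => ?_
      simp only [D, ← Nat.cast_smul_eq_nsmul ℚ_[p], _root_.smul_apply,
        ContinuousLinearMap.smulRight_apply, ContinuousLinearMap.proj_apply, Pi.smul_apply,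
        smul_smul, smul_eq_mul, mul_inv_cancel_left₀ hn']
    exact ⟨(n : ℚ_[p])⁻¹ • c, (congrArg P hD).trans (hP v hv)⟩
  have : CompleteSpace V := FiniteDimensional.complete ℚ_[p] V
  have hmap := hψ.map_nhds_eq_of_surj hsurj
  have hψ_zero : ψ 0 = 0 := by simp [ψ, hΦ_zero, hlog_one]
  rw [hψ_zero] at hmap
  let T : Set (s → ℚ_[p]) := {t | (∀ i, ‖t i‖ ≤ 1) ∧ Φ t ∈ U}
  have hT : T ∈ 𝓝 (0 : s → ℚ_[p]) := by
    have h1 : ∀ᶠ t : s → ℚ_[p] in 𝓝 0, ∀ i, ‖t i‖ ≤ 1 := by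
      filter_upwards [Metric.closedBall_mem_nhds (0 : s → ℚ_[p]) one_pos] with t ht i
      exact (norm_le_pi_norm t i).trans (by simpa using ht)
    have h2 : Tendsto Φ (𝓝 0) (𝓝 1) := by
      simpa [ContinuousAt, hΦ_zero] using hΦ.continuousAt
    exact h1.and (h2.eventually hU)
  have hΦ_mem : ∀ t ∈ T, Φ t ∈ Submonoid.closure ((· ^ n) '' (K : Set A)) := by
    intro t ht
    refine list_prod_mem fun x hx => ?_
    obtain ⟨i, -, rfl⟩ := List.mem_map.mp hx
    obtain ⟨hi, hiK⟩ := hS i (hsS i.2)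
    have : D i t = n • (t i • (i : A)) := rfl
    rw [this, Padic.exp_nsmul_of_mem_ball (Padic.smul_mem_eball hi (ht.1 i))]
    exact Submonoid.subset_closure
      ⟨_, Padic.exp_smul_mem_of_isClosed hK hi hiK (ht.1 i), rfl⟩
  have hpow_le : Submonoid.closure ((· ^ n) '' (K : Set A)) ≤ K := by
    rw [Submonoid.closure_le]
    rintro _ ⟨x, hx, rfl⟩
    exact pow_mem hx n
  have hlog_mem : ∀ a ∈ K, a ∈ U → log a ∈ V := fun a haK haU =>
    Submodule.subset_span ⟨a, ⟨haK, haU⟩, rfl⟩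
  have himage : ψ '' T ∈ 𝓝 (0 : V) := hmap ▸ image_mem_map hT
  have hPlog : Tendsto (fun a => P (log a)) (𝓝 1) (𝓝 0) := by
    simpa [Function.comp_def] using (P.continuous.tendsto 0).comp hlog_tendsto
  filter_upwards [hU, hPlog.eventually himage] with a haU ⟨t, ht, hta⟩ haK
  have hlog_eq : log (Φ t) = log a := by
    have h := hta
    simp only [ψ] at h
    rw [hP _ (hlog_mem _ (hpow_le (hΦ_mem t ht)) ht.2), hP _ (hlog_mem a haK haU)] at h
    exact congrArg Subtype.val h
  rw [← haU.1, ← hlog_eq, ht.2.1]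
  exact hΦ_mem t ht

theorem Padic.isOpen_ker_of_pow_eq_one (p : ℕ) [Fact p.Prime] {A : Type*} [NormedRing A]
    [NormedAlgebra ℚ_[p] A] [FiniteDimensional ℚ_[p] A] {G : Subgroup Aˣ}
    (hG : IsCompact (G : Set Aˣ)) {M : Type*} [Group M] {n : ℕ} (hn : 0 < n)
    (hM : ∀ x : M, x ^ n = 1) (π : G →* M) : IsOpen (π.ker : Set G) := by
  let K : Submonoid A := G.toSubmonoid.map (Units.coeHom A)
  have hK : IsClosed (K : Set A) := (hG.image Units.continuous_val).isClosed
  have hcont : Continuous fun g : G => ((g : Aˣ) : A) :=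
    Units.continuous_val.comp continuous_subtype_val
  have hclosure : Submonoid.closure ((· ^ n) '' (K : Set A)) ≤
      π.ker.toSubmonoid.map ((Units.coeHom A).comp G.subtype) := by
    rw [Submonoid.closure_le]
    rintro _ ⟨_, ⟨g, hg, rfl⟩, rfl⟩
    exact ⟨⟨g, hg⟩ ^ n, (map_pow π _ n).trans (hM _), by simp⟩
  refine Subgroup.isOpen_of_mem_nhds _ (g := 1) ?_
  have hev := (hcont.tendsto 1).eventually (Padic.eventually_mem_closure_pow p hK hn)
  filter_upwards [hev] with g hg
  obtain ⟨h, hh, hhg⟩ := hclosure (hg ⟨g, g.2, rfl⟩)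
  have : h = g := Subtype.ext (Units.ext hhg)
  exact this ▸ hh

/-- Let `ℓ` be a prime, `F` a field which is a finite extension of `ℚ_ℓ`
(with its canonical `ℓ`-adic topology, encoded here by a norm for which the inclusion of
`ℚ_ℓ` is an isometry), `W` a finite-dimensional `F`-vector space (with its natural
`ℓ`-adic topology, encoded by a compatible norm), and `G` a compact subgroup of the
topological group `Aut_F(W)` of `F`-linear automorphisms of `W` (realized as the units of
the ring of continuous `F`-linear endomorphisms of `W`; over a complete field every linear
endomorphism of a finite-dimensional space is continuous).  Let `M` be a group of finite
exponent.  Then for every group homomorphism `π : G → M`, the kernel of `π` is an open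
subgroup of finite index in `G`. -/
theorem kernel_open_of_finite_exponent
    (ℓ : ℕ) [Fact ℓ.Prime]
    (F : Type*) [NontriviallyNormedField F] [Algebra ℚ_[ℓ] F]
    [FiniteDimensional ℚ_[ℓ] F] (hFiso : Isometry (algebraMap ℚ_[ℓ] F))
    (W : Type*) [NormedAddCommGroup W] [NormedSpace F W] [FiniteDimensional F W]
    (G : Subgroup (W →L[F] W)ˣ) (hG : IsCompact (G : Set (W →L[F] W)ˣ))
    (M : Type*) [Group M] (n : ℕ) (hn : 0 < n) (hM : ∀ x : M, x ^ n = 1)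
    (π : G →* M) :
    IsOpen ((MonoidHom.ker π : Subgroup G) : Set G) ∧ (MonoidHom.ker π).FiniteIndex := by
  let : NormedAlgebra ℚ_[ℓ] F :=
    { (inferInstance : Algebra ℚ_[ℓ] F) with
      norm_smul_le := fun r x => by
        rw [Algebra.smul_def, norm_mul, hFiso.norm_map_of_map_zero (map_zero _)] }
  have : CompleteSpace F := FiniteDimensional.complete ℚ_[ℓ] F
  let : NormedAlgebra ℚ_[ℓ] (W →L[F] W) := NormedAlgebra.restrictScalars ℚ_[ℓ] F (W →L[F] W)
  have : IsScalarTower ℚ_[ℓ] F (W →L[F] W) := IsScalarTower.of_algebraMap_eq fun _ => rfl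
  have : FiniteDimensional ℚ_[ℓ] (W →L[F] W) := FiniteDimensional.trans ℚ_[ℓ] F (W →L[F] W)
  have hopen := Padic.isOpen_ker_of_pow_eq_one ℓ hG hn hM π
  have : CompactSpace G := isCompact_iff_compactSpace.mp hG
  have := Subgroup.quotient_finite_of_isOpen π.ker hopen
  exact ⟨hopen, Subgroup.finiteIndex_of_finite_quotient⟩
end

section
/- Let G be a group, H a normal subgroup of finite index in G such that the quotient G/H is a finite simple non-abelian group, and π : G → M a group homomorphism. Set G' = ker(π) and H' = H ∩ ker(π). Then: if H contains ker(π), the group G/H is a homomorphic image of π(G) (there is a surjective homomorphism π(G) → G/H); and if H does not contain ker(π), then the natural map G'/H' → G/H is an isomorphism. In particular, G/H is always a homomorphic image either of ker(π) or of the image of π. -/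
/-- Let `G` be a group, `H` a normal subgroup of finite index in `G` such
that `G/H` is a finite simple non-abelian group, and `π : G → M` a group homomorphism.
Set `G' = ker π` and `H' = H ∩ ker π`.  Then: if `H` contains `ker π`, the group `G/H` is a
homomorphic image of `π(G)`; and if `H` does not contain `ker π`, then the natural map
`G'/H' → G/H` is an isomorphism (equivalently, the composite `G' → G → G/H` is surjective
with kernel `H'`). -/
theorem quotient_image_of_ker_cases
    {G M : Type*} [Group G] [Group M]
    (H : Subgroup G) [H.Normal] [H.FiniteIndex]
    [IsSimpleGroup (G ⧸ H)] (hnab : ∃ a b : G ⧸ H, a * b ≠ b * a)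
    (π : G →* M) :
    (MonoidHom.ker π ≤ H →
      ∃ φ : MonoidHom.range π →* G ⧸ H, Function.Surjective φ) ∧
    (¬ MonoidHom.ker π ≤ H →
      Function.Surjective ((QuotientGroup.mk' H).comp (MonoidHom.ker π).subtype) ∧
      MonoidHom.ker ((QuotientGroup.mk' H).comp (MonoidHom.ker π).subtype)
        = H.subgroupOf (MonoidHom.ker π)) := by
  refine ⟨fun hle => ?_, fun hnle => ⟨?_, ?_⟩⟩
  · have hker : π.rangeRestrict.ker ≤ (QuotientGroup.mk' H).ker := by
      rwa [MonoidHom.ker_rangeRestrict, QuotientGroup.ker_mk']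
    let φ := π.rangeRestrict.liftOfSurjective π.rangeRestrict_surjective
      ⟨QuotientGroup.mk' H, hker⟩
    have hφ : φ.comp π.rangeRestrict = QuotientGroup.mk' H :=
      π.rangeRestrict.liftOfRightInverse_comp _ _ ⟨QuotientGroup.mk' H, hker⟩
    refine ⟨φ, Function.Surjective.of_comp (g := π.rangeRestrict) ?_⟩
    rw [← MonoidHom.coe_comp, hφ]
    exact QuotientGroup.mk'_surjective H
  · have hnormal : (π.ker.map (QuotientGroup.mk' H)).Normal :=
      Subgroup.Normal.map inferInstance _ (QuotientGroup.mk'_surjective H)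
    rw [← MonoidHom.range_eq_top, MonoidHom.range_comp, Subgroup.range_subtype]
    refine hnormal.eq_bot_or_eq_top.resolve_left fun hbot => hnle ?_
    rwa [Subgroup.map_eq_bot_iff, QuotientGroup.ker_mk'] at hbot
  · rw [← MonoidHom.comap_ker, QuotientGroup.ker_mk', Subgroup.subgroupOf]
end

section
/- Let ℓ be a prime, k a finite field of characteristic ℓ, V a finite-dimensional k-vector space, and G a subgroup of Aut_k(V). Assume: (i) G is perfect; (ii) G contains a normal abelian subgroup Z such that Γ := G/Z is a simple non-abelian group; (iii) there exists a positive integer d ≥ dim_k(V) such that for every field F of characteristic ℓ and every positive integer a < d, every group homomorphism Γ → PGL_a(F) is trivial. Then every subgroup of G other than G itself has index ≥ max(5, d+1) in G. -/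
/-- The projective general linear group `PGL_a(F)`: the quotient of `GL_a(F)` by its
center. -/
abbrev ProjGL (a : ℕ) (F : Type*) [Field F] : Type _ :=
  GL (Fin a) F ⧸ Subgroup.center (GL (Fin a) F)

open Equiv in
/-- The symmetric group on four letters is solvable. -/
theorem Equiv.Perm.isSolvable_fin_four : Group.IsSolvable (Perm (Fin 4)) := by
  have h4 : Nat.card (Fin 4) = 4 := by simp
  have hK : Group.IsSolvable (commutator (alternatingGroup (Fin 4))) := by
    rw [← alternatingGroup.kleinFour_eq_commutator h4]
    have := (alternatingGroup.kleinFour_isKleinFour h4).isMulCommutative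
    exact Group.isSolvable_of_comm fun a b => mul_comm' a b
  have hQ : Group.IsSolvable
      (alternatingGroup (Fin 4) ⧸ commutator (alternatingGroup (Fin 4))) :=
    inferInstanceAs (Group.IsSolvable (Abelianization (alternatingGroup (Fin 4))))
  have hA : Group.IsSolvable (alternatingGroup (Fin 4)) :=
    (Group.isSolvable_iff_subgroup_quotient _).2 ⟨hK, hQ⟩
  refine Group.isSolvable_of_ker_le_range (alternatingGroup (Fin 4)).subtype Perm.sign ?_
  rw [Subgroup.range_subtype]
  exact le_rfl

/-- The symmetric group on at most four letters is solvable. -/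
theorem Equiv.Perm.isSolvable_of_card_le_four {X : Type*} [Finite X] (hX : Nat.card X ≤ 4) :
    Group.IsSolvable (Equiv.Perm X) := by
  have := Equiv.Perm.isSolvable_fin_four
  let e : X ↪ Fin 4 := (Finite.equivFin X).toEmbedding.trans (Fin.castLEEmb hX)
  exact Group.isSolvable_of_isSolvable_injective (Equiv.Perm.viaEmbeddingHom_injective e)

/-- A homomorphism from a perfect group to a solvable group is trivial. -/
theorem MonoidHom.eq_one_of_commutator_eq_top {H K : Type*} [Group H] [Group K]
    [Group.IsSolvable K] (hH : commutator H = ⊤) (f : H →* K) : f = 1 := by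
  rw [← MonoidHom.range_eq_bot_iff]
  by_contra hne
  refine (Group.IsSolvable.commutator_lt_of_ne_bot hne).ne ?_
  rw [MonoidHom.range_eq_map, ← Subgroup.map_commutator, ← commutator_def, hH]

section PermSumZero

variable (F X : Type*) [Field F] [Fintype X]

/-- The hyperplane of functions with sum zero. -/
def sumZero : Submodule F (X → F) :=
  LinearMap.ker (∑ x : X, LinearMap.proj (R := F) (φ := fun _ : X => F) x)

variable {F X}

theorem mem_sumZero {f : X → F} : f ∈ sumZero F X ↔ ∑ x, f x = 0 := by
  simp [sumZero]

theorem finrank_sumZero [Nonempty X] :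
    Module.finrank F (sumZero F X) = Fintype.card X - 1 := by
  classical
  have hne : (∑ x : X, LinearMap.proj (R := F) (φ := fun _ : X => F) x) ≠ 0 := by
    obtain ⟨x⟩ := ‹Nonempty X›
    intro h
    simpa using LinearMap.congr_fun h (Pi.single x 1)
  have := Module.Dual.finrank_ker_add_one_of_ne_zero hne
  rw [Module.finrank_fintype_fun_eq_card] at this
  rw [sumZero]
  omega

variable (F X)

/-- The permutation action on functions with sum zero. -/
def permSumZero : Equiv.Perm X →* Module.End F (sumZero F X) where
  toFun σ := (LinearMap.funLeft F F (σ⁻¹ : Equiv.Perm X)).restrict fun f hf => by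
    rw [mem_sumZero] at hf ⊢
    simpa [LinearMap.funLeft_apply] using
      (Equiv.sum_comp (σ⁻¹ : Equiv.Perm X) f).trans hf
  map_one' := rfl
  map_mul' σ τ := by
    ext f x
    simp [LinearMap.restrict_apply, LinearMap.funLeft_apply, mul_inv_rev]

variable {F X}

theorem permSumZero_apply (σ : Equiv.Perm X) (f : sumZero F X) (x : X) :
    (permSumZero F X σ f : X → F) x = (f : X → F) (σ⁻¹ x) := rfl

theorem permSumZero_injective (hX : 3 ≤ Fintype.card X) :
    Function.Injective (permSumZero F X) := by
  classical
  rw [injective_iff_map_eq_one]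
  intro σ hσ
  ext x
  by_contra hx
  rw [Equiv.Perm.one_apply] at hx
  obtain ⟨y, hy⟩ : ∃ y, y ∉ ({x, σ x} : Finset X) := by
    by_contra! h
    have := Finset.card_le_card (fun z _ => h z : (Finset.univ : Finset X) ⊆ {x, σ x})
    have := Finset.card_le_two (a := x) (b := σ x)
    rw [← Finset.card_univ] at hX
    omega
  simp only [Finset.mem_insert, Finset.mem_singleton, not_or] at hy
  let f : sumZero F X := ⟨Pi.single x 1 - Pi.single y 1, by simp [mem_sumZero]⟩
  have h := permSumZero_apply σ f (σ x)
  rw [hσ] at h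
  simp [f, hx, Ne.symm hy.1, Ne.symm hy.2] at h

end PermSumZero

/-- If every homomorphism from the perfect group `Γ` to `PGL_a(F)` is trivial, then so is every
action of `Γ` on `a + 1` points. -/
theorem perm_hom_eq_one_of_projGL {Γ : Type*} [Group Γ] (hΓ : commutator Γ = ⊤)
    (F : Type*) [Field F] {X : Type*} [Finite X]
    (hproj : ∀ φ : Γ →* ProjGL (Nat.card X - 1) F, φ = 1) (f : Γ →* Equiv.Perm X) : f = 1 := by
  rcases le_or_gt (Nat.card X) 4 with h4 | h4
  · have := Equiv.Perm.isSolvable_of_card_le_four h4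
    exact f.eq_one_of_commutator_eq_top hΓ
  have := Fintype.ofFinite X
  rw [Nat.card_eq_fintype_card] at hproj h4
  have : Nonempty X := Fintype.card_pos_iff.1 (by omega)
  let b := Module.finBasisOfFinrankEq F (sumZero F X) finrank_sumZero
  let ψ : Γ →* GL (Fin (Fintype.card X - 1)) F :=
    (Units.map (LinearMap.toMatrixAlgEquiv b).toRingEquiv.toMonoidHom).comp
      ((permSumZero F X).comp f).toHomUnits
  have hcenter : ∀ g, ψ g ∈ Subgroup.center (GL (Fin (Fintype.card X - 1)) F) := fun g => by
    rw [← QuotientGroup.eq_one_iff]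
    exact DFunLike.congr_fun (hproj ((QuotientGroup.mk' _).comp ψ)) g
  have : Group.IsSolvable (Subgroup.center (GL (Fin (Fintype.card X - 1)) F)) :=
    Group.isSolvable_of_comm fun x y => Subtype.ext (Subgroup.mem_center_iff.1 y.2 x)
  have hψ := (ψ.codRestrict _ hcenter).eq_one_of_commutator_eq_top hΓ
  ext1 g
  apply permSumZero_injective (F := F) (by omega : 3 ≤ Fintype.card X)
  apply (LinearMap.toMatrixAlgEquiv b).injective
  have h : ψ g = 1 := congrArg Subtype.val (DFunLike.congr_fun hψ g)
  simpa [ψ] using congrArg Units.val h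

/-- The version of `perm_hom_eq_one_of_projGL` for actions of an extension `H` of `Γ` that factor
through `Γ`. -/
theorem perm_hom_eq_one_of_ker_le {Γ H : Type*} [Group Γ] [Group H] (hΓ : commutator Γ = ⊤)
    (F : Type*) [Field F] {X : Type*} [Finite X]
    (hproj : ∀ φ : Γ →* ProjGL (Nat.card X - 1) F, φ = 1)
    (π : H →* Γ) (hπ : Function.Surjective π) (f : H →* Equiv.Perm X) (hf : π.ker ≤ f.ker) :
    f = 1 := by
  have h := perm_hom_eq_one_of_projGL hΓ F hproj (π.liftOfSurjective hπ ⟨f, hf⟩)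
  ext1 x
  rw [← π.liftOfRightInverse_comp_apply _ (Function.rightInverse_surjInv hπ) ⟨f, hf⟩ x]
  exact DFunLike.congr_fun h (π x)

/-- A subgroup all of whose cosets are fixed by left translations is the whole group. -/
theorem Subgroup.eq_top_of_toPermHom_eq_one {G : Type*} [Group G] {S : Subgroup G}
    (h : MulAction.toPermHom G (G ⧸ S) = 1) : S = ⊤ := by
  refine (Subgroup.eq_top_iff' S).2 fun g => ?_
  have := Equiv.congr_fun (DFunLike.congr_fun h g) ((1 : G) : G ⧸ S)
  have h1 : ((g * 1 : G) : G ⧸ S) = ((1 : G) : G ⧸ S) := this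
  simpa using (QuotientGroup.eq.1 h1.symm)

/-- A proper subgroup of a perfect group has index at least five, if that index is finite. -/
theorem Subgroup.five_le_index_of_commutator_eq_top {G : Type*} [Group G]
    (hG : _root_.commutator G = ⊤) {S : Subgroup G} [S.FiniteIndex] (hS : S ≠ ⊤) : 5 ≤ S.index := by
  by_contra! h
  have := Equiv.Perm.isSolvable_of_card_le_four (X := G ⧸ S) (by rw [← Subgroup.index]; omega)
  exact hS (Subgroup.eq_top_of_toPermHom_eq_one
    (MonoidHom.eq_one_of_commutator_eq_top hG _))

/-- A normal subgroup `S` of a perfect group that together with an abelian subgroup generates the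
whole group is the whole group. -/
theorem Subgroup.eq_top_of_sup_eq_top {G : Type*} [Group G] (hG : _root_.commutator G = ⊤)
    {S Z : Subgroup G} [S.Normal] (hZ : ∀ x ∈ Z, ∀ y ∈ Z, x * y = y * x) (h : S ⊔ Z = ⊤) :
    S = ⊤ := by
  have hsurj : ∀ q : G ⧸ S, ∃ z ∈ Z, (z : G ⧸ S) = q := fun q => by
    obtain ⟨g, rfl⟩ := QuotientGroup.mk_surjective q
    obtain ⟨s, hs, z, hz, rfl⟩ := Subgroup.mem_sup_of_normal_left.1 (h ▸ Subgroup.mem_top g)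
    exact ⟨z, hz, by simp [(QuotientGroup.eq_one_iff s).2 hs]⟩
  have : Group.IsSolvable (G ⧸ S) := Group.isSolvable_of_comm fun a b => by
    obtain ⟨x, hx, rfl⟩ := hsurj a
    obtain ⟨y, hy, rfl⟩ := hsurj b
    rw [← QuotientGroup.mk_mul, hZ x hx y hy, QuotientGroup.mk_mul]
  rw [← QuotientGroup.ker_mk' S,
    MonoidHom.eq_one_of_commutator_eq_top hG (QuotientGroup.mk' S), MonoidHom.ker_one]

/-- In a perfect group `G` with abelian normal subgroup `Z`, a subgroup `S` is the whole group if
`G ⧸ Z` has no nontrivial projective representation of dimension less than `d` over `F` and `S` has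
index at most `d`. -/
theorem Subgroup.eq_top_of_index_le {G : Type*} [Group G] (hG : _root_.commutator G = ⊤)
    (Z : Subgroup G) [Z.Normal] (hZ : ∀ x ∈ Z, ∀ y ∈ Z, x * y = y * x) (F : Type*) [Field F]
    (d : ℕ) (hproj : ∀ a, 0 < a → a < d → ∀ φ : G ⧸ Z →* ProjGL a F, φ = 1)
    (S : Subgroup G) [S.FiniteIndex] (hS : S.index ≤ d) : S = ⊤ := by
  have hΓ : _root_.commutator (G ⧸ Z) = ⊤ := by
    rw [_root_.commutator_def, ← MonoidHom.range_eq_top.2 (QuotientGroup.mk'_surjective Z),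
      MonoidHom.range_eq_map, ← Subgroup.map_commutator, ← _root_.commutator_def, hG]
  have key : ∀ T : Subgroup G, S ≤ T → T ≠ ⊤ →
      ∀ φ : G ⧸ Z →* ProjGL (Nat.card (G ⧸ T) - 1) F, φ = 1 := fun T hST hT => by
    have : T.FiniteIndex := Subgroup.finiteIndex_of_le hST
    have h5 := Subgroup.five_le_index_of_commutator_eq_top hG hT
    have hle := Nat.le_of_dvd (Nat.pos_of_ne_zero S.index_ne_zero_of_finite)
      (Subgroup.index_dvd_of_le hST)
    rw [Subgroup.index] at h5 hle
    exact hproj _ (by omega) (by omega)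
  by_contra hne
  by_cases hsup : S ⊔ Z = ⊤
  · suffices S.Normal from hne (Subgroup.eq_top_of_sup_eq_top hG hZ hsup)
    have hsurj : Function.Surjective ((QuotientGroup.mk' Z).comp S.subtype) := fun q => by
      obtain ⟨g, rfl⟩ := QuotientGroup.mk_surjective q
      obtain ⟨s, hs, z, hz, rfl⟩ :=
        Subgroup.mem_sup_of_normal_right.1 (hsup ▸ Subgroup.mem_top g)
      exact ⟨⟨s, hs⟩, by simp [(QuotientGroup.eq_one_iff z).2 hz]⟩
    have htriv := perm_hom_eq_one_of_ker_le hΓ F (key S le_rfl hne) _ hsurj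
      ((MulAction.toPermHom G (G ⧸ S)).comp S.subtype) fun s hs => by
        replace hs : (s : G) ∈ Z := (QuotientGroup.eq_one_iff _).1 hs
        rw [MonoidHom.mem_ker]
        ext q
        obtain ⟨g, rfl⟩ := QuotientGroup.mk_surjective q
        obtain ⟨z, hz, t, ht, rfl⟩ :=
          Subgroup.mem_sup_of_normal_left.1 ((sup_comm S Z ▸ hsup) ▸ Subgroup.mem_top g)
        change ((s * (z * t) : G) : G ⧸ S) = ((z * t : G) : G ⧸ S)
        rw [← mul_assoc, hZ _ hs z hz, mul_assoc, QuotientGroup.eq]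
        simpa [mul_assoc] using
          S.mul_mem (S.mul_mem (S.inv_mem ht) (S.inv_mem s.2)) ht
    refine ⟨fun s hs g => ?_⟩
    have h := Equiv.congr_fun (DFunLike.congr_fun htriv ⟨s, hs⟩) ((g⁻¹ : G) : G ⧸ S)
    have h1 : ((s * g⁻¹ : G) : G ⧸ S) = ((g⁻¹ : G) : G ⧸ S) := h
    simpa [mul_assoc] using QuotientGroup.eq.1 h1.symm
  · have : (S ⊔ Z).FiniteIndex := Subgroup.finiteIndex_of_le (le_sup_left : S ≤ S ⊔ Z)
    refine hsup (Subgroup.eq_top_of_toPermHom_eq_one (perm_hom_eq_one_of_ker_le hΓ F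
      (key _ le_sup_left hsup) (QuotientGroup.mk' Z) (QuotientGroup.mk'_surjective Z) _ ?_))
    rw [QuotientGroup.ker_mk']
    intro z hz
    rw [MonoidHom.mem_ker]
    ext q
    obtain ⟨g, rfl⟩ := QuotientGroup.mk_surjective q
    change ((z * g : G) : G ⧸ (S ⊔ Z)) = (g : G ⧸ (S ⊔ Z))
    rw [eq_comm, QuotientGroup.eq, ← mul_assoc]
    refine (le_sup_right : Z ≤ S ⊔ Z) ?_
    simpa using Subgroup.Normal.conj_mem inferInstance z hz g⁻¹

/-- Let `ℓ` be a prime, `k` a finite field of characteristic `ℓ`, `V` a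
finite-dimensional `k`-vector space, and `G` a subgroup of `Aut_k(V)`.  Assume: (i) `G` is
perfect; (ii) `G` contains a normal abelian subgroup `Z` such that `Γ := G/Z` is a simple
non-abelian group; (iii) there is `d ≥ dim_k V`, `d ≥ 1`, such that for every field `F` of
characteristic `ℓ` and every positive integer `a < d` every homomorphism `Γ → PGL_a(F)` is
trivial.  Then every subgroup of `G` other than `G` itself has index `≥ max (5, d+1)`. -/
theorem index_ge_of_projective_bound
    (ℓ : ℕ) [Fact ℓ.Prime] (k : Type*) [Field k] [Finite k] [CharP k ℓ]
    (V : Type*) [AddCommGroup V] [Module k V] [FiniteDimensional k V]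
    (G : Subgroup (Module.End k V)ˣ)
    (hperf : commutator G = ⊤)
    (Z : Subgroup G) [Z.Normal] (hZab : ∀ x ∈ Z, ∀ y ∈ Z, x * y = y * x)
    [IsSimpleGroup (G ⧸ Z)] (hnab : ∃ a b : G ⧸ Z, a * b ≠ b * a)
    (d : ℕ) (hd0 : 0 < d) (hdim : Module.finrank k V ≤ d)
    (hproj : ∀ (F : Type) [Field F] [CharP F ℓ] (a : ℕ), 0 < a → a < d →
      ∀ φ : G ⧸ Z →* ProjGL a F, φ = 1) :
    ∀ S : Subgroup G, S ≠ ⊤ → max 5 (d + 1) ≤ S.index := by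
  have : Finite V := Module.finite_of_finite k
  have : Finite (Module.End k V) := Finite.of_injective _ DFunLike.coe_injective
  intro S hS
  refine max_le (Subgroup.five_le_index_of_commutator_eq_top hperf hS) ?_
  by_contra! h
  exact hS (Subgroup.eq_top_of_index_le hperf Z hZab (ZMod ℓ) d
    (fun a ha had => hproj (ZMod ℓ) a ha had) S (by omega))
end

section
/- Let ℓ be a prime, k a finite field of characteristic ℓ, V a finite-dimensional k-vector space, and G a subgroup of Aut_k(V). Assume: (i) G is perfect; (ii) G contains a normal abelian subgroup Z such that Γ := G/Z is a simple non-abelian group; (iii) there exists a positive integer d ≥ dim_k(V) such that for every field F of characteristic ℓ and every positive integer a < d, every group homomorphism Γ → PGL_a(F) is trivial. Then for every finite field k' of characteristic ℓ and every positive integer a < d, every group homomorphism G → PGL_a(k') is trivial. -/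
section GroupTheory

variable {G H : Type*} [Group G] [Group H]

theorem derivedSeries_eq_top_of_commutator_eq_top (hG : commutator G = ⊤) (n : ℕ) :
    derivedSeries G n = ⊤ := by
  induction n with
  | zero => rfl
  | succ n ih => rwa [derivedSeries_succ, ih, ← commutator_def]

/-- In a central extension `p : H → G` of a perfect group, the preimage of a central subgroup
is central. -/
theorem commute_of_map_mem_center {p : H →* G} (hp : Function.Surjective p)
    (hker : p.ker ≤ Subgroup.center H) (hG : commutator G = ⊤) {x : H}
    (hx : p x ∈ Subgroup.center G) (y : H) : x * y = y * x := by
  set K : Subgroup H := (Subgroup.center G).comap p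
  have hK : ⁅K, (⊤ : Subgroup H)⁆ ≤ Subgroup.center H := by
    refine le_trans (Subgroup.commutator_le.2 fun a ha b _ => ?_) hker
    have hab : p b * p a = p a * p b := Subgroup.mem_center_iff.1 ha (p b)
    simp [MonoidHom.mem_ker, commutatorElement_def, ← hab]
  have hK1 : ⁅⁅K, (⊤ : Subgroup H)⁆, (⊤ : Subgroup H)⁆ = ⊥ := by
    rw [Subgroup.commutator_eq_bot_iff_le_centralizer]
    rwa [Subgroup.coe_top, Subgroup.centralizer_univ]
  have hK2 : ⁅⁅(⊤ : Subgroup H), (⊤ : Subgroup H)⁆, K⁆ = ⊥ :=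
    Subgroup.commutator_commutator_eq_bot_of_rotate
      (by rw [Subgroup.commutator_comm ⊤ K]; exact hK1) hK1
  rw [Subgroup.commutator_eq_bot_iff_le_centralizer] at hK2
  have hy : p y ∈ (commutator H).map p := by
    rw [commutator_def, Subgroup.map_commutator, Subgroup.map_top_of_surjective p hp,
      ← commutator_def, hG]
    trivial
  obtain ⟨c, hc, hcy⟩ := hy
  have hxc : x * c = c * x := hK2 hc x hx
  have hs : c⁻¹ * y ∈ Subgroup.center H := hker (by simp [MonoidHom.mem_ker, hcy])
  have hxs : x * (c⁻¹ * y) = c⁻¹ * y * x := Subgroup.mem_center_iff.1 hs x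
  calc x * y = x * c * (c⁻¹ * y) := by group
    _ = c * (x * (c⁻¹ * y)) := by rw [hxc, mul_assoc]
    _ = y * x := by rw [hxs]; group

theorem commutator_mem_ker_of_map_commute {M : Type*} [Monoid M] {f : H →* M} {a b : H}
    (hab : f a * f b = f b * f a) : a * b * a⁻¹ * b⁻¹ ∈ f.ker := by
  rw [MonoidHom.mem_ker, mul_assoc, map_mul, map_mul, hab, ← map_mul,
    ← map_mul]
  simp [mul_assoc]

end GroupTheory

section Representation

variable {F H W : Type*} [Field F] [Group H] [AddCommGroup W] [Module F W]

theorem commutator_le_ker_of_scalar {ρ : Representation F H W}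
    (hρ : ∀ h, ∃ c : F, ρ h = c • 1) : commutator H ≤ ρ.ker := by
  rw [commutator_def, Subgroup.commutator_le]
  intro a _ b _
  obtain ⟨c, hc⟩ := hρ a
  have hab : ρ a * ρ b = ρ b * ρ a := by simp [hc]
  exact commutator_mem_ker_of_map_commute hab

/-- If a subgroup `N` acts trivially on `U` and on `W ⧸ U`, then `⁅N, N⁆` acts trivially
on `W`. -/
theorem commutator_le_ker_of_trivial_on_sub_and_quotient {ρ : Representation F H W}
    {N : Subgroup H} {U : Submodule F W} (hU : ∀ h ∈ N, ∀ u ∈ U, ρ h u = u)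
    (hQ : ∀ h ∈ N, ∀ w, ρ h w - w ∈ U) : ⁅N, N⁆ ≤ ρ.ker := by
  rw [Subgroup.commutator_le]
  intro a ha b hb
  have key : ∀ a ∈ N, ∀ b ∈ N, ∀ w, ρ a (ρ b w) = ρ b w + ρ a w - w := by
    intro a ha b hb w
    have h := hU a ha _ (hQ b hb w)
    rw [map_sub] at h
    rw [sub_eq_iff_eq_add] at h
    rw [h]
    abel
  have hab : ρ a * ρ b = ρ b * ρ a := by
    ext w
    rw [Module.End.mul_apply, Module.End.mul_apply, key a ha b hb, key b hb a ha, add_comm]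
  exact commutator_mem_ker_of_map_commute hab

theorem exists_derivedSeries_le_ker_of_sub_and_quotient {ρ : Representation F H W}
    {U : Submodule F W} (hinv : ∀ h, U ≤ U.comap (ρ h))
    (hU : ∃ n, derivedSeries H n ≤ (ρ.subrepresentation U hinv).ker)
    (hQ : ∃ n, derivedSeries H n ≤ (ρ.quotient U hinv).ker) :
    ∃ n, derivedSeries H n ≤ ρ.ker := by
  obtain ⟨m, hm⟩ := hU
  obtain ⟨n, hn⟩ := hQ
  refine ⟨max m n + 1, ?_⟩
  rw [derivedSeries_succ]
  refine commutator_le_ker_of_trivial_on_sub_and_quotient (U := U) (fun h hh u hu => ?_)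
    fun h hh w => ?_
  · have h1 := hm (derivedSeries_antitone H (le_max_left m n) hh)
    rw [MonoidHom.mem_ker] at h1
    exact congrArg Subtype.val (LinearMap.congr_fun h1 ⟨u, hu⟩)
  · have h1 := hn (derivedSeries_antitone H (le_max_right m n) hh)
    rw [MonoidHom.mem_ker] at h1
    exact (Submodule.Quotient.eq U).1 (LinearMap.congr_fun h1 (U.mkQ w))

theorem finrank_quotient_lt_of_ne_bot [FiniteDimensional F W] {U : Submodule F W} (hU : U ≠ ⊥) :
    Module.finrank F (W ⧸ U) < Module.finrank F W := by
  have h1 := U.finrank_quotient_add_finrank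
  have h2 : 0 < Module.finrank F U :=
    Module.finrank_pos_iff.2 (Submodule.nontrivial_iff_ne_bot.2 hU)
  omega

theorem exists_common_eigenvector [IsAlgClosed F] [FiniteDimensional F W] [Nontrivial W]
    {ι : Type*} (f : ι → Module.End F W) (hf : ∀ i j, Commute (f i) (f j)) :
    ∃ χ : ι → F, ⨅ i, (f i).eigenspace (χ i) ≠ ⊥ := by
  obtain ⟨U, ⟨hU0, hUinv⟩, hUmin⟩ := WellFounded.has_min (wellFounded_lt (α := Submodule F W))
    {U | U ≠ ⊥ ∧ ∀ i, U ≤ U.comap (f i)} ⟨⊤, top_ne_bot, fun i => by simp⟩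
  have hscal : ∀ i, ∃ c, U ≤ (f i).eigenspace c := by
    intro i
    have : Nontrivial U := Submodule.nontrivial_iff_ne_bot.2 hU0
    obtain ⟨c, hc⟩ := Module.End.exists_eigenvalue ((f i).restrict (hUinv i))
    obtain ⟨v, hv⟩ := hc.exists_hasEigenvector
    refine ⟨c, inf_eq_left.1 (eq_of_le_of_not_lt inf_le_left (hUmin _ ⟨?_, fun j w hw => ?_⟩))⟩
    · intro hbot
      have hv1 : (v : W) ∈ U ⊓ (f i).eigenspace c :=
        ⟨v.2, Module.End.mem_eigenspace_iff.2 (congrArg Subtype.val hv.apply_eq_smul)⟩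
      rw [hbot, Submodule.mem_bot] at hv1
      exact hv.2 (Subtype.ext hv1)
    · refine ⟨hUinv j hw.1, Module.End.mem_eigenspace_iff.2 ?_⟩
      rw [← Module.End.mul_apply, (hf i j).eq, Module.End.mul_apply,
        Module.End.mem_eigenspace_iff.1 hw.2, map_smul]
  choose χ hχ using hscal
  exact ⟨χ, fun h => hU0 (le_bot_iff.1 (h ▸ le_iInf hχ))⟩

theorem iSupIndep_iInf_eigenspace {ι : Type*} (f : ι → Module.End F W)
    (hf : ∀ i j, Commute (f i) (f j)) :
    iSupIndep fun χ : ι → F => ⨅ i, (f i).eigenspace (χ i) :=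
  (Module.End.independent_iInf_maxGenEigenspace_of_forall_mapsTo f fun i j μ =>
    Module.End.mapsTo_maxGenEigenspace_of_comm (hf j i) μ).mono fun χ =>
      iInf_mono fun i => (f i).genEigenspace (χ i) |>.mono le_top

end Representation

section ProjectiveBound

variable {F Γ H W : Type*} [Field F] [Group Γ] [Group H] [AddCommGroup W] [Module F W]
  [FiniteDimensional F W] {d : ℕ} {π : H →* Γ}

theorem scalar_of_ker_scalar
    (hF : ∀ a : ℕ, 0 < a → a < d → ∀ φ : Γ →* ProjGL a F, φ = 1)
    (hπ : Function.Surjective π) {ρ : Representation F H W} (hd : Module.finrank F W < d)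
    (hker : ∀ h ∈ π.ker, ∃ c : F, ρ h = c • 1) (h : H) : ∃ c : F, ρ h = c • 1 := by
  rcases Nat.eq_zero_or_pos (Module.finrank F W) with h0 | h0
  · have := Module.finrank_zero_iff.1 h0
    exact ⟨1, LinearMap.ext fun _ => Subsingleton.elim _ _⟩
  let e : Module.End F W ≃ₐ[F] Matrix (Fin (Module.finrank F W)) (Fin (Module.finrank F W)) F :=
    LinearMap.toMatrixAlgEquiv (Module.finBasis F W)
  let ψ : H →* GL (Fin (Module.finrank F W)) F :=
    (((e : Module.End F W →* Matrix _ _ F)).comp ρ).toHomUnits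
  have hψ : ∀ h, (ψ h).1 = e (ρ h) := fun h => rfl
  have hcen : ∀ h, ψ h ∈ Subgroup.center (GL (Fin (Module.finrank F W)) F) ↔
      ∃ c : F, ρ h = c • 1 := by
    intro h
    rw [Matrix.GeneralLinearGroup.mem_center_iff_val_mem_range_scalar]
    refine exists_congr fun c => ?_
    rw [hψ, ← e.injective.eq_iff, map_smul, map_one, Matrix.smul_one_eq_diagonal]
    exact eq_comm
  let φ : H →* ProjGL (Module.finrank F W) F := (QuotientGroup.mk' _).comp ψ
  have hφ : π.ker ≤ φ.ker := fun x hx =>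
    (QuotientGroup.eq_one_iff _).2 ((hcen x).2 (hker x hx))
  have h1 := hF _ h0 hd (π.liftOfSurjective hπ ⟨φ, hφ⟩)
  have h2 : φ h = 1 := by
    rw [← MonoidHom.liftOfRightInverse_comp_apply π _ (Function.rightInverse_surjInv hπ) ⟨φ, hφ⟩ h]
    exact DFunLike.congr_fun h1 (π h)
  exact (hcen h).1 ((QuotientGroup.eq_one_iff _).1 h2)

/-- A perfect group with no nontrivial projective representation of dimension `< d` over `F`
acts trivially on every set with at most `d` elements. -/
theorem perm_hom_trivial
    (hF : ∀ a : ℕ, 0 < a → a < d → ∀ φ : Γ →* ProjGL a F, φ = 1)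
    (hΓ : commutator Γ = ⊤) {X : Type*} [Finite X] (hX : Nat.card X ≤ d)
    (θ : Γ →* Equiv.Perm X) : θ = 1 := by
  classical
  rcases isEmpty_or_nonempty X with hE | hE
  · exact MonoidHom.ext fun g => Subsingleton.elim _ _
  have := Fintype.ofFinite X
  let ρ : Representation F Γ (X → F) :=
    { toFun := fun g => LinearMap.funLeft F F (θ g⁻¹)
      map_one' := by ext; simp
      map_mul' := fun a b => by ext; simp }
  have hρ : ∀ g v x, ρ g v x = v ((θ g)⁻¹ x) := fun g v x => by
    simp [ρ, LinearMap.funLeft_apply]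
  let s : (X → F) →ₗ[F] F := ∑ x, LinearMap.proj x
  have hs : ∀ v, s v = ∑ x, v x := fun v => by simp [s]
  have hsρ : ∀ g v, s (ρ g v) = s v := fun g v => by
    simp only [hs, hρ]
    exact Equiv.sum_comp (θ g)⁻¹ v
  have hinv : ∀ g, LinearMap.ker s ≤ (LinearMap.ker s).comap (ρ g) := fun g v hv => by
    simpa [LinearMap.mem_ker, hsρ] using hv
  have hdim : Module.finrank F (LinearMap.ker s) < d := by
    refine lt_of_lt_of_le (Submodule.finrank_lt fun htop => ?_)
      (by simpa [Nat.card_eq_fintype_card] using hX)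
    obtain ⟨x⟩ := hE
    have h1 : Pi.single x (1 : F) ∈ LinearMap.ker s := htop ▸ Submodule.mem_top
    rw [LinearMap.mem_ker, hs, Finset.sum_pi_single'] at h1
    simp at h1
  have hS := commutator_le_ker_of_scalar
    (scalar_of_ker_scalar hF (π := MonoidHom.id Γ) Function.surjective_id
      (ρ := ρ.subrepresentation (LinearMap.ker s) hinv) hdim
      fun g hg => ⟨1, by rw [show g = 1 from hg, map_one, one_smul]⟩)
  rw [hΓ] at hS
  have hK : ⁅(⊤ : Subgroup Γ), (⊤ : Subgroup Γ)⁆ ≤ ρ.ker :=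
    commutator_le_ker_of_trivial_on_sub_and_quotient (U := LinearMap.ker s)
      (fun g _ u hu => congrArg Subtype.val
        (LinearMap.congr_fun (MonoidHom.mem_ker.1 (hS (Subgroup.mem_top g))) ⟨u, hu⟩))
      fun g _ w => by rw [LinearMap.mem_ker, map_sub, hsρ, sub_self]
  rw [← commutator_def, hΓ] at hK
  ext g x
  have h1 := congrFun (LinearMap.congr_fun (MonoidHom.mem_ker.1 (hK (Subgroup.mem_top g)))
    (Pi.single x 1)) (θ g x)
  rw [hρ] at h1
  by_contra hne
  simp only [MonoidHom.one_apply, Equiv.Perm.coe_one, id_eq] at hne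
  simp [Pi.single_eq_of_ne hne] at h1

/-- Abelian kernels act by scalars on irreducible representations of dimension at most `d`. -/
theorem ker_scalar_of_irreducible [IsAlgClosed F] [Nontrivial W]
    (hF : ∀ a : ℕ, 0 < a → a < d → ∀ φ : Γ →* ProjGL a F, φ = 1)
    (hΓ : commutator Γ = ⊤) (hπ : Function.Surjective π)
    (hab : ∀ x ∈ π.ker, ∀ y ∈ π.ker, x * y = y * x)
    {ρ : Representation F H W} (hd : Module.finrank F W ≤ d)
    (hirr : ∀ U : Submodule F W, (∀ h, U ≤ U.comap (ρ h)) → U = ⊥ ∨ U = ⊤) :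
    ∀ h ∈ π.ker, ∃ c : F, ρ h = c • 1 := by
  let f : π.ker → Module.End F W := fun x => ρ x
  have hf : ∀ x y, Commute (f x) (f y) := fun x y => by
    rw [Commute, SemiconjBy, ← map_mul, ← map_mul, hab x x.2 y y.2]
  let E : (π.ker → F) → Submodule F W := fun χ => ⨅ x, (f x).eigenspace (χ x)
  have hE : ∀ χ w, w ∈ E χ ↔ ∀ x, f x w = χ x • w := fun χ w => by
    simp [E, Submodule.mem_iInf]
  have hind : iSupIndep E := iSupIndep_iInf_eigenspace f hf
  let X := {χ : π.ker → F // E χ ≠ ⊥}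
  have : Fintype X := hind.fintypeNeBotOfFiniteDimensional
  have hX : Nat.card X ≤ d := by
    rw [Nat.card_eq_fintype_card]
    exact hind.subtype_ne_bot_le_finrank.trans hd
  let conj : H → (π.ker → F) → π.ker → F := fun h χ x => χ (MulAut.conjNormal h⁻¹ x)
  have hconj : ∀ h χ w, w ∈ E χ → ρ h w ∈ E (conj h χ) := by
    intro h χ w hw
    rw [hE] at hw ⊢
    intro x
    have h1 : (x : H) * h = h * (MulAut.conjNormal h⁻¹ x : π.ker) := by
      simp [mul_assoc]
    change ρ x (ρ h w) = χ _ • ρ h w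
    rw [← Module.End.mul_apply, ← map_mul, h1, map_mul, Module.End.mul_apply, ← map_smul]
    exact congrArg _ (hw _)
  have hconj_ne : ∀ h χ, E χ ≠ ⊥ → E (conj h χ) ≠ ⊥ := by
    intro h χ hχ
    obtain ⟨w, hw, hw0⟩ := Submodule.exists_mem_ne_zero_of_ne_bot hχ
    refine (Submodule.ne_bot_iff _).2 ⟨ρ h w, hconj h χ w hw, fun h0 => hw0 ?_⟩
    have h1 := congrArg (ρ h⁻¹) h0
    simpa using h1
  let Θ : H →* Equiv.Perm X := MonoidHom.toHomPerm
    { toFun := fun h χ => ⟨conj h χ, hconj_ne h χ χ.2⟩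
      map_one' := by
        funext χ
        refine Subtype.ext (funext fun x => ?_)
        change χ.1 (MulAut.conjNormal (1 : H)⁻¹ x) = χ.1 x
        simp
      map_mul' := fun a b => by
        funext χ
        refine Subtype.ext (funext fun x => ?_)
        change χ.1 (MulAut.conjNormal (a * b)⁻¹ x) =
          χ.1 (MulAut.conjNormal b⁻¹ (MulAut.conjNormal a⁻¹ x))
        rw [mul_inv_rev, map_mul, MulAut.mul_apply] }
  have hΘ : ∀ h χ, (Θ h χ).1 = conj h χ := fun h χ => rfl
  have hker : π.ker ≤ Θ.ker := by
    intro y hy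
    rw [MonoidHom.mem_ker]
    ext χ x
    rw [hΘ]
    refine congrArg χ.1 (Subtype.ext ?_)
    rw [MulAut.conjNormal_apply, hab _ (inv_mem hy) x x.2]
    simp
  have hΘ1 : ∀ h, Θ h = 1 := by
    intro h
    rw [← MonoidHom.liftOfRightInverse_comp_apply π _ (Function.rightInverse_surjInv hπ)
      ⟨Θ, hker⟩ h]
    exact DFunLike.congr_fun (perm_hom_trivial hF hΓ hX (π.liftOfSurjective hπ ⟨Θ, hker⟩)) (π h)
  obtain ⟨χ, hχ⟩ := exists_common_eigenvector f hf
  have hstable : ∀ h, E χ ≤ (E χ).comap (ρ h) := by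
    intro h w hw
    have h1 : conj h χ = χ := by
      rw [← hΘ h ⟨χ, hχ⟩, hΘ1]
      rfl
    have h2 := hconj h χ w hw
    rwa [h1] at h2
  have htop := (hirr (E χ) hstable).resolve_left hχ
  intro h hh
  refine ⟨χ ⟨h, hh⟩, LinearMap.ext fun w => ?_⟩
  exact (hE χ w).1 (htop ▸ Submodule.mem_top) ⟨h, hh⟩

theorem exists_derivedSeries_le_ker_of_finrank_lt {W : Type*} [AddCommGroup W] [Module F W]
    [FiniteDimensional F W] [IsAlgClosed F]
    (hF : ∀ a : ℕ, 0 < a → a < d → ∀ φ : Γ →* ProjGL a F, φ = 1)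
    (hΓ : commutator Γ = ⊤) (hπ : Function.Surjective π)
    (hab : ∀ x ∈ π.ker, ∀ y ∈ π.ker, x * y = y * x)
    (ρ : Representation F H W) (hd : Module.finrank F W < d) :
    ∃ n, derivedSeries H n ≤ ρ.ker := by
  induction hm : Module.finrank F W using Nat.strong_induction_on generalizing W with
  | _ m ih =>
  subst hm
  rcases subsingleton_or_nontrivial W with hW | hW
  · exact ⟨0, fun h _ => LinearMap.ext fun _ => Subsingleton.elim _ _⟩
  by_cases hirr : ∀ U : Submodule F W, (∀ h, U ≤ U.comap (ρ h)) → U = ⊥ ∨ U = ⊤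
  · refine ⟨1, ?_⟩
    rw [derivedSeries_one]
    exact commutator_le_ker_of_scalar (scalar_of_ker_scalar hF hπ hd
      (ker_scalar_of_irreducible hF hΓ hπ hab hd.le hirr))
  · push Not at hirr
    obtain ⟨U, hinv, hbot, htop⟩ := hirr
    have h1 := Submodule.finrank_lt htop
    have h2 := finrank_quotient_lt_of_ne_bot hbot
    exact exists_derivedSeries_le_ker_of_sub_and_quotient hinv
      (ih _ h1 _ (h1.trans hd) rfl) (ih _ h2 _ (h2.trans hd) rfl)

/-- For a representation of dimension at most `d`, either an abelian kernel acts by scalars or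
the image is solvable. -/
theorem ker_scalar_or_exists_derivedSeries_le_ker [IsAlgClosed F]
    (hF : ∀ a : ℕ, 0 < a → a < d → ∀ φ : Γ →* ProjGL a F, φ = 1)
    (hΓ : commutator Γ = ⊤) (hπ : Function.Surjective π)
    (hab : ∀ x ∈ π.ker, ∀ y ∈ π.ker, x * y = y * x)
    (ρ : Representation F H W) (hd : Module.finrank F W ≤ d) :
    (∀ h ∈ π.ker, ∃ c : F, ρ h = c • 1) ∨ ∃ n, derivedSeries H n ≤ ρ.ker := by
  rcases subsingleton_or_nontrivial W with hW | hW
  · exact Or.inr ⟨0, fun h _ => LinearMap.ext fun _ => Subsingleton.elim _ _⟩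
  by_cases hirr : ∀ U : Submodule F W, (∀ h, U ≤ U.comap (ρ h)) → U = ⊥ ∨ U = ⊤
  · exact Or.inl (ker_scalar_of_irreducible hF hΓ hπ hab hd hirr)
  · push Not at hirr
    obtain ⟨U, hinv, hbot, htop⟩ := hirr
    exact Or.inr (exists_derivedSeries_le_ker_of_sub_and_quotient hinv
      (exists_derivedSeries_le_ker_of_finrank_lt hF hΓ hπ hab _
        ((Submodule.finrank_lt htop).trans_le hd))
      (exists_derivedSeries_le_ker_of_finrank_lt hF hΓ hπ hab _
        ((finrank_quotient_lt_of_ne_bot hbot).trans_le hd)))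

end ProjectiveBound

/-- The representation of `GL_a(k)` on `K^a` obtained by extension of scalars. -/
noncomputable def glRepresentation {k K : Type*} [Field k] [Field K] (i : k →+* K) (a : ℕ) :
    Representation K (GL (Fin a) k) (Fin a → K) :=
  ((Matrix.toLinAlgEquiv' : Matrix (Fin a) (Fin a) K ≃ₐ[K] _) :
    Matrix (Fin a) (Fin a) K →* Module.End K (Fin a → K)).comp
    (i.mapMatrix.toMonoidHom.comp
      (Units.coeHom (Matrix (Fin a) (Fin a) k)))

theorem glRepresentation_injective {k K : Type*} [Field k] [Field K] (i : k →+* K) (a : ℕ) :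
    Function.Injective (glRepresentation i a) := fun _ _ hxy =>
  Units.ext (Matrix.map_injective i.injective
    ((Matrix.toLinAlgEquiv' : Matrix (Fin a) (Fin a) K ≃ₐ[K] _).injective hxy))

theorem nonempty_ringHom_algebraicClosure_zmod (ℓ : ℕ) [Fact ℓ.Prime] (k : Type*) [Field k]
    [Finite k] [CharP k ℓ] : Nonempty (k →+* AlgebraicClosure (ZMod ℓ)) := by
  let _ := ZMod.algebra k ℓ
  have : Module.Finite (ZMod ℓ) k := Module.Finite.of_finite
  exact ⟨(IsAlgClosed.lift (R := ZMod ℓ) (S := k) (M := AlgebraicClosure (ZMod ℓ))).toRingHom⟩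

/-- Let `ℓ` be a prime, `k` a finite field of characteristic `ℓ`, `V` a
finite-dimensional `k`-vector space, and `G` a subgroup of `Aut_k(V)`.  Assume: (i) `G` is
perfect; (ii) `G` contains a normal abelian subgroup `Z` such that `Γ := G/Z` is a simple
non-abelian group; (iii) there is `d ≥ dim_k V`, `d ≥ 1`, such that for every field `F` of
characteristic `ℓ` and every positive integer `a < d` every homomorphism `Γ → PGL_a(F)` is
trivial.  Then for every finite field `k'` of characteristic `ℓ` and every positive
integer `a < d`, every group homomorphism `G → PGL_a(k')` is trivial. -/
theorem hom_to_pgl_trivial_of_projective_bound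
    (ℓ : ℕ) [Fact ℓ.Prime] (k : Type*) [Field k] [Finite k] [CharP k ℓ]
    (V : Type*) [AddCommGroup V] [Module k V] [FiniteDimensional k V]
    (G : Subgroup (Module.End k V)ˣ)
    (hperf : commutator G = ⊤)
    (Z : Subgroup G) [Z.Normal] (hZab : ∀ x ∈ Z, ∀ y ∈ Z, x * y = y * x)
    [IsSimpleGroup (G ⧸ Z)] (hnab : ∃ a b : G ⧸ Z, a * b ≠ b * a)
    (d : ℕ) (hd0 : 0 < d) (hdim : Module.finrank k V ≤ d)
    (hproj : ∀ (F : Type) [Field F] [CharP F ℓ] (a : ℕ), 0 < a → a < d →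
      ∀ φ : G ⧸ Z →* ProjGL a F, φ = 1) :
    ∀ (k' : Type) [Field k'] [Finite k'] [CharP k' ℓ] (a : ℕ), 0 < a → a < d →
      ∀ φ : G →* ProjGL a k', φ = 1 := by
  intro k' _ _ _ a ha had φ
  let F := AlgebraicClosure (ZMod ℓ)
  have hF : ∀ a : ℕ, 0 < a → a < d → ∀ φ : G ⧸ Z →* ProjGL a F, φ = 1 := hproj F
  let π : G →* G ⧸ Z := QuotientGroup.mk' Z
  have hπ : Function.Surjective π := QuotientGroup.mk'_surjective Z
  have hΓ : commutator (G ⧸ Z) = ⊤ := by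
    rw [commutator_def, ← Subgroup.map_top_of_surjective π hπ, ← Subgroup.map_commutator,
      ← commutator_def, hperf]
  have hπker : π.ker = Z := QuotientGroup.ker_mk' Z
  have hZcenter : Z ≤ Subgroup.center G := by
    obtain ⟨i⟩ := nonempty_ringHom_algebraicClosure_zmod ℓ k
    let toGL : (Module.End k V)ˣ →* GL (Fin (Module.finrank k V)) k :=
      Units.map (LinearMap.toMatrixAlgEquiv (Module.finBasis k V) : Module.End k V →* _)
    let ρ : Representation F G (Fin (Module.finrank k V) → F) :=
      (glRepresentation i _).comp (toGL.comp G.subtype)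
    have hρ : Function.Injective ρ := (glRepresentation_injective i _).comp
      ((Units.map_injective (LinearMap.toMatrixAlgEquiv (Module.finBasis k V)).injective).comp
        G.subtype_injective)
    rcases ker_scalar_or_exists_derivedSeries_le_ker hF hΓ hπ (hπker.symm ▸ hZab) ρ
      (by simpa using hdim) with h | ⟨n, hn⟩
    · intro z hz
      obtain ⟨c, hc⟩ := h z (hπker.symm ▸ hz)
      exact Subgroup.mem_center_iff.2 fun g => hρ (by simp [hc])
    · rw [derivedSeries_eq_top_of_commutator_eq_top hperf, (MonoidHom.ker_eq_bot_iff ρ).2 hρ] at hn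
      obtain ⟨x, y, hxy⟩ := hnab
      obtain ⟨g, rfl⟩ := hπ x
      have hg : g = 1 := hn (Subgroup.mem_top g)
      simp [hg] at hxy
  let H : Subgroup (G × GL (Fin a) k') := MonoidHom.eqLocus (φ.comp (MonoidHom.fst _ _))
    ((QuotientGroup.mk' (Subgroup.center (GL (Fin a) k'))).comp (MonoidHom.snd _ _))
  let p : H →* G := (MonoidHom.fst _ _).comp H.subtype
  have hp : Function.Surjective p := fun g => by
    obtain ⟨x, hx⟩ := QuotientGroup.mk'_surjective _ (φ g)
    exact ⟨⟨(g, x), hx.symm⟩, rfl⟩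
  have hpker : p.ker ≤ Subgroup.center H := by
    rintro ⟨⟨g, x⟩, hx⟩ hg
    obtain rfl : g = 1 := hg
    have hx1 : x ∈ Subgroup.center (GL (Fin a) k') :=
      (QuotientGroup.eq_one_iff x).1 (hx.symm.trans (map_one φ))
    refine Subgroup.mem_center_iff.2 fun y => Subtype.ext (Prod.ext ?_ ?_)
    · simp
    · exact Subgroup.mem_center_iff.1 hx1 _
  obtain ⟨i⟩ := nonempty_ringHom_algebraicClosure_zmod ℓ k'
  let ρ : Representation F H (Fin a → F) :=
    (glRepresentation i a).comp ((MonoidHom.snd _ _).comp H.subtype)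
  obtain ⟨n, hn⟩ := exists_derivedSeries_le_ker_of_finrank_lt hF hΓ (π := π.comp p)
    (hπ.comp hp)
    (fun x hx y _ => commute_of_map_mem_center hp hpker hperf
      (hZcenter (hπker ▸ (show p x ∈ π.ker from hx))) y) ρ (by simpa using had)
  ext1 g
  have hg : g ∈ (derivedSeries H n).map p := by
    rw [map_derivedSeries_eq hp, derivedSeries_eq_top_of_commutator_eq_top hperf]
    trivial
  obtain ⟨⟨⟨g', x⟩, hx⟩, hh, rfl⟩ := hg
  have hx1 : x = 1 := glRepresentation_injective i a ((hn hh).trans (map_one _).symm)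
  subst hx1
  exact hx.trans (map_one (QuotientGroup.mk' _))
end

section
/- Let d ≥ 8 be an even integer and let n be either d+1 or d+2. Then every nontrivial projective representation of the alternating group A_n in characteristic 2 has dimension ≥ d; that is, for every field F of characteristic 2 and every positive integer a < d, every group homomorphism A_n → PGL_a(F) is trivial. -/
open Equiv Equiv.Perm Module

namespace AltPGL

section Permutations

variable {α : Type*} [DecidableEq α]

/-- The permutation `a ↦ b ↦ c ↦ a`. -/
def cyc (a b c : α) : Perm α := swap a b * swap b c

lemma cyc_apply_left {a b c : α} (hab : a ≠ b) (hac : a ≠ c) : cyc a b c a = b := by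
  simp [cyc, swap_apply_of_ne_of_ne hab hac]

lemma cyc_apply_mid {a b c : α} (hac : a ≠ c) (hbc : b ≠ c) : cyc a b c b = c := by
  simp [cyc, swap_apply_of_ne_of_ne hac.symm hbc.symm]

lemma cyc_apply_right (a b c : α) : cyc a b c c = a := by
  simp [cyc]

lemma cyc_apply_of_ne {a b c x : α} (ha : x ≠ a) (hb : x ≠ b) (hc : x ≠ c) :
    cyc a b c x = x := by
  simp [cyc, swap_apply_of_ne_of_ne, ha, hb, hc]

lemma conj_swap (g : Perm α) (a b : α) : g * swap a b * g⁻¹ = swap (g a) (g b) := by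
  rw [mul_swap_eq_swap_mul, mul_inv_cancel_right]

lemma conj_cyc (g : Perm α) (a b c : α) :
    g * cyc a b c * g⁻¹ = cyc (g a) (g b) (g c) := by
  rw [cyc, cyc, ← conj_swap, ← conj_swap]; group

lemma cyc_swap {a b c : α} (hab : a ≠ b) (hac : a ≠ c) (hbc : b ≠ c) :
    cyc b a c = cyc a b c * cyc a b c := by
  ext x
  simp only [cyc, Perm.mul_apply, swap_apply_def]
  grind

lemma cyc_pow_three {a b c : α} (hab : a ≠ b) (hac : a ≠ c) (hbc : b ≠ c) :
    cyc a b c ^ 3 = 1 := by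
  rw [pow_succ, pow_two, ← cyc_swap hab hac hbc]
  ext x
  simp only [cyc, Perm.mul_apply, swap_apply_def, Perm.one_apply]
  grind

lemma conj_swap_mul_swap_cyc {a b c d e : α} (hab : a ≠ b) (hac : a ≠ c) (hbc : b ≠ c)
    (hd' : d ∉ ({a, b, c} : Finset α)) (he' : e ∉ ({a, b, c} : Finset α)) :
    swap a b * swap d e * cyc a b c * (swap a b * swap d e)⁻¹ = cyc a b c * cyc a b c := by
  rw [conj_cyc, ← cyc_swap hab hac hbc]
  simp only [Finset.mem_insert, Finset.mem_singleton, not_or] at hd' he'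
  simp only [Perm.mul_apply]
  rw [swap_apply_of_ne_of_ne (Ne.symm hd'.1) (Ne.symm he'.1),
    swap_apply_of_ne_of_ne (Ne.symm hd'.2.1) (Ne.symm he'.2.1),
    swap_apply_of_ne_of_ne (Ne.symm hd'.2.2) (Ne.symm he'.2.2),
    swap_apply_left, swap_apply_right, swap_apply_of_ne_of_ne hac.symm hbc.symm]

/-- A product of two transpositions is a product of 3-cycles. -/
lemma swap_mul_swap_mem (H : Subgroup (Perm α)) (F : Finset α)
    (h : ∀ a ∈ F, ∀ b ∈ F, ∀ c ∈ F, a ≠ b → a ≠ c → b ≠ c → cyc a b c ∈ H)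
    {a b c d : α} (ha : a ∈ F) (hb : b ∈ F) (hc : c ∈ F) (hd : d ∈ F)
    (hab : a ≠ b) (hcd : c ≠ d) : swap a b * swap c d ∈ H := by
  have key : ∀ a ∈ F, ∀ b ∈ F, ∀ c ∈ F, a ≠ b → b ≠ c → swap a b * swap b c ∈ H := by
    intro a ha b hb c hc hab hbc
    by_cases hac : a = c
    · subst hac
      rw [swap_comm b a, swap_mul_self]
      exact H.one_mem
    · exact h a ha b hb c hc hab hac hbc
  by_cases hbc : b = c
  · subst hbc
    exact key a ha b hb d hd hab hcd
  · have := H.mul_mem (key a ha b hb c hc hab hbc) (key b hb c hc d hd hbc hcd)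
    rwa [mul_assoc, ← mul_assoc (swap b c), swap_mul_self, one_mul] at this

end Permutations

/-- If `y` and `x` commute with `t` up to central elements and `x` conjugates `y` to `y ^ 2` up to
a central element, then `y` commutes with `t`. -/
lemma commute_of_commute_up_to_center {P : Type*} [Group P] {t y x z w k : P}
    (hz : ∀ g, Commute z g) (hw : ∀ g, Commute w g) (hk : ∀ g, Commute k g)
    (hy : y * t = z * (t * y)) (hx : x * t = w * (t * x)) (hxy : x * y = k * (y * y * x)) :
    y * t = t * y := by
  have h1 : x * y * t = z * w * k * (t * (y * y * x)) := by
    rw [mul_assoc, hy, ← mul_assoc x z, ← (hz x).eq, mul_assoc, ← mul_assoc x t, hx,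
      mul_assoc w, mul_assoc t, hxy, ← mul_assoc t k, ← (hk t).eq]
    simp only [mul_assoc]
  have h2 : x * y * t = z * w * k * (z * (t * (y * y * x))) := by
    calc x * y * t = k * (y * y * (x * t)) := by rw [hxy]; simp only [mul_assoc]
      _ = k * (w * (y * (y * t) * x)) := by
        rw [hx, ← mul_assoc (y * y) w, ← (hw (y * y)).eq]; simp only [mul_assoc]
      _ = k * (w * (z * ((y * t) * (y * x)))) := by
        conv_lhs => rw [hy, ← mul_assoc y z, ← (hz y).eq]
        simp only [mul_assoc]
      _ = k * (w * (z * (z * (t * (y * y * x))))) := by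
        rw [hy]; simp only [mul_assoc]
      _ = z * w * k * (z * (t * (y * y * x))) := by
        have : k * (w * z) = z * w * k := by
          rw [(hk _).eq, (hw z).eq]
        rw [← this]; simp only [mul_assoc]
  have h3 : z = 1 := by
    have := h1.symm.trans h2
    have := mul_left_cancel this
    exact (mul_right_cancel ((one_mul _).trans this)).symm
  rw [hy, h3, one_mul]

variable {α G K V : Type*} [DecidableEq α] [Group G] [Field K] [AddCommGroup V] [Module K V]

/-- `ρ` is a representation of a group `G` that maps to the permutations supported on `S`, whose
image contains all 3-cycles on `S`, such that the kernel of this map acts by scalars: a projective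
representation of the alternating group on `S`. -/
structure IsProjAlt (π : G →* Perm α) (ρ : Representation K G V) (S : Finset α) : Prop where
  apply_of_notMem : ∀ g, ∀ x ∉ S, π g x = x
  exists_cyc : ∀ a ∈ S, ∀ b ∈ S, ∀ c ∈ S, a ≠ b → a ≠ c → b ≠ c → ∃ g, π g = cyc a b c
  scalar : ∀ g, π g = 1 → ∃ r : K, ρ g = r • (1 : V →ₗ[K] V)

/-- `τ` is a normalized lift of the 3-cycle `a ↦ b ↦ c ↦ a`: every lift of an involution
`(a b)(d e)` conjugates it to its square. -/
structure IsGood (π : G →* Perm α) (ρ : Representation K G V) (S : Finset α) (a b c : α)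
    (τ : G) : Prop where
  ha : a ∈ S
  hb : b ∈ S
  hc : c ∈ S
  hab : a ≠ b
  hac : a ≠ c
  hbc : b ≠ c
  map_eq : π τ = cyc a b c
  sq : ∀ d ∈ S, ∀ e ∈ S, d ≠ e → d ∉ ({a, b, c} : Finset α) → e ∉ ({a, b, c} : Finset α) →
    ∀ x, π x = swap a b * swap d e → ρ x * ρ τ = ρ τ * ρ τ * ρ x

/-- The elements of `G` whose action commutes with that of `τ`. -/
def commutant (ρ : Representation K G V) (τ : G) : Subgroup G where
  carrier := {g | Commute (ρ g) (ρ τ)}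
  mul_mem' := fun {a b} ha hb => by
    simp only [Set.mem_ofPred_eq, map_mul] at *
    exact ha.mul_left hb
  one_mem' := by simp
  inv_mem' := fun {a} ha => by
    simp only [Set.mem_ofPred_eq] at *
    have h1 : ρ a⁻¹ * ρ a = 1 := by rw [← map_mul]; simp
    have h2 : ρ a * ρ a⁻¹ = 1 := by rw [← map_mul]; simp
    calc ρ a⁻¹ * ρ τ = ρ a⁻¹ * (ρ τ * ρ a) * ρ a⁻¹ := by
          rw [mul_assoc, mul_assoc, h2, mul_one]
      _ = ρ τ * ρ a⁻¹ := by rw [← ha.eq, ← mul_assoc, h1, one_mul]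

lemma mem_commutant {ρ : Representation K G V} {τ g : G} :
    g ∈ commutant ρ τ ↔ Commute (ρ g) (ρ τ) := Iff.rfl

namespace IsProjAlt

variable {π : G →* Perm α} {ρ : Representation K G V} {S : Finset α}

lemma mem_of_mem (h : IsProjAlt π ρ S) (g : G) {x : α} (hx : x ∈ S) : π g x ∈ S := by
  by_contra hn
  have := h.apply_of_notMem g _ hn
  rw [(π g).injective this] at hn
  exact hn hx

lemma exists_swap_mul_swap (h : IsProjAlt π ρ S) {a b c d : α} (ha : a ∈ S) (hb : b ∈ S)
    (hc : c ∈ S) (hd : d ∈ S) (hab : a ≠ b) (hcd : c ≠ d) : ∃ g, π g = swap a b * swap c d :=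
  swap_mul_swap_mem π.range S h.exists_cyc ha hb hc hd hab hcd

lemma central (h : IsProjAlt π ρ S) {g : G} (hg : π g = 1) (f : V →ₗ[K] V) :
    Commute (ρ g) f := by
  obtain ⟨r, hr⟩ := h.scalar g hg
  rw [hr]
  exact (Commute.one_left f).smul_left r

lemma exists_smul (h : IsProjAlt π ρ S) {g g' : G} (hg : π g = π g') :
    ∃ r : K, ρ g = r • ρ g' := by
  obtain ⟨r, hr⟩ := h.scalar (g * g'⁻¹) (by rw [map_mul, map_inv, hg, mul_inv_cancel])
  refine ⟨r, ?_⟩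
  rw [← one_mul (ρ g'), ← smul_mul_assoc, ← hr, ← map_mul, inv_mul_cancel_right]

lemma mem_commutant_of_map (h : IsProjAlt π ρ S) {τ g : G}
    (hg : π g ∈ (commutant ρ τ).map π) : g ∈ commutant ρ τ := by
  obtain ⟨y, hy, hyg⟩ := hg
  obtain ⟨r, hr⟩ := h.exists_smul hyg.symm
  rw [mem_commutant, hr]
  exact (mem_commutant.1 hy).smul_left r

/-- A lift of a 3-cycle commutes with `τ` as soon as `τ` fixes five points
including those moved by the 3-cycle. -/
lemma commute_of_cyc (h : IsProjAlt π ρ S) {τ y : G} {a b c d e : α}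
    (ha : a ∈ S) (hb : b ∈ S) (hd : d ∈ S) (he : e ∈ S)
    (hab : a ≠ b) (hac : a ≠ c) (hbc : b ≠ c) (hde : d ≠ e)
    (hd' : d ∉ ({a, b, c} : Finset α)) (he' : e ∉ ({a, b, c} : Finset α))
    (fa : π τ a = a) (fb : π τ b = b) (fc : π τ c = c) (fd : π τ d = d) (fe : π τ e = e)
    (hy : π y = cyc a b c) : y ∈ commutant ρ τ := by
  obtain ⟨x, hx⟩ := h.exists_swap_mul_swap ha hb hd he hab hde
  have comm : ∀ p q : Perm α, q * p * q⁻¹ = p → p * q = q * p := by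
    intro p q hpq
    rw [← hpq]; simpa [mul_assoc] using hpq.symm
  have hyt : π y * π τ = π τ * π y := by
    refine comm _ _ ?_
    rw [hy, conj_cyc, fa, fb, fc]
  have hxt : π x * π τ = π τ * π x := by
    refine comm _ _ ?_
    rw [hx]
    calc π τ * (swap a b * swap d e) * (π τ)⁻¹
        = (π τ * swap a b * (π τ)⁻¹) * (π τ * swap d e * (π τ)⁻¹) := by group
      _ = _ := by rw [conj_swap, conj_swap, fa, fb, fd, fe]
  have hxy : π x * π y = π y * π y * π x := by
    rw [← mul_inv_eq_iff_eq_mul, hy, hx, conj_swap_mul_swap_cyc hab hac hbc hd' he']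
  let f : G →* (V →ₗ[K] V)ˣ := ρ.toHomUnits
  have hf : ∀ g, ((f g : (V →ₗ[K] V)ˣ) : V →ₗ[K] V) = ρ g := fun g => rfl
  have cen : ∀ g, π g = 1 → ∀ u, Commute (f g) u := by
    intro g hg u
    exact Units.ext (h.central hg (u : V →ₗ[K] V)).eq
  have key : ∀ u v : G, π u = π v → f u = f (u * v⁻¹) * f v := by
    intro u v _
    rw [← map_mul, inv_mul_cancel_right]
  have k1 := key (y * τ) (τ * y) (by simpa using hyt)
  have k2 := key (x * τ) (τ * x) (by simpa using hxt)
  have k3 := key (x * y) (y * y * x) (by simpa using hxy)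
  have := commute_of_commute_up_to_center
    (cen (y * τ * (τ * y)⁻¹) (by simp only [map_mul, map_inv, hyt, mul_inv_cancel]))
    (cen (x * τ * (τ * x)⁻¹) (by simp only [map_mul, map_inv, hxt, mul_inv_cancel]))
    (cen (x * y * (y * y * x)⁻¹) (by simp only [map_mul, map_inv, hxy, mul_inv_cancel]))
    (t := f τ) (y := f y) (x := f x)
    (by simpa only [map_mul] using k1) (by simpa only [map_mul] using k2)
    (by simpa only [map_mul] using k3)
  exact congrArg Units.val this

/-- Products of two transpositions moving only points of a set `F` of at least five fixed points
of `τ` lift to elements commuting with `τ`. -/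
lemma cyc_mem_map_commutant (h : IsProjAlt π ρ S) {τ : G} {F : Finset α} (hFS : F ⊆ S)
    (hF : 5 ≤ F.card) (hτ : ∀ x ∈ F, π τ x = x) :
    ∀ a ∈ F, ∀ b ∈ F, ∀ c ∈ F, a ≠ b → a ≠ c → b ≠ c → cyc a b c ∈ (commutant ρ τ).map π := by
  intro a ha b hb c hc hab hac hbc
  obtain ⟨y, hy⟩ := h.exists_cyc a (hFS ha) b (hFS hb) c (hFS hc) hab hac hbc
  have : 1 < (F \ {a, b, c}).card := by
    have h1 := Finset.le_card_sdiff ({a, b, c} : Finset α) F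
    have h2 : ({a, b, c} : Finset α).card ≤ 3 := Finset.card_le_three
    omega
  obtain ⟨d, hd, e, he, hde⟩ := Finset.one_lt_card.1 this
  rw [Finset.mem_sdiff] at hd he
  exact ⟨y, h.commute_of_cyc (hFS ha) (hFS hb) (hFS hd.1) (hFS he.1) hab hac hbc hde hd.2 he.2
    (hτ a ha) (hτ b hb) (hτ c hc) (hτ d hd.1) (hτ e he.1) hy, hy⟩

lemma swap_mul_swap_mem_map_commutant (h : IsProjAlt π ρ S) {τ : G} {F : Finset α} (hFS : F ⊆ S)
    (hF : 5 ≤ F.card) (hτ : ∀ x ∈ F, π τ x = x) {a b c d : α} (ha : a ∈ F) (hb : b ∈ F)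
    (hc : c ∈ F) (hd : d ∈ F) (hab : a ≠ b) (hcd : c ≠ d) :
    swap a b * swap c d ∈ (commutant ρ τ).map π :=
  swap_mul_swap_mem _ F (h.cyc_mem_map_commutant hFS hF hτ) ha hb hc hd hab hcd

/-- If `x` conjugates the permutation of `τ` to its square, then `x` conjugates the
commutator `[x, τ]` to its square. -/
lemma commutator_sq (h : IsProjAlt π ρ S) {x τ : G} (hx : π x * π τ * (π x)⁻¹ = π τ * π τ) :
    π (x * τ * x⁻¹ * τ⁻¹) = π τ ∧
    ρ x * ρ (x * τ * x⁻¹ * τ⁻¹) =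
      ρ (x * τ * x⁻¹ * τ⁻¹) * ρ (x * τ * x⁻¹ * τ⁻¹) * ρ x := by
  have h1 : π (x * τ * x⁻¹ * τ⁻¹) = π τ := by
    simp only [map_mul, map_inv, hx, mul_inv_cancel_right]
  refine ⟨h1, ?_⟩
  obtain ⟨r, hr⟩ := h.exists_smul h1
  calc ρ x * ρ (x * τ * x⁻¹ * τ⁻¹) = r • ρ (x * τ) := by rw [hr, mul_smul_comm, map_mul]
    _ = r • ρ (x * τ * x⁻¹ * τ⁻¹ * τ * x) := by congr 2; group
    _ = ρ (x * τ * x⁻¹ * τ⁻¹) * (r • ρ τ) * ρ x := by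
      rw [map_mul, map_mul, mul_smul_comm, smul_mul_assoc]
    _ = _ := by rw [← hr]

/-- If `ρ τ` is conjugate to its square and `τ ^ k` acts as a scalar, then `ρ τ ^ k = 1`. -/
lemma pow_eq_one_of_sq (h : IsProjAlt π ρ S) {x τ : G} {k : ℕ} (hτ : π τ ^ k = 1)
    (hx : ρ x * ρ τ = ρ τ * ρ τ * ρ x) : ρ τ ^ k = 1 := by
  have hc : Commute (ρ x) (ρ τ ^ k) := by
    rw [← map_pow]
    exact (h.central (by rw [map_pow, hτ]) _).symm
  have h1 : ρ x * ρ τ ^ k = (ρ τ * ρ τ) ^ k * ρ x :=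
    SemiconjBy.pow_right (show SemiconjBy (ρ x) (ρ τ) (ρ τ * ρ τ) from hx) k
  rw [hc.eq, ← pow_two, ← pow_mul, mul_comm 2, pow_mul, pow_two] at h1
  have inv : ∀ g, ρ g * ρ g⁻¹ = 1 := fun g => by rw [← map_mul]; simp
  have h2 : ρ τ ^ k = ρ τ ^ k * ρ τ ^ k := by
    have := congrArg (· * ρ x⁻¹) h1
    simpa [mul_assoc, inv] using this
  have h3 := congrArg (ρ ((τ ^ k)⁻¹) * ·) h2
  have h4 : ρ ((τ ^ k)⁻¹) * ρ τ ^ k = 1 := by rw [← map_pow, ← map_mul]; simp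
  simp only [← mul_assoc, h4, one_mul] at h3
  exact h3.symm

lemma exists_isGood (h : IsProjAlt π ρ S) (hS : 8 ≤ S.card) {a b c : α} (ha : a ∈ S) (hb : b ∈ S)
    (hc : c ∈ S) (hab : a ≠ b) (hac : a ≠ c) (hbc : b ≠ c) : ∃ τ, IsGood π ρ S a b c τ := by
  have hF : 5 ≤ (S \ {a, b, c}).card := by
    have h1 := Finset.le_card_sdiff ({a, b, c} : Finset α) S
    have h2 : ({a, b, c} : Finset α).card ≤ 3 := Finset.card_le_three
    omega
  obtain ⟨d, hd, e, he, hde⟩ := Finset.one_lt_card.1 (show 1 < (S \ {a, b, c}).card by omega)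
  have hd' := Finset.mem_sdiff.1 hd
  have he' := Finset.mem_sdiff.1 he
  obtain ⟨τ, hτ⟩ := h.exists_cyc a ha b hb c hc hab hac hbc
  obtain ⟨x, hx⟩ := h.exists_swap_mul_swap ha hb hd'.1 he'.1 hab hde
  obtain ⟨h1, h2⟩ := h.commutator_sq (x := x) (τ := τ)
    (by rw [hx, hτ, conj_swap_mul_swap_cyc hab hac hbc hd'.2 he'.2])
  rw [hτ] at h1
  refine ⟨_, ha, hb, hc, hab, hac, hbc, h1, ?_⟩
  generalize x * τ * x⁻¹ * τ⁻¹ = σ at h1 h2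
  intro d' hd1 e' he1 hde1 hd2 he2 y hy
  have hz : x⁻¹ * y ∈ commutant ρ σ := by
    refine h.mem_commutant_of_map ?_
    have : π (x⁻¹ * y) = swap d e * swap d' e' := by
      rw [map_mul, map_inv, hx, hy, mul_inv_rev, swap_inv, swap_inv, mul_assoc,
        ← mul_assoc (swap a b), swap_mul_self, one_mul]
    rw [this]
    refine h.swap_mul_swap_mem_map_commutant Finset.sdiff_subset hF ?_ hd he
      (Finset.mem_sdiff.2 ⟨hd1, hd2⟩) (Finset.mem_sdiff.2 ⟨he1, he2⟩) hde hde1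
    intro z hz
    simp only [Finset.mem_sdiff, Finset.mem_insert, Finset.mem_singleton, not_or] at hz
    rw [h1, cyc_apply_of_ne hz.2.1 hz.2.2.1 hz.2.2.2]
  have e1 : ρ y = ρ x * ρ (x⁻¹ * y) := by rw [← map_mul, mul_inv_cancel_left]
  rw [e1, mul_assoc, (mem_commutant.1 hz).eq, ← mul_assoc, h2]
  simp only [mul_assoc]

end IsProjAlt

namespace IsGood

variable {π : G →* Perm α} {ρ : Representation K G V} {S : Finset α} {a b c : α} {τ : G}

lemma exists_sq (h : IsProjAlt π ρ S) (hS : 8 ≤ S.card) (hτ : IsGood π ρ S a b c τ) :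
    ∃ x, ρ x * ρ τ = ρ τ * ρ τ * ρ x := by
  have h1 := Finset.le_card_sdiff ({a, b, c} : Finset α) S
  have h2 : ({a, b, c} : Finset α).card ≤ 3 := Finset.card_le_three
  obtain ⟨d, hd, e, he, hde⟩ := Finset.one_lt_card.1 (show 1 < (S \ {a, b, c}).card by omega)
  have hd' := Finset.mem_sdiff.1 hd
  have he' := Finset.mem_sdiff.1 he
  obtain ⟨x, hx⟩ := h.exists_swap_mul_swap hτ.ha hτ.hb hd'.1 he'.1 hτ.hab hde
  exact ⟨x, hτ.sq d hd'.1 e he'.1 hde hd'.2 he'.2 x hx⟩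

lemma pow_three (h : IsProjAlt π ρ S) (hS : 8 ≤ S.card) (hτ : IsGood π ρ S a b c τ) :
    ρ τ ^ 3 = 1 := by
  obtain ⟨x, hx⟩ := hτ.exists_sq h hS
  exact h.pow_eq_one_of_sq (by rw [hτ.map_eq, cyc_pow_three hτ.hab hτ.hac hτ.hbc]) hx

lemma conj (h : IsProjAlt π ρ S) (hτ : IsGood π ρ S a b c τ) (g : G) :
    IsGood π ρ S (π g a) (π g b) (π g c) (g * τ * g⁻¹) where
  ha := h.mem_of_mem g hτ.ha
  hb := h.mem_of_mem g hτ.hb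
  hc := h.mem_of_mem g hτ.hc
  hab := (π g).injective.ne hτ.hab
  hac := (π g).injective.ne hτ.hac
  hbc := (π g).injective.ne hτ.hbc
  map_eq := by rw [map_mul, map_mul, map_inv, hτ.map_eq, conj_cyc]
  sq := by
    intro d hd e he hde hd' he' x hx
    have inj : ∀ u v, (π g)⁻¹ u = v ↔ u = π g v := fun u v => Perm.inv_eq_iff_eq
    have := hτ.sq ((π g)⁻¹ d) (by rw [← map_inv]; exact h.mem_of_mem _ hd) ((π g)⁻¹ e)
      (by rw [← map_inv]; exact h.mem_of_mem _ he) ((π g)⁻¹.injective.ne hde)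
      (by simpa only [Finset.mem_insert, Finset.mem_singleton, inj] using hd')
      (by simpa only [Finset.mem_insert, Finset.mem_singleton, inj] using he') (g⁻¹ * x * g) (by
        rw [map_mul, map_mul, map_inv, hx]
        have h1 := conj_swap (π g)⁻¹ (π g a) (π g b)
        have h2 := conj_swap (π g)⁻¹ d e
        rw [(inj _ _).2 rfl, (inj _ _).2 rfl] at h1
        rw [← h1, ← h2]
        group)
    simp only [← map_mul] at this ⊢
    have e1 : x * (g * τ * g⁻¹) = g * (g⁻¹ * x * g * τ) * g⁻¹ := by group
    have e2 : g * τ * g⁻¹ * (g * τ * g⁻¹) * x = g * (τ * τ * (g⁻¹ * x * g)) * g⁻¹ := by group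
    rw [e1, e2, map_mul, map_mul, this, ← map_mul, ← map_mul]

end IsGood

end AltPGL

namespace AltPGL

section LinearAlgebra

variable {K V : Type*} [Field K] [AddCommGroup V] [Module K V]

lemma add_self_eq_zero_of_charTwo (K : Type*) {V : Type*} [Field K] [CharP K 2] [AddCommGroup V]
    [Module K V] (v : V) : v + v = 0 := by
  rw [← two_smul K v, CharTwo.two_eq_zero, zero_smul]

lemma sum_orbit_eq_zero {T : V →ₗ[K] V} (hT : T ^ 3 = 1) (u : V) :
    T (T (T u - u)) + T (T u - u) + (T u - u) = 0 := by
  have : T (T (T u)) = u := by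
    have := LinearMap.congr_fun hT u
    simpa [pow_succ] using this
  simp only [map_sub, this]
  abel

variable [CharP K 2]

/-- An operator of order three has no nonzero fixed vectors in the range of `T - 1`. -/
lemma eq_zero_of_fixed {T : V →ₗ[K] V} (hT : T ^ 3 = 1) {u : V}
    (h : T (T u - u) = T u - u) : T u - u = 0 := by
  have := sum_orbit_eq_zero hT u
  rwa [h, h, add_self_eq_zero_of_charTwo K, zero_add] at this

lemma two_le_finrank_range [FiniteDimensional K V] {T X Y : V →ₗ[K] V} (hT : T ^ 3 = 1)
    (hT1 : T ≠ 1) (hYX : Y * X = 1) (hX : X * T = T * T * X) :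
    2 ≤ finrank K (LinearMap.range (T - 1)) := by
  by_contra hlt
  obtain ⟨⟨v, u, hu⟩, hv⟩ := finrank_le_one_iff.1
    (show finrank K (LinearMap.range (T - 1)) ≤ 1 by omega)
  have hv' : ∀ w, ∃ r : K, r • v = T w - w := fun w => by
    obtain ⟨r, hr⟩ := hv ⟨T w - w, w, by simp⟩
    exact ⟨r, congrArg Subtype.val hr⟩
  have hu' : T u - u = v := by simpa using hu
  have hXT : ∀ w, X (T w) = T (T (X w)) := fun w => LinearMap.congr_fun hX w
  apply hT1
  have hv0 : v = 0 := by
    by_contra hv0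
    obtain ⟨r, hr⟩ : ∃ r : K, T v = r • v := by
      obtain ⟨r, hr⟩ := hv' v
      exact ⟨r + 1, by rw [add_smul, one_smul, hr, sub_add_cancel]⟩
    obtain ⟨s, hs⟩ : ∃ s : K, X v = s • v := by
      obtain ⟨r1, hr1⟩ := hv' (X u)
      obtain ⟨r2, hr2⟩ := hv' (T (X u))
      refine ⟨r2 + r1, ?_⟩
      rw [add_smul, hr1, hr2, ← hu', map_sub, hXT]
      abel
    have hs0 : s ≠ 0 := by
      rintro rfl
      have h1 : Y (X v) = v := LinearMap.congr_fun hYX v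
      rw [hs, zero_smul, map_zero] at h1
      exact hv0 h1.symm
    have h1 := hXT v
    rw [hr, map_smul, hs, map_smul, map_smul, hr, map_smul, hr, smul_smul, smul_smul, smul_smul]
      at h1
    have h2 := smul_left_injective K hv0 h1
    have h3 : r ≠ 0 := by
      rintro rfl
      have := LinearMap.congr_fun hT v
      rw [pow_succ] at this
      simp [hr] at this
      exact hv0 this.symm
    have h4 : r = 1 := by
      have : r * s = r * (r * s) := by linear_combination h2
      have := mul_left_cancel₀ h3 this
      exact (mul_right_cancel₀ hs0 ((one_mul s).trans this)).symm
    apply hv0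
    rw [← hu']
    exact eq_zero_of_fixed hT (by rw [hu', hr, h4, one_smul])
  ext w
  obtain ⟨r, hr⟩ := hv' w
  rw [hv0, smul_zero] at hr
  simpa using (sub_eq_zero.1 hr.symm)

end LinearAlgebra

variable {α G K V : Type*} [DecidableEq α] [Group G] [Field K] [AddCommGroup V]
  [Module K V]

/-- A projective representation of the alternating group on `S` of degree at most `|S| - 2` in
which normalized lifts of 3-cycles act nontrivially but act trivially on the commutator spaces of
disjoint 3-cycles. -/
structure IsSmall (π : G →* Perm α) (ρ : Representation K G V) (S : Finset α) : Prop
    extends IsProjAlt π ρ S where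
  card : 9 ≤ S.card
  finrank_le : finrank K V + 2 ≤ S.card
  ne_one : ∀ a b c τ, IsGood π ρ S a b c τ → ρ τ ≠ 1
  fixes : ∀ a b c τ x y z σ, IsGood π ρ S a b c τ → IsGood π ρ S x y z σ →
    Disjoint ({a, b, c} : Finset α) {x, y, z} → ∀ u, ρ σ (ρ τ u - u) = ρ τ u - u

/-- The span of the commutator spaces of the 3-cycles on `R`. -/
def comm (π : G →* Perm α) (ρ : Representation K G V) (S R : Finset α) : Submodule K V :=
  Submodule.span K {v | ∃ a b c τ u, IsGood π ρ S a b c τ ∧ a ∈ R ∧ b ∈ R ∧ c ∈ R ∧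
    ρ τ u - u = v}

variable {π : G →* Perm α} {ρ : Representation K G V} {S R : Finset α}

lemma comm_mono {R' : Finset α} (hR : R ⊆ R') : comm π ρ S R ≤ comm π ρ S R' := by
  refine Submodule.span_mono ?_
  rintro v ⟨a, b, c, τ, u, hτ, ha, hb, hc, rfl⟩
  exact ⟨a, b, c, τ, u, hτ, hR ha, hR hb, hR hc, rfl⟩

lemma sub_mem_comm {a b c : α} {τ : G} (hτ : IsGood π ρ S a b c τ) (ha : a ∈ R) (hb : b ∈ R)
    (hc : c ∈ R) (u : V) : ρ τ u - u ∈ comm π ρ S R :=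
  Submodule.subset_span ⟨a, b, c, τ, u, hτ, ha, hb, hc, rfl⟩

lemma range_le_comm {a b c : α} {σ : G} (hσ : IsGood π ρ S a b c σ) (ha : a ∈ R) (hb : b ∈ R)
    (hc : c ∈ R) : LinearMap.range (ρ σ - 1) ≤ comm π ρ S R := by
  rintro _ ⟨u, rfl⟩
  exact sub_mem_comm hσ ha hb hc u

lemma rep_injective (g : G) : Function.Injective (ρ g) := by
  intro u v huv
  simpa using congrArg (ρ g⁻¹) huv

namespace IsSmall

lemma exists_notMem (h : IsSmall π ρ S) (X : Finset α) (hX : X.card ≤ 8) : ∃ x ∈ S, x ∉ X :=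
  Finset.exists_mem_notMem_of_card_lt_card (lt_of_le_of_lt hX h.card)

lemma good (h : IsSmall π ρ S) {a b c : α} (ha : a ∈ S) (hb : b ∈ S) (hc : c ∈ S) (hab : a ≠ b)
    (hac : a ≠ c) (hbc : b ≠ c) : ∃ τ, IsGood π ρ S a b c τ :=
  h.exists_isGood (le_trans (by norm_num) h.card) ha hb hc hab hac hbc

lemma pow_three (h : IsSmall π ρ S) {a b c : α} {τ : G} (hτ : IsGood π ρ S a b c τ) :
    ρ τ ^ 3 = 1 :=
  hτ.pow_three h.toIsProjAlt (le_trans (by norm_num) h.card)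

lemma smul_mem_comm (h : IsSmall π ρ S) (g : G) {v : V} (hv : v ∈ comm π ρ S R) :
    ρ g v ∈ comm π ρ S (R.image (π g)) := by
  induction hv using Submodule.span_induction with
  | mem v hv =>
    obtain ⟨a, b, c, τ, u, hτ, ha, hb, hc, rfl⟩ := hv
    have : ρ g (ρ τ u - u) = ρ (g * τ * g⁻¹) (ρ g u) - ρ g u := by
      rw [map_sub, ← Module.End.mul_apply, ← Module.End.mul_apply, ← map_mul, ← map_mul]
      congr 3
      group
    rw [this]
    exact sub_mem_comm (hτ.conj h.toIsProjAlt g) (Finset.mem_image_of_mem _ ha)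
      (Finset.mem_image_of_mem _ hb) (Finset.mem_image_of_mem _ hc) _
  | zero => simp
  | add x y _ _ hx hy => rw [map_add]; exact add_mem hx hy
  | smul r x _ hx => rw [map_smul]; exact Submodule.smul_mem _ _ hx

lemma fixed_of_mem_comm (h : IsSmall π ρ S) {x y z : α} {σ : G} (hσ : IsGood π ρ S x y z σ)
    (hx : x ∉ R) (hy : y ∉ R) (hz : z ∉ R) {v : V} (hv : v ∈ comm π ρ S R) : ρ σ v = v := by
  induction hv using Submodule.span_induction with
  | mem v hv =>
    obtain ⟨a, b, c, τ, u, hτ, ha, hb, hc, rfl⟩ := hv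
    refine h.fixes a b c τ x y z σ hτ hσ ?_ u
    rw [Finset.disjoint_right]
    intro w hw hw'
    simp only [Finset.mem_insert, Finset.mem_singleton] at hw hw'
    grind
  | zero => simp
  | add x y _ _ hx hy => rw [map_add, hx, hy]
  | smul r x _ hx => rw [map_smul, hx]

variable [CharP K 2]

/-- The commutator space of a 3-cycle meeting `R` in two points is not contained in
that of `R`. -/
lemma not_comm_le (h : IsSmall π ρ S) (hR : R.card + 3 ≤ S.card) {x y a : α}
    (hxS : x ∈ S) (hyS : y ∈ S) (hx : x ∈ R) (hy : y ∈ R) (hxy : x ≠ y) (haS : a ∈ S) (ha : a ∉ R) :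
    ¬ comm π ρ S {x, y, a} ≤ comm π ρ S R := by
  intro hle
  have pick : ∀ X : Finset α, X.card ≤ 2 → ∃ e ∈ S, e ∉ R ∪ X := fun X hX =>
    Finset.exists_mem_notMem_of_card_lt_card
      (lt_of_le_of_lt (Finset.card_union_le R X) (by omega))
  have all : ∀ m ∈ S, comm π ρ S {x, y, m} ≤ comm π ρ S R := by
    intro m hm
    by_cases hmR : m ∈ R
    · refine comm_mono ?_
      intro w hw
      simp only [Finset.mem_insert, Finset.mem_singleton] at hw
      grind
    by_cases hma : m = a
    · rwa [hma]
    obtain ⟨e, heS, he⟩ := pick {a, m} Finset.card_le_two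
    simp only [Finset.mem_union, Finset.mem_insert, Finset.mem_singleton, not_or] at he
    obtain ⟨σ, hσ⟩ := h.good hm haS heS hma (Ne.symm he.2.2) (Ne.symm he.2.1)
    intro v hv
    have h1 := h.smul_mem_comm σ hv
    have h2 : ({x, y, m} : Finset α).image (π σ) = {x, y, a} := by
      rw [hσ.map_eq, Finset.image_insert, Finset.image_insert, Finset.image_singleton,
        cyc_apply_left hσ.hab hσ.hac, cyc_apply_of_ne, cyc_apply_of_ne] <;> grind
    rw [h2] at h1
    have h3 := hle h1
    have h4 := rep_injective σ (h.fixed_of_mem_comm hσ hmR ha he.1 h3)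
    rwa [← h4]
  have inv : ∀ p q r σ, IsGood π ρ S p q r σ → ∀ m ∈ S, p ∈ ({x, y, m} : Finset α) →
      q ∈ ({x, y, m} : Finset α) → r ∈ ({x, y, m} : Finset α) →
      ∀ v, ρ σ v ∈ comm π ρ S R → v ∈ comm π ρ S R := by
    intro p q r σ hσ m hm hp hq hr v hv
    have := sub_mem hv (all m hm (sub_mem_comm hσ hp hq hr v))
    rwa [sub_sub_cancel] at this
  obtain ⟨b, hbS, hb⟩ := pick {a} (by simp)
  obtain ⟨c, hcS, hc⟩ := pick {a, b} Finset.card_le_two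
  simp only [Finset.mem_union, Finset.mem_insert, Finset.mem_singleton, not_or] at hb hc
  obtain ⟨σ₁, h₁⟩ := h.good hxS hcS hyS (by grind) hxy (by grind)
  obtain ⟨σ₂, h₂⟩ := h.good hbS hyS hxS (by grind) (by grind) hxy.symm
  have sub : comm π ρ S {a, b, c} ≤ comm π ρ S R := by
    intro v hv
    refine inv _ _ _ _ h₁ c hcS (by simp) (by simp) (by simp) _ ?_
    refine inv _ _ _ _ h₂ b hbS (by simp) (by simp) (by simp) _ ?_
    refine all a haS ?_
    have := h.smul_mem_comm σ₂ (h.smul_mem_comm σ₁ hv)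
    have e1 : (({a, b, c} : Finset α).image (π σ₁)).image (π σ₂) = {x, y, a} := by
      simp only [h₁.map_eq, h₂.map_eq, Finset.image_insert, Finset.image_singleton]
      rw [cyc_apply_mid h₁.hac h₁.hbc, cyc_apply_of_ne (x := a), cyc_apply_of_ne (x := b),
        cyc_apply_of_ne (x := a), cyc_apply_left h₂.hab h₂.hac, cyc_apply_mid h₂.hac h₂.hbc] <;>
        first | grind | (ext w; simp only [Finset.mem_insert, Finset.mem_singleton]; tauto)
    rwa [e1] at this
  obtain ⟨σ, hσ⟩ := h.good haS hbS hcS (by grind) (by grind) (by grind)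
  refine h.ne_one a b c σ hσ ?_
  ext u
  have h1 := sub (sub_mem_comm hσ (by simp) (by simp) (by simp) u)
  have h2 := h.fixed_of_mem_comm hσ ha hb.1 hc.1 h1
  simpa using sub_eq_zero.1 (eq_zero_of_fixed (h.pow_three hσ) h2)

variable [FiniteDimensional K V]

lemma two_le_finrank_range (h : IsSmall π ρ S) {a b c : α} {σ : G} (hσ : IsGood π ρ S a b c σ) :
    2 ≤ finrank K (LinearMap.range (ρ σ - 1)) := by
  obtain ⟨x, hx⟩ := hσ.exists_sq h.toIsProjAlt (le_trans (by norm_num) h.card)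
  exact AltPGL.two_le_finrank_range (h.pow_three hσ) (h.ne_one _ _ _ _ hσ)
    (Y := ρ x⁻¹) (X := ρ x) (by rw [← map_mul]; simp) hx

lemma comm_lt_insert (h : IsSmall π ρ S) (hRS : R ⊆ S) (hR2 : 2 ≤ R.card)
    (hR : R.card + 3 ≤ S.card) {a : α} (haS : a ∈ S) (ha : a ∉ R) :
    finrank K (comm π ρ S R) < finrank K (comm π ρ S (insert a R)) := by
  obtain ⟨x, hx, y, hy, hxy⟩ := Finset.one_lt_card.1 (show 1 < R.card by omega)
  refine Submodule.finrank_lt_finrank_of_lt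
    (lt_of_le_not_ge (comm_mono (Finset.subset_insert _ _)) ?_)
  intro hle
  refine h.not_comm_le hR (hRS hx) (hRS hy) hx hy hxy haS ha ((comm_mono ?_).trans hle)
  intro w hw
  simp only [Finset.mem_insert, Finset.mem_singleton] at hw ⊢
  grind

lemma exists_superset (h : IsSmall π ρ S) (hRS : R ⊆ S) (hR2 : 2 ≤ R.card) (k : ℕ)
    (hk : R.card + k + 3 ≤ S.card) : ∃ R' ⊆ S, R'.card = R.card + k ∧
      finrank K (comm π ρ S R) + k ≤ finrank K (comm π ρ S R') := by
  induction k with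
  | zero => exact ⟨R, hRS, rfl, le_rfl⟩
  | succ k ih =>
    obtain ⟨R', hR'S, hc, hle⟩ := ih (by omega)
    obtain ⟨a, haS, ha⟩ := Finset.exists_mem_notMem_of_card_lt_card (show R'.card < S.card by omega)
    refine ⟨insert a R', Finset.insert_subset haS hR'S, ?_, ?_⟩
    · rw [Finset.card_insert_of_notMem ha, hc]; rfl
    · have := h.comm_lt_insert hR'S (by omega) (by omega) haS ha
      omega

lemma finrank_comm_lt (h : IsSmall π ρ S) (hRS : R ⊆ S) (hR2 : 2 ≤ R.card)
    (hR : R.card + 3 ≤ S.card) : finrank K (comm π ρ S R) < R.card := by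
  obtain ⟨R', hR'S, hc, hle⟩ := h.exists_superset hRS hR2 (S.card - 3 - R.card) (by omega)
  have h3 : (S \ R').card = 3 := by
    rw [Finset.card_sdiff_of_subset hR'S]; omega
  obtain ⟨a, b, c, hab, hac, hbc, habc⟩ := Finset.card_eq_three.1 h3
  have ha : a ∈ S \ R' := by simp [habc]
  have hb : b ∈ S \ R' := by simp [habc]
  have hc' : c ∈ S \ R' := by simp [habc]
  rw [Finset.mem_sdiff] at ha hb hc'
  obtain ⟨σ, hσ⟩ := h.good ha.1 hb.1 hc'.1 hab hac hbc
  have hd : Disjoint (comm π ρ S R') (LinearMap.range (ρ σ - 1)) := by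
    rw [Submodule.disjoint_def]
    rintro _ hv ⟨u, rfl⟩
    exact eq_zero_of_fixed (h.pow_three hσ) (h.fixed_of_mem_comm hσ ha.2 hb.2 hc'.2 hv)
  have h1 := Submodule.finrank_add_finrank_le_of_disjoint hd
  have h2 := h.two_le_finrank_range hσ
  have h4 := h.finrank_le
  omega

lemma finrank_comm_three (h : IsSmall π ρ S) {i j k : α} (hi : i ∈ S) (hj : j ∈ S) (hk : k ∈ S)
    (hij : i ≠ j) (hik : i ≠ k) (hjk : j ≠ k) : finrank K (comm π ρ S {i, j, k}) = 2 := by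
  have hc : ({i, j, k} : Finset α).card = 3 := Finset.card_eq_three.2 ⟨i, j, k, hij, hik, hjk, rfl⟩
  have h9 := h.card
  have h1 := h.finrank_comm_lt (R := {i, j, k}) (by intro w; simp; grind) (by omega) (by omega)
  obtain ⟨σ, hσ⟩ := h.good hi hj hk hij hik hjk
  have h2 := h.two_le_finrank_range hσ
  have h3 := Submodule.finrank_mono
    (range_le_comm (R := {i, j, k}) hσ (by simp) (by simp) (by simp))
  omega

lemma eq_zero_of_mem_comm_three (h : IsSmall π ρ S) {i j k : α} {σ : G}
    (hσ : IsGood π ρ S i j k σ) {v : V} (hv : v ∈ comm π ρ S {i, j, k}) (hf : ρ σ v = v) :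
    v = 0 := by
  have h1 := range_le_comm (R := {i, j, k}) hσ (by simp) (by simp) (by simp)
  have h2 := Submodule.eq_of_le_of_finrank_le h1
    (by rw [h.finrank_comm_three hσ.ha hσ.hb hσ.hc hσ.hab hσ.hac hσ.hbc]
        exact h.two_le_finrank_range hσ)
  rw [← h2] at hv
  obtain ⟨u, rfl⟩ := hv
  exact eq_zero_of_fixed (h.pow_three hσ) hf

lemma finrank_comm_inf (h : IsSmall π ρ S) {i j k l : α} (hi : i ∈ S) (hj : j ∈ S) (hk : k ∈ S)
    (hl : l ∈ S) (hij : i ≠ j) (hik : i ≠ k) (hil : i ≠ l) (hjk : j ≠ k) (hjl : j ≠ l)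
    (hkl : k ≠ l) :
    finrank K ↥(comm π ρ S {i, j, k} ⊓ comm π ρ S {i, j, l}) = 1 := by
  have h9 := h.card
  have hc : ({i, j, k, l} : Finset α).card = 4 := by
    simp [hij, hik, hil, hjk, hjl, hkl]
  have hc3 : ({i, j, k} : Finset α).card = 3 := Finset.card_eq_three.2 ⟨i, j, k, hij, hik, hjk, rfl⟩
  have h1 := h.finrank_comm_lt (R := {i, j, k, l}) (by intro w; simp; grind) (by omega) (by omega)
  have h2 := h.finrank_comm_three hi hj hk hij hik hjk
  have h3 := h.finrank_comm_three hi hj hl hij hil hjl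
  have h4 := Submodule.finrank_sup_add_finrank_inf_eq (comm π ρ S {i, j, k}) (comm π ρ S {i, j, l})
  have h5 : comm π ρ S {i, j, k} ⊔ comm π ρ S {i, j, l} ≤ comm π ρ S {i, j, k, l} :=
    sup_le (comm_mono (by intro w; simp; grind)) (comm_mono (by intro w; simp; grind))
  have h6 := Submodule.finrank_mono h5
  have h7 : finrank K (comm π ρ S {i, j, k}) <
      finrank K ↥(comm π ρ S {i, j, k} ⊔ comm π ρ S {i, j, l}) := by
    refine Submodule.finrank_lt_finrank_of_lt (lt_of_le_not_ge le_sup_left ?_)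
    intro hle
    refine h.not_comm_le (R := {i, j, k}) (by omega) hi hj (by simp) (by simp) hij hl ?_
      (le_sup_right.trans hle)
    simp; grind
  omega

lemma comm_inf_le (h : IsSmall π ρ S) {i j k l m : α} (hi : i ∈ S) (hj : j ∈ S) (hk : k ∈ S)
    (hl : l ∈ S) (hm : m ∈ S) (hij : i ≠ j) (hik : i ≠ k) (hil : i ≠ l) (him : i ≠ m) (hjk : j ≠ k)
    (hjl : j ≠ l) (hjm : j ≠ m) (hkl : k ≠ l) (hkm : k ≠ m) (hlm : l ≠ m) :
    comm π ρ S {i, j, k} ⊓ comm π ρ S {i, j, l} ≤ comm π ρ S {i, j, m} := by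
  have h9 := h.card
  have hAB := h.finrank_comm_inf hi hj hk hl hij hik hil hjk hjl hkl
  have hAC := h.finrank_comm_inf hi hj hk hm hij hik him hjk hjm hkm
  have hBC := h.finrank_comm_inf hi hj hl hm hij hil him hjl hjm hlm
  have hC := h.finrank_comm_three hi hj hm hij him hjm
  have hcard : ({i, j, k, l} : Finset α).card ≤ 4 := Finset.card_le_four
  have hnot := h.not_comm_le (R := {i, j, k, l}) (by omega) hi hj (by simp) (by simp) hij hm
    (by simp; grind)
  have hsup : comm π ρ S {i, j, k} ⊔ comm π ρ S {i, j, l} ≤ comm π ρ S {i, j, k, l} :=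
    sup_le (comm_mono (by intro w; simp; grind)) (comm_mono (by intro w; simp; grind))
  generalize comm π ρ S {i, j, k} = A at *
  generalize comm π ρ S {i, j, l} = B at *
  generalize comm π ρ S {i, j, m} = C at *
  have hlt : finrank K ↥((A ⊔ B) ⊓ C) < finrank K C :=
    Submodule.finrank_lt_finrank_of_lt (lt_of_le_not_ge inf_le_right
      fun hle => hnot ((le_inf_iff.1 hle).1.trans hsup))
  have e1 : A ⊓ C = (A ⊔ B) ⊓ C :=
    Submodule.eq_of_le_of_finrank_le (inf_le_inf_right _ le_sup_left) (by omega)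
  have e2 : B ⊓ C = (A ⊔ B) ⊓ C :=
    Submodule.eq_of_le_of_finrank_le (inf_le_inf_right _ le_sup_right) (by omega)
  have e3 : A ⊓ C ≤ A ⊓ B := le_inf inf_le_left ((e1.trans e2.symm).le.trans inf_le_left)
  have e4 := Submodule.eq_of_le_of_finrank_le e3 (by omega)
  exact e4.ge.trans inf_le_right

end IsSmall

end AltPGL

namespace AltPGL

variable {α G K V : Type*} [DecidableEq α] [Group G] [Field K] [AddCommGroup V]
  [Module K V]

/-- The intersection of the commutator spaces of all 3-cycles moving `i` and `j`. -/
def line (π : G →* Perm α) (ρ : Representation K G V) (S : Finset α) (i j : α) : Submodule K V :=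
  ⨅ k ∈ S \ {i, j}, comm π ρ S {i, j, k}

variable {π : G →* Perm α} {ρ : Representation K G V} {S : Finset α}

lemma mem_line {i j : α} {v : V} :
    v ∈ line π ρ S i j ↔ ∀ k ∈ S, k ≠ i → k ≠ j → v ∈ comm π ρ S {i, j, k} := by
  simp [line, Submodule.mem_iInf]

lemma line_comm (i j : α) : line π ρ S i j = line π ρ S j i := by
  rw [line, line, Finset.pair_comm]
  simp only [Finset.insert_comm j i]

namespace IsSmall

lemma smul_mem_line (h : IsSmall π ρ S) (g : G) {i j : α} {v : V} (hv : v ∈ line π ρ S i j) :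
    ρ g v ∈ line π ρ S (π g i) (π g j) := by
  rw [mem_line] at hv ⊢
  intro k hk hki hkj
  have e : π g (π g⁻¹ k) = k := by simp
  have := h.smul_mem_comm g (hv (π g⁻¹ k) (h.mem_of_mem _ hk) (by rintro rfl; exact hki e.symm)
    (by rintro rfl; exact hkj e.symm))
  rwa [Finset.image_insert, Finset.image_insert, Finset.image_singleton, e] at this

lemma fixed_of_mem_line (h : IsSmall π ρ S) {x y z : α} {σ : G} (hσ : IsGood π ρ S x y z σ)
    {i j : α} (hi : i ∉ ({x, y, z} : Finset α)) (hj : j ∉ ({x, y, z} : Finset α)) {v : V}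
    (hv : v ∈ line π ρ S i j) : ρ σ v = v := by
  obtain ⟨k, hkS, hk⟩ := h.exists_notMem {i, j, x, y, z} (Finset.card_le_five.trans (by norm_num))
  simp only [Finset.mem_insert, Finset.mem_singleton, not_or] at hk hi hj
  refine h.fixed_of_mem_comm hσ ?_ ?_ ?_ (mem_line.1 hv k hkS hk.1 hk.2.1) <;>
    (simp only [Finset.mem_insert, Finset.mem_singleton, not_or]; grind)

variable [CharP K 2] [FiniteDimensional K V]

lemma mem_line_of_mem_comm (h : IsSmall π ρ S) {i j k l : α} (hi : i ∈ S) (hj : j ∈ S) (hk : k ∈ S)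
    (hl : l ∈ S) (hij : i ≠ j) (hik : i ≠ k) (hil : i ≠ l) (hjk : j ≠ k) (hjl : j ≠ l)
    (hkl : k ≠ l) {v : V} (hvk : v ∈ comm π ρ S {i, j, k}) (hvl : v ∈ comm π ρ S {i, j, l}) :
    v ∈ line π ρ S i j := by
  rw [mem_line]
  intro m hm hmi hmj
  by_cases hmk : m = k
  · rwa [hmk]
  by_cases hml : m = l
  · rwa [hml]
  exact h.comm_inf_le hi hj hk hl hm hij hik hil hmi.symm hjk hjl hmj.symm hkl (Ne.symm hmk)
    (Ne.symm hml) ⟨hvk, hvl⟩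

lemma finrank_line (h : IsSmall π ρ S) {i j : α} (hi : i ∈ S) (hj : j ∈ S) (hij : i ≠ j) :
    finrank K (line π ρ S i j) = 1 := by
  obtain ⟨k, hkS, hk⟩ := h.exists_notMem {i, j} (Finset.card_le_two.trans (by norm_num))
  obtain ⟨l, hlS, hl⟩ := h.exists_notMem {i, j, k} (Finset.card_le_three.trans (by norm_num))
  simp only [Finset.mem_insert, Finset.mem_singleton, not_or] at hk hl
  suffices line π ρ S i j = comm π ρ S {i, j, k} ⊓ comm π ρ S {i, j, l} by
    rw [this, h.finrank_comm_inf hi hj hkS hlS hij (Ne.symm hk.1) (Ne.symm hl.1) (Ne.symm hk.2)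
      (Ne.symm hl.2.1) (Ne.symm hl.2.2)]
  ext v
  refine ⟨fun hv => ⟨mem_line.1 hv k hkS hk.1 hk.2, mem_line.1 hv l hlS hl.1 hl.2.1⟩,
    fun hv => h.mem_line_of_mem_comm hi hj hkS hlS hij (Ne.symm hk.1) (Ne.symm hl.1) (Ne.symm hk.2)
    (Ne.symm hl.2.1) (Ne.symm hl.2.2) hv.1 hv.2⟩

lemma exists_smul_eq_of_mem_line (h : IsSmall π ρ S) {i j : α} (hi : i ∈ S) (hj : j ∈ S)
    (hij : i ≠ j) {u v : V} (hu : u ∈ line π ρ S i j) (hv : v ∈ line π ρ S i j) (hu0 : u ≠ 0) :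
    ∃ r : K, v = r • u := by
  obtain ⟨r, hr⟩ := exists_smul_eq_of_finrank_eq_one (h.finrank_line hi hj hij) (x := ⟨u, hu⟩)
    (by simpa [Subtype.ext_iff] using hu0) ⟨v, hv⟩
  exact ⟨r, (congrArg Subtype.val hr).symm⟩

lemma eq_zero_of_mem_line (h : IsSmall π ρ S) {i j k : α} (hi : i ∈ S) (hj : j ∈ S) (hk : k ∈ S)
    (hij : i ≠ j) (hik : i ≠ k) (hjk : j ≠ k) {v : V} (hvj : v ∈ line π ρ S i j)
    (hvk : v ∈ line π ρ S i k) : v = 0 := by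
  by_contra hv0
  have hA : ∀ m ∈ S, m ≠ i → v ∈ line π ρ S i m := by
    intro m hm hmi
    by_cases hmj : m = j
    · rwa [hmj]
    by_cases hmk : m = k
    · rwa [hmk]
    obtain ⟨p, hpS, hp⟩ := h.exists_notMem {i, j, k, m} (Finset.card_le_four.trans (by norm_num))
    simp only [Finset.mem_insert, Finset.mem_singleton, not_or] at hp
    obtain ⟨σ, hσ⟩ := h.good hk hm hpS (Ne.symm hmk) (by grind) (by grind)
    have h1 := h.smul_mem_line σ hvk
    rwa [h.fixed_of_mem_line hσ (i := i) (j := j) (by simp; grind) (by simp; grind) hvj, hσ.map_eq,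
      cyc_apply_of_ne hik hmi.symm (by grind), cyc_apply_left hσ.hab hσ.hac] at h1
  have hB : ∀ l ∈ S, ∀ m ∈ S, l ≠ i → m ≠ i → l ≠ m → v ∈ line π ρ S l m := by
    intro l hl m hm hli hmi hlm
    obtain ⟨τ, hτ⟩ := h.good hi hl hm hli.symm hmi.symm hlm
    have h1 := h.smul_mem_line τ (hA l hl hli)
    have h2 := h.smul_mem_line τ (hA m hm hmi)
    rw [hτ.map_eq, cyc_apply_left hτ.hab hτ.hac] at h1 h2
    rw [cyc_apply_mid hτ.hac hτ.hbc] at h1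
    rw [cyc_apply_right, line_comm] at h2
    obtain ⟨r, hr⟩ := h.exists_smul_eq_of_mem_line hi hl hli.symm (hA l hl hli) h2 hv0
    have hr0 : r ≠ 0 := by
      rintro rfl
      rw [zero_smul] at hr
      exact hv0 (rep_injective τ (hr.trans (map_zero _).symm))
    rw [hr] at h1
    exact (Submodule.smul_mem_iff _ hr0).1 h1
  obtain ⟨σ, hσ⟩ := h.good hi hj hk hij hik hjk
  obtain ⟨l, hlS, hl⟩ := h.exists_notMem {i, j, k} (Finset.card_le_three.trans (by norm_num))
  obtain ⟨m, hmS, hm⟩ := h.exists_notMem {i, j, k, l} (Finset.card_le_four.trans (by norm_num))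
  simp only [Finset.mem_insert, Finset.mem_singleton, not_or] at hm
  have hl' := hl
  simp only [Finset.mem_insert, Finset.mem_singleton, not_or] at hl'
  refine hv0 (h.eq_zero_of_mem_comm_three hσ (mem_line.1 hvj k hk hik.symm hjk.symm) ?_)
  exact h.fixed_of_mem_line hσ hl (by simp; grind)
    (hB l hlS m hmS hl'.1 hm.1 (Ne.symm hm.2.2.2))

lemma exists_add_eq_of_mem_comm (h : IsSmall π ρ S) {i j k : α} (hi : i ∈ S) (hj : j ∈ S)
    (hk : k ∈ S) (hij : i ≠ j) (hik : i ≠ k) (hjk : j ≠ k) {v : V}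
    (hv : v ∈ comm π ρ S {i, j, k}) :
    ∃ a ∈ line π ρ S i k, ∃ b ∈ line π ρ S j k, a + b = v := by
  have hd : Disjoint (line π ρ S i k) (line π ρ S j k) := by
    rw [Submodule.disjoint_def]
    intro u hu hu'
    rw [line_comm] at hu hu'
    exact h.eq_zero_of_mem_line hk hi hj hik.symm hjk.symm hij hu hu'
  have hle : line π ρ S i k ⊔ line π ρ S j k ≤ comm π ρ S {i, j, k} := by
    refine sup_le (fun u hu => ?_) (fun u hu => ?_)
    · have := mem_line.1 hu j hj hij.symm hjk
      rwa [Finset.pair_comm] at this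
    · have := mem_line.1 hu i hi hij hik
      rwa [Finset.pair_comm k, Finset.insert_comm] at this
  have h1 := Submodule.finrank_sup_add_finrank_inf_eq (line π ρ S i k) (line π ρ S j k)
  rw [hd.eq_bot, finrank_bot, h.finrank_line hi hk hik, h.finrank_line hj hk hjk] at h1
  rw [← Submodule.eq_of_le_of_finrank_le hle
    (by rw [h.finrank_comm_three hi hj hk hij hik hjk]; omega)] at hv
  exact Submodule.mem_sup.1 hv

end IsSmall

/-- A choice of vectors on the lines through `b` such that the sum of two of them is on the line
through the other two points. -/
structure IsFrame (π : G →* Perm α) (ρ : Representation K G V) (S : Finset α) (b : α) (w : α → V) :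
    Prop where
  mem : b ∈ S
  mem_line : ∀ j ∈ S, j ≠ b → w j ∈ line π ρ S b j
  ne_zero : ∀ j ∈ S, j ≠ b → w j ≠ 0
  add_mem : ∀ i ∈ S, ∀ j ∈ S, i ≠ b → j ≠ b → i ≠ j → w i + w j ∈ line π ρ S i j

namespace IsFrame

variable [CharP K 2] [FiniteDimensional K V] {b : α} {w : α → V}

lemma smul_eq (hw : IsFrame π ρ S b w) (h : IsSmall π ρ S) {p q r : α} {σ : G}
    (hσ : IsGood π ρ S p q r σ) (hp : p ≠ b) (hq : q ≠ b) (hr : r ≠ b) {x : α} (hx : x ∈ S)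
    (hxb : x ≠ b) : ρ σ (w x) = w (π σ x) := by
  have hσb : π σ b = b := by rw [hσ.map_eq, cyc_apply_of_ne hp.symm hq.symm hr.symm]
  have hyS : π σ x ∈ S := h.mem_of_mem σ hx
  have hyb : π σ x ≠ b := fun hy => hxb ((π σ).injective (hy.trans hσb.symm))
  have h1 := h.smul_mem_line σ (hw.mem_line x hx hxb)
  rw [hσb] at h1
  obtain ⟨r', hr'⟩ := h.exists_smul_eq_of_mem_line hw.mem hyS hyb.symm (hw.mem_line _ hyS hyb) h1
    (hw.ne_zero _ hyS hyb)
  obtain ⟨j, hjS, hj⟩ := h.exists_notMem {b, p, q, r, x, π σ x}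
    (Finset.card_le_six.trans (by norm_num))
  simp only [Finset.mem_insert, Finset.mem_singleton, not_or] at hj
  have hσj : π σ j = j := by rw [hσ.map_eq, cyc_apply_of_ne hj.2.1 hj.2.2.1 hj.2.2.2.1]
  have h2 := h.smul_mem_line σ (hw.add_mem x hx j hjS hxb hj.1 (Ne.symm hj.2.2.2.2.1))
  rw [map_add, hσj, hr', h.fixed_of_mem_line hσ (i := b) (j := j) (by simp; grind) (by simp; grind)
    (hw.mem_line j hjS hj.1)] at h2
  have h3 := sub_mem h2 (hw.add_mem _ hyS j hjS hyb hj.1 (Ne.symm hj.2.2.2.2.2))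
  have h4 : r' • w (π σ x) + w j - (w (π σ x) + w j) = (r' - 1) • w (π σ x) := by module
  rw [h4] at h3
  have h5 := Submodule.smul_mem _ (r' - 1) (hw.mem_line _ hyS hyb)
  rw [line_comm] at h5
  have h6 := h.eq_zero_of_mem_line hyS hjS hw.mem (Ne.symm hj.2.2.2.2.2) hyb hj.1 h3 h5
  rw [smul_eq_zero, or_iff_left (hw.ne_zero _ hyS hyb), sub_eq_zero] at h6
  rw [hr', h6, one_smul]

lemma coeff_eq (hw : IsFrame π ρ S b w) (h : IsSmall π ρ S) {c : α → K}
    (hc : ∑ j ∈ S.erase b, c j • w j = 0) {x z : α} (hx : x ∈ S) (hz : z ∈ S) (hxb : x ≠ b)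
    (hzb : z ≠ b) (hxz : x ≠ z) : c x = c z := by
  obtain ⟨y, hyS, hy⟩ := h.exists_notMem {b, x, z} (Finset.card_le_three.trans (by norm_num))
  simp only [Finset.mem_insert, Finset.mem_singleton, not_or] at hy
  obtain ⟨σ, hσ⟩ := h.good hx hyS hz (Ne.symm hy.2.1) hxz hy.2.2
  have h1 : ∑ j ∈ S.erase b, c j • (w (π σ j) - w j) = 0 := by
    have := congrArg (ρ σ) hc
    rw [map_zero, map_sum] at this
    rw [Finset.sum_congr rfl fun j _ => smul_sub _ _ _, Finset.sum_sub_distrib, hc, sub_zero,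
      ← this]
    refine Finset.sum_congr rfl fun j hj => ?_
    rw [Finset.mem_erase] at hj
    rw [map_smul, hw.smul_eq h hσ hxb hy.1 hzb hj.2 hj.1]
  rw [← Finset.sum_subset (s₁ := {x, y, z})
    (by intro u hu; simp only [Finset.mem_insert, Finset.mem_singleton, Finset.mem_erase] at hu ⊢
        grind)
    (by
      intro u _ hu
      simp only [Finset.mem_insert, Finset.mem_singleton, not_or] at hu
      rw [hσ.map_eq, cyc_apply_of_ne hu.1 hu.2.1 hu.2.2, sub_self, smul_zero]),
    Finset.sum_insert (by simp; grind), Finset.sum_pair hy.2.2, hσ.map_eq,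
    cyc_apply_left hσ.hab hσ.hac, cyc_apply_mid hσ.hac hσ.hbc, cyc_apply_right] at h1
  have h2 := hw.add_mem y hyS x hx hy.1 hxb hy.2.1
  have h3 := hw.add_mem y hyS z hz hy.1 hzb hy.2.2
  have h4 : (c x + c z) • (w y + w x) = -((c y + c z) • (w y + w z)) := by
    linear_combination (norm := module) h1 +
      add_self_eq_zero_of_charTwo K (c x • w x + c y • w y + c z • (w y + w z))
  have h5 := Submodule.smul_mem _ (c x + c z) h2
  have h6 := Submodule.neg_mem _ (Submodule.smul_mem _ (c y + c z) h3)
  rw [← h4] at h6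
  have h7 := h.eq_zero_of_mem_line hyS hx hz hy.2.1 hy.2.2 hxz h5 h6
  rcases smul_eq_zero.1 h7 with h8 | h8
  · exact CharTwo.add_eq_zero.1 h8
  · have h9 : w y = w x := by
      linear_combination (norm := module) h8 - add_self_eq_zero_of_charTwo K (w x)
    have h10 := hw.mem_line y hyS hy.1
    rw [h9] at h10
    exact absurd (h.eq_zero_of_mem_line hw.mem hx hyS hxb.symm (Ne.symm hy.1) (Ne.symm hy.2.1)
      (hw.mem_line x hx hxb) h10) (hw.ne_zero x hx hxb)

/-- The vectors of a frame sum to zero. -/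
lemma sum_eq_zero (hw : IsFrame π ρ S b w) (h : IsSmall π ρ S) : ∑ j ∈ S.erase b, w j = 0 := by
  have hdep : ¬ LinearIndepOn K w (S.erase b : Finset α) := by
    intro hli
    have h1 := LinearIndependent.fintype_card_le_finrank hli
    have h2 := h.finrank_le
    have h3 := Finset.card_erase_of_mem hw.mem
    simp only [Finset.coe_sort_coe, Fintype.card_coe] at h1
    omega
  rw [linearIndepOn_finset_iff] at hdep
  push Not at hdep
  obtain ⟨c, hc, x, hx, hx0⟩ := hdep
  rw [Finset.mem_erase] at hx
  have h1 : ∑ j ∈ S.erase b, c j • w j = c x • ∑ j ∈ S.erase b, w j := by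
    rw [Finset.smul_sum]
    refine Finset.sum_congr rfl fun j hj => ?_
    rw [Finset.mem_erase] at hj
    by_cases hjx : j = x
    · rw [hjx]
    · rw [hw.coeff_eq h hc hj.2 hx.2 hj.1 hx.1 hjx]
  rw [hc] at h1
  exact (smul_eq_zero.1 h1.symm).resolve_left hx0

end IsFrame

namespace IsSmall

variable [CharP K 2] [FiniteDimensional K V]

lemma exists_isFrame (h : IsSmall π ρ S) {p q : α} (hp : p ∈ S) (hq : q ∈ S) (hpq : p ≠ q) :
    ∃ w : α → V, IsFrame π ρ S p w ∧
      IsFrame π ρ S q (fun j => if j = p then w q else w q + w j) := by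
  have k2 : ∀ v : V, v + v = 0 := add_self_eq_zero_of_charTwo K
  obtain ⟨⟨u, hu⟩, hu0, -⟩ := finrank_eq_one_iff'.1 (h.finrank_line hp hq hpq)
  replace hu0 : u ≠ 0 := by simpa [Subtype.ext_iff] using hu0
  have hex : ∀ j, ∃ v, (j = q → v = u) ∧ (j ∈ S → j ≠ p → j ≠ q →
      v ∈ line π ρ S p j ∧ u + v ∈ line π ρ S q j) := by
    intro j
    by_cases hj : j ∈ S ∧ j ≠ p ∧ j ≠ q
    · obtain ⟨a, ha, b, hb, hab⟩ := h.exists_add_eq_of_mem_comm hp hq hj.1 hpq hj.2.1.symm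
        hj.2.2.symm (mem_line.1 hu j hj.1 hj.2.1 hj.2.2)
      refine ⟨a, fun e => absurd e hj.2.2, fun _ _ _ => ⟨ha, ?_⟩⟩
      rwa [← hab, add_right_comm, k2, zero_add]
    · exact ⟨u, fun _ => rfl, fun h1 h2 h3 => absurd ⟨h1, h2, h3⟩ hj⟩
  choose w hwq hw using hex
  replace hwq : w q = u := hwq q rfl
  have hqp : u ∈ line π ρ S q p := by rwa [line_comm]
  have hw1 : ∀ j ∈ S, j ≠ p → w j ∈ line π ρ S p j := by
    intro j hj hjp
    by_cases hjq : j = q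
    · rwa [hjq, hwq]
    · exact (hw j hj hjp hjq).1
  have hw0 : ∀ j ∈ S, j ≠ p → w j ≠ 0 := by
    intro j hj hjp hj0
    by_cases hjq : j = q
    · rw [hjq, hwq] at hj0
      exact hu0 hj0
    · have := (hw j hj hjp hjq).2
      rw [hj0, add_zero] at this
      exact hu0 (h.eq_zero_of_mem_line hq hp hj hpq.symm (Ne.symm hjq) hjp.symm hqp this)
  have hadd : ∀ i ∈ S, ∀ j ∈ S, i ≠ p → j ≠ p → i ≠ q → j ≠ q → i ≠ j →
      w i + w j ∈ line π ρ S i j := by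
    intro i hi j hj hip hjp hiq hjq hij
    have hi1 := mem_line.1 (hw1 i hi hip) j hj hjp hij.symm
    obtain ⟨a, ha, b, hb, hab⟩ := h.exists_add_eq_of_mem_comm hp hi hj hip.symm hjp.symm hij hi1
    obtain ⟨r, rfl⟩ := h.exists_smul_eq_of_mem_line hp hj hjp.symm (hw1 j hj hjp) ha
      (hw0 j hj hjp)
    by_cases hr : r = 1
    · rw [hr, one_smul] at hab
      rwa [← hab, add_right_comm, k2, zero_add]
    · exfalso
      have m1 := mem_line.1 (hw i hi hip hiq).2 j hj hjq hij.symm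
      have m2 := mem_line.1 (hw j hj hjp hjq).2 i hi hiq hij
      have m3 := mem_line.1 hb q hq hiq.symm hjq.symm
      rw [Finset.pair_comm] at m2
      rw [Finset.pair_comm, Finset.insert_comm] at m3
      have m4 := sub_mem (sub_mem m1 m2) m3
      have e1 : u + w i - (u + w j) - b = (r - 1) • w j := by
        rw [← hab]; module
      rw [e1, Submodule.smul_mem_iff _ (sub_ne_zero.2 hr)] at m4
      have m5 := sub_mem m2 m4
      rw [add_sub_cancel_right] at m5
      have m6 := mem_line.1 hqp i hi hiq hip
      rw [Finset.pair_comm] at m6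
      have m7 := h.mem_line_of_mem_comm hq hi hj hp hiq.symm hjq.symm hpq.symm hij hip hjp m5 m6
      exact hu0 (h.eq_zero_of_mem_line hq hi hp hiq.symm hpq.symm hip m7 hqp)
  refine ⟨w, ⟨hp, hw1, hw0, ?_⟩, ⟨hq, ?_, ?_, ?_⟩⟩
  · intro i hi j hj hip hjp hij
    by_cases hiq : i = q
    · have := (hw j hj hjp (by rw [← hiq]; exact hij.symm)).2
      rwa [hiq, hwq]
    by_cases hjq : j = q
    · have := (hw i hi hip (by rw [← hjq]; exact hij)).2
      rwa [hjq, hwq, line_comm, add_comm]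
    exact hadd i hi j hj hip hjp hiq hjq hij
  · intro j hj hjq
    simp only [hwq]
    split_ifs with hjp
    · rwa [hjp]
    · exact (hw j hj hjp hjq).2
  · intro j hj hjq
    simp only [hwq]
    split_ifs with hjp
    · exact hu0
    · intro hj0
      have : u = w j := by linear_combination (norm := module) hj0 - k2 (w j)
      have h1 := hw1 j hj hjp
      rw [← this] at h1
      exact hu0 (h.eq_zero_of_mem_line hp hq hj hpq (Ne.symm hjp) (Ne.symm hjq) hu h1)
  · intro i hi j hj hiq hjq hij
    simp only [hwq]
    split_ifs with hip hjp hjp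
    · exact absurd (hip.trans hjp.symm) hij
    · rw [← add_assoc, k2, zero_add, hip]
      exact hw1 j hj hjp
    · rw [add_right_comm, k2, zero_add, hjp, line_comm]
      exact hw1 i hi hip
    · have := hadd i hi j hj hip hjp hiq hjq hij
      rwa [add_add_add_comm, k2, zero_add]

/-- There are no small representations of the alternating group on an odd number of letters. -/
lemma not_odd (h : IsSmall π ρ S) : ¬ Odd S.card := by
  intro hodd
  have h9 := h.card
  obtain ⟨p, hp, q, hq, hpq⟩ := Finset.one_lt_card.1 (show 1 < S.card by omega)
  obtain ⟨w, hw, hw'⟩ := h.exists_isFrame hp hq hpq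
  have h1 := hw.sum_eq_zero h
  have h2 := hw'.sum_eq_zero h
  have hq' : q ∈ S.erase p := Finset.mem_erase.2 ⟨hpq.symm, hq⟩
  have hp' : p ∈ S.erase q := Finset.mem_erase.2 ⟨hpq, hp⟩
  rw [← Finset.add_sum_erase _ _ hq'] at h1
  rw [← Finset.add_sum_erase _ _ hp', if_pos rfl, Finset.erase_right_comm,
    Finset.sum_congr rfl (g := fun j => w q + w j) (by
      intro j hj
      simp only [Finset.mem_erase] at hj
      rw [if_neg (by grind)]), Finset.sum_add_distrib, Finset.sum_const] at h2
  have hc : Odd ((S.erase p).erase q).card := by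
    rw [Finset.card_erase_of_mem hq', Finset.card_erase_of_mem hp, Nat.sub_sub]
    exact Nat.Odd.sub_even (by omega) hodd even_two
  obtain ⟨k, hk⟩ := hc
  rw [hk, add_smul, mul_comm, mul_smul, one_smul, two_smul, add_self_eq_zero_of_charTwo K (w q),
    smul_zero, zero_add, ← add_assoc, add_self_eq_zero_of_charTwo K, zero_add] at h2
  rw [h2, add_zero] at h1
  exact hw.ne_zero q hq hpq.symm h1

end IsSmall

end AltPGL

namespace AltPGL

section Eigenvectors

variable {K V : Type*} [Field K] [AddCommGroup V] [Module K V]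

lemma linearIndependent_of_joint_eigenvectors {ι : Type*} {A B : End K V} (hAB : Commute A B)
    {v : ι → V} {χ : ι → K × K} (hχ : Function.Injective χ) (hA : ∀ i, A (v i) = (χ i).1 • v i)
    (hB : ∀ i, B (v i) = (χ i).2 • v i) (hv : ∀ i, v i ≠ 0) : LinearIndependent K v := by
  let f : Bool → End K V := fun b => if b then A else B
  have hf : ∀ i j, Commute (f i) (f j) := by
    rintro (_ | _) (_ | _)
    · exact Commute.refl B
    · exact hAB.symm
    · exact hAB
    · exact Commute.refl A
  have h1 := Module.End.independent_iInf_maxGenEigenspace_of_forall_mapsTo f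
    fun i j φ => Module.End.mapsTo_maxGenEigenspace_of_comm (hf j i) φ
  let χ' : ι → Bool → K := fun i b => if b then (χ i).1 else (χ i).2
  have hχ' : Function.Injective χ' := by
    intro i j hij
    have e1 := congrFun hij true
    have e2 := congrFun hij false
    exact hχ (Prod.ext e1 e2)
  refine (h1.comp hχ').linearIndependent _ (v := v) (fun i => ?_) hv
  simp only [Function.comp_apply, Submodule.mem_iInf]
  rintro (_ | _)
  · exact Module.End.eigenspace_le_maxGenEigenspace (Module.End.mem_eigenspace_iff.2 (hB i))
  · exact Module.End.eigenspace_le_maxGenEigenspace (Module.End.mem_eigenspace_iff.2 (hA i))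

lemma exists_eigenvector_mem [IsAlgClosed K] [FiniteDimensional K V] (f : End K V)
    {W : Submodule K V} (hW : W ≠ ⊥) (hf : ∀ w ∈ W, f w ∈ W) :
    ∃ μ : K, ∃ v ∈ W, v ≠ 0 ∧ f v = μ • v := by
  have : Nontrivial W := Submodule.nontrivial_iff_ne_bot.2 hW
  obtain ⟨μ, hμ⟩ := Module.End.exists_eigenvalue (f.restrict hf)
  obtain ⟨v, hv⟩ := hμ.exists_hasEigenvector
  refine ⟨μ, v, v.2, ?_, ?_⟩
  · simpa using hv.2
  · exact congrArg Subtype.val hv.apply_eq_smul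

lemma pow_apply_of_apply_eq_smul {f : End K V} {μ : K} {v : V} (h : f v = μ • v) (k : ℕ) :
    (f ^ k) v = μ ^ k • v := by
  induction k with
  | zero => simp
  | succ k ih => rw [pow_succ', Module.End.mul_apply, ih, map_smul, h, smul_smul, pow_succ]

lemma pow_eq_one_of_apply_eq_smul {f : End K V} {μ : K} {v : V} (hv : v ≠ 0) (h : f v = μ • v)
    {k : ℕ} (hk : f ^ k = 1) : μ ^ k = 1 := by
  have h1 := pow_apply_of_apply_eq_smul h k
  rw [hk, Module.End.one_apply] at h1
  exact smul_left_injective K hv (by simpa using h1.symm)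

/-- An operator of odd order has no nonzero fixed vectors in the range of `T - 1`. -/
lemma eq_zero_of_fixed_of_odd [CharP K 2] {T : End K V} {k : ℕ} (hk : Odd k) (hT : T ^ k = 1)
    {v u : V} (hv : T u - u = v) (h : T v = v) : v = 0 := by
  have h1 : ∀ m : ℕ, (T ^ m) u = u + m • v := by
    intro m
    induction m with
    | zero => simp
    | succ m ih =>
      rw [pow_succ', Module.End.mul_apply, ih, map_add, map_nsmul, h, ← hv, succ_nsmul]
      abel
  have h2 := h1 k
  rw [hT, Module.End.one_apply, left_eq_add] at h2
  obtain ⟨m, rfl⟩ := hk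
  rwa [add_smul, mul_comm, mul_smul, one_smul, two_smul, add_self_eq_zero_of_charTwo K v,
    smul_zero, zero_add] at h2

lemma exists_eigenvector_ne_one [CharP K 2] [IsAlgClosed K] [FiniteDimensional K V] {T : End K V}
    {k : ℕ} (hk : Odd k) (hT : T ^ k = 1) {W : Submodule K V} (hW : ∀ w ∈ W, T w ∈ W) {w : V}
    (hw : w ∈ W) (hTw : T w ≠ w) : ∃ μ : K, ∃ v ∈ W, v ≠ 0 ∧ T v = μ • v ∧ μ ≠ 1 := by
  obtain ⟨μ, v, ⟨u, hu, rfl⟩, hv0, hv⟩ := exists_eigenvector_mem T (W := W.map (T - 1))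
    (by
      rw [Submodule.ne_bot_iff]
      exact ⟨T w - w, ⟨w, hw, rfl⟩, sub_ne_zero.2 hTw⟩)
    (by
      rintro _ ⟨u, hu, rfl⟩
      exact ⟨T u, hW u hu, by simp⟩)
  refine ⟨μ, _, sub_mem (hW u hu) hu, hv0, hv, ?_⟩
  rintro rfl
  rw [one_smul] at hv
  exact hv0 (eq_zero_of_fixed_of_odd hk hT rfl hv)

/-- A subspace of dimension at most three on which a group of order 36 acts such that the
generator `g` of order four permutes the weights of the two commuting operators of order three. -/
lemma apply_eq_self_of_finrank_le_three [CharP K 2] [IsAlgClosed K] [FiniteDimensional K V]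
    {A B g : End K V} {W : Submodule K V} (hW : finrank K W ≤ 3) (hAW : ∀ w ∈ W, A w ∈ W)
    (hBW : ∀ w ∈ W, B w ∈ W) (hgW : ∀ w ∈ W, g w ∈ W) (hA : A ^ 3 = 1) (hB : B ^ 3 = 1)
    (hAB : Commute A B) (hg : Function.Injective g) (hgA : g * A = B * g)
    (hgB : g * B = A * A * g) : ∀ w ∈ W, A w = w := by
  intro w hw
  by_contra hAw
  obtain ⟨ζ, v₀, hv₀W, hv₀, hζ, hζ1⟩ := exists_eigenvector_ne_one (by decide) hA hAW hw hAw
  have hζ3 := pow_eq_one_of_apply_eq_smul hv₀ hζ hA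
  obtain ⟨η, v, ⟨hvW, hvA⟩, hv, hη⟩ := exists_eigenvector_mem B (W := W ⊓ End.eigenspace A ζ)
    (by
      rw [Submodule.ne_bot_iff]
      exact ⟨v₀, ⟨hv₀W, End.mem_eigenspace_iff.2 hζ⟩, hv₀⟩)
    (by
      rintro u ⟨hu, hu'⟩
      refine ⟨hBW u hu, ?_⟩
      have hu' := End.mem_eigenspace_iff.1 hu'
      refine End.mem_eigenspace_iff.2 ?_
      rw [← End.mul_apply, hAB.eq, End.mul_apply, hu', map_smul])
  replace hvA := End.mem_eigenspace_iff.1 hvA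
  have hη3 := pow_eq_one_of_apply_eq_smul hv hη hB
  have hA4 : ∀ u, A u = A (A (A (A u))) := fun u => by
    have := LinearMap.congr_fun hA (A u)
    simpa [pow_succ] using this.symm
  have step : ∀ (u : V) (a b : K), A u = a • u → B u = b • u →
      A (g u) = b ^ 2 • g u ∧ B (g u) = a • g u := by
    intro u a b ha hb
    constructor
    · have h1 : A (A (g u)) = b • g u := by
        have := LinearMap.congr_fun hgB u
        simpa [hb] using this.symm
      rw [hA4, h1, map_smul, map_smul, h1, smul_smul, pow_two]
    · have := LinearMap.congr_fun hgA u
      simpa [ha] using this.symm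
  have s1 := step v ζ η hvA hη
  have s2 := step _ _ _ s1.1 s1.2
  have s3 := step _ _ _ s2.1 s2.2
  have hg0 : ∀ u, u ≠ 0 → g u ≠ 0 := fun u hu h0 => hu (hg (by rw [h0, map_zero]))
  have hli := linearIndependent_of_joint_eigenvectors hAB
    (v := ![v, g v, g (g v), g (g (g v))])
    (χ := ![(ζ, η), (η ^ 2, ζ), (ζ ^ 2, η ^ 2), ((η ^ 2) ^ 2, ζ ^ 2)])
    (by
      have hζ2 : ζ ^ 2 ≠ ζ := by
        intro h2
        have h0 : ζ ≠ 0 := by rintro rfl; simp at hζ3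
        exact hζ1 (mul_left_cancel₀ h0 (by rw [← pow_two, h2, mul_one]))
      have e4 : (η ^ 2) ^ 2 = η := by linear_combination η * hη3
      rw [e4]
      have e5 : ζ ^ 2 = η → η ^ 2 = ζ ^ 2 → False := by
        rintro rfl h2
        apply hζ2
        rw [← h2]
        linear_combination ζ * hζ3
      intro i j hij
      fin_cases i <;> fin_cases j <;> simp [Prod.ext_iff] at hij ⊢ <;> grind)
    (by
      intro i
      fin_cases i
      · exact hvA
      · exact s1.1
      · exact s2.1
      · exact s3.1)
    (by
      intro i
      fin_cases i
      · exact hη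
      · exact s1.2
      · exact s2.2
      · exact s3.2)
    (by
      intro i
      fin_cases i
      · exact hv
      · exact hg0 _ hv
      · exact hg0 _ (hg0 _ hv)
      · exact hg0 _ (hg0 _ (hg0 _ hv)))
  have h4 := finrank_span_eq_card hli
  have h5 : Submodule.span K (Set.range ![v, g v, g (g v), g (g (g v))]) ≤ W := by
    rw [Submodule.span_le]
    rintro _ ⟨i, rfl⟩
    fin_cases i
    · exact hvW
    · exact hgW _ hvW
    · exact hgW _ (hgW _ hvW)
    · exact hgW _ (hgW _ (hgW _ hvW))
  have h6 := Submodule.finrank_mono h5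
  rw [h4, Fintype.card_fin] at h6
  omega

lemma sum_finrank_eigenspace_le [FiniteDimensional K V] (f : End K V) (s : Finset K) :
    ∑ μ ∈ s, finrank K (End.eigenspace f μ) ≤ finrank K V := by
  classical
  suffices ∑ μ ∈ s, finrank K (End.eigenspace f μ) ≤
      finrank K ↥(⨆ μ ∈ s, End.eigenspace f μ) from this.trans (Submodule.finrank_le _)
  induction s using Finset.induction_on with
  | empty => simp
  | insert a s ha ih =>
    have hd : Disjoint (End.eigenspace f a) (⨆ μ ∈ s, End.eigenspace f μ) :=
      (End.eigenspaces_iSupIndep f).disjoint_biSup (y := (s : Set K)) (by simpa using ha)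
    have h1 := Submodule.finrank_sup_add_finrank_inf_eq (End.eigenspace f a)
      (⨆ μ ∈ s, End.eigenspace f μ)
    rw [hd.eq_bot, finrank_bot] at h1
    rw [Finset.sum_insert ha, Finset.iSup_insert]
    omega

/-- If `X` conjugates `T` to its square, then it permutes the eigenspaces of `T`. -/
lemma apply_mem_eigenspace_pow {T X : End K V} (hX : X * T = T * T * X) {m : ℕ}
    (hT : T ^ (2 * m) = T) {μ : K} {v : V} (hv : v ∈ End.eigenspace T μ) :
    X v ∈ End.eigenspace T (μ ^ m) := by
  rw [End.mem_eigenspace_iff] at hv ⊢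
  have h1 : (T ^ 2) (X v) = μ • X v := by
    have := LinearMap.congr_fun hX v
    simpa [hv, pow_two] using this.symm
  have := pow_apply_of_apply_eq_smul h1 m
  rwa [← pow_mul, hT] at this

lemma finrank_eigenspace_le_pow [FiniteDimensional K V] {T X : End K V}
    (hX : X * T = T * T * X) (hXi : Function.Injective X) {m : ℕ} (hT : T ^ (2 * m) = T) (μ : K) :
    finrank K (End.eigenspace T μ) ≤ finrank K (End.eigenspace T (μ ^ m)) := by
  refine LinearMap.finrank_le_finrank_of_injective
    (f := X.restrict fun v hv => apply_mem_eigenspace_pow hX hT hv) ?_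
  intro u v huv
  exact Subtype.ext (hXi (congrArg Subtype.val huv))

end Eigenvectors

end AltPGL

namespace AltPGL

variable {α G K V : Type*} [DecidableEq α] [Group G] [Field K] [AddCommGroup V]
  [Module K V] {π : G →* Perm α} {ρ : Representation K G V} {S : Finset α}

section Permutations

variable {α : Type*} [DecidableEq α]

lemma viaEmbeddingHom_swap {β : Type*} [DecidableEq β] (f : β ↪ α) (i j : β) :
    viaEmbeddingHom f (swap i j) = swap (f i) (f j) := by
  ext x
  rw [viaEmbeddingHom_apply]
  by_cases hx : x ∈ Set.range f
  · obtain ⟨k, rfl⟩ := hx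
    rw [viaEmbedding_apply, ← f.injective.map_swap]
  · rw [viaEmbedding_apply_of_notMem _ _ _ hx, swap_apply_of_ne_of_ne] <;>
    · rintro rfl
      exact hx ⟨_, rfl⟩

lemma swap_prod_mul_self {a₁ b₁ c₁ a₂ b₂ c₂ : α}
    (h : ([a₁, b₁, c₁, a₂, b₂, c₂] : List α).Nodup) :
    let g : Perm α := swap a₁ a₂ * swap a₂ b₁ * (swap b₁ b₂ * swap c₁ c₂)
    g a₁ = a₂ ∧ g b₁ = b₂ ∧ g c₁ = c₂ ∧ g * g = swap a₁ b₁ * swap a₂ b₂ := by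
  intro g
  let f : Fin 6 ↪ α := ⟨[a₁, b₁, c₁, a₂, b₂, c₂].get, h.injective_get⟩
  let k : Perm (Fin 6) := swap 0 3 * swap 3 1 * (swap 1 4 * swap 2 5)
  have hg : viaEmbeddingHom f k = g := by
    simp only [k, map_mul, viaEmbeddingHom_swap]; rfl
  have hk : k * k = swap 0 1 * swap 3 4 := by decide
  rw [← hg]
  refine ⟨viaEmbedding_apply k f 0, viaEmbedding_apply k f 1, viaEmbedding_apply k f 2, ?_⟩
  rw [← map_mul, hk, map_mul, viaEmbeddingHom_swap, viaEmbeddingHom_swap]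
  rfl

end Permutations

lemma commutant_mapsTo_eigenspace {τ g : G} (hg : g ∈ commutant ρ τ) {ζ : K} {w : V}
    (hw : w ∈ End.eigenspace (ρ τ) ζ) : ρ g w ∈ End.eigenspace (ρ τ) ζ := by
  rw [End.mem_eigenspace_iff] at hw ⊢
  rw [← End.mul_apply, ← (mem_commutant.1 hg).eq, End.mul_apply, hw, map_smul]

namespace IsProjAlt

section Scalars

/-- If one 3-cycle acts as a scalar, then all do. -/
lemma exists_smul_one_of_exists (h : IsProjAlt π ρ S) (hS : 9 ≤ S.card) {a b c : α} (ha : a ∈ S)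
    (hb : b ∈ S) (hc : c ∈ S) (hab : a ≠ b) (hac : a ≠ c) (hbc : b ≠ c) {g : G}
    (hg : π g = cyc a b c) (hr : ∃ r : K, ρ g = r • (1 : End K V)) {x y z : α} (hx : x ∈ S)
    (hy : y ∈ S) (hz : z ∈ S) (hxy : x ≠ y) (hxz : x ≠ z) (hyz : y ≠ z) {g' : G}
    (hg' : π g' = cyc x y z) : ∃ r : K, ρ g' = r • (1 : End K V) := by
  let P : α → α → α → Prop := fun a b c => ∃ g, π g = cyc a b c ∧ ∃ r : K, ρ g = r • (1 : End K V)
  have rot : ∀ a b c, a ≠ b → a ≠ c → b ≠ c → P a b c → P b c a := by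
    rintro a b c hab hac hbc ⟨g, hg, hr⟩
    refine ⟨g, ?_, hr⟩
    rw [hg]
    have := conj_cyc (cyc a b c) a b c
    rwa [cyc_apply_left hab hac, cyc_apply_mid hac hbc, cyc_apply_right,
      mul_inv_cancel_right] at this
  have ext : ∀ a b c d, a ∈ S → b ∈ S → c ∈ S → d ∈ S → d ≠ a → d ≠ b → d ≠ c → a ≠ c → b ≠ c →
      P a b c → P a b d := by
    rintro a b c d ha hb hc hd hda hdb hdc hac hbc ⟨g, hg, r, hr⟩
    obtain ⟨e, heS, he⟩ := Finset.exists_mem_notMem_of_card_lt_card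
      (show ({a, b, c, d} : Finset α).card < S.card from Finset.card_le_four.trans_lt (by omega))
    simp only [Finset.mem_insert, Finset.mem_singleton, not_or] at he
    obtain ⟨k, hk⟩ := h.exists_cyc c hc d hd e heS hdc.symm (by grind) (by grind)
    refine ⟨k * g * k⁻¹, ?_, r, ?_⟩
    · rw [map_mul, map_mul, map_inv, hg, conj_cyc, hk, cyc_apply_of_ne hac hda.symm (by grind),
        cyc_apply_of_ne hbc hdb.symm (by grind), cyc_apply_left hdc.symm (by grind)]
    · rw [map_mul, map_mul, hr, mul_smul_comm, mul_one, smul_mul_assoc, ← map_mul, mul_inv_cancel,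
        map_one]
  have far : ∀ a b c u v w, a ∈ S → b ∈ S → c ∈ S → u ∈ S → v ∈ S → w ∈ S → a ≠ b → a ≠ c →
      b ≠ c → u ≠ v → u ≠ w → v ≠ w → u ∉ ({a, b, c} : Finset α) → v ∉ ({a, b, c} : Finset α) →
      w ∉ ({a, b, c} : Finset α) → P a b c → P u v w := by
    intro a b c u v w ha hb hc hu hv hw hab hac hbc huv huw hvw hu' hv' hw' h0
    simp only [Finset.mem_insert, Finset.mem_singleton, not_or] at hu' hv' hw'
    have h1 := ext a b c u ha hb hc hu hu'.1 hu'.2.1 hu'.2.2 hac hbc h0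
    have h2 := rot a b u hab (by grind) (by grind) h1
    have h3 := ext b u a v hb hu ha hv hv'.2.1 huv.symm hv'.1 hab.symm hu'.1 h2
    have h4 := rot b u v (by grind) (by grind) huv h3
    exact ext u v b w hu hv hb hw huw.symm hvw.symm hw'.2.1 hu'.2.1 hv'.2.1 h4
  have hT : ({a, b, c, x, y, z} : Finset α).card ≤ 6 := Finset.card_le_six
  have h3 : 2 < (S \ {a, b, c, x, y, z}).card := by
    have := Finset.le_card_sdiff ({a, b, c, x, y, z} : Finset α) S
    omega
  obtain ⟨u, hu, v, hv, w, hw, huv, huw, hvw⟩ := Finset.two_lt_card.1 h3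
  simp only [Finset.mem_sdiff, Finset.mem_insert, Finset.mem_singleton, not_or] at hu hv hw
  have h1 := far a b c u v w ha hb hc hu.1 hv.1 hw.1 hab hac hbc huv huw hvw (by simp; grind)
    (by simp; grind) (by simp; grind) ⟨g, hg, hr⟩
  obtain ⟨k, hk, r, hr⟩ := far u v w x y z hu.1 hv.1 hw.1 hx hy hz huv huw hvw hxy hxz hyz
    (by simp; grind) (by simp; grind) (by simp; grind) h1
  obtain ⟨s, hs⟩ := h.exists_smul (hg'.trans hk.symm)
  exact ⟨s * r, by rw [hs, hr, smul_smul]⟩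

end Scalars

variable [CharP K 2] [IsAlgClosed K] [FiniteDimensional K V]

/-- A normalized 3-cycle acts trivially on eigenspaces of dimension at most three of elements
centralized by an alternating group of degree six containing it. -/
lemma apply_eq_self_of_mem_eigenspace (h : IsProjAlt π ρ S) (hS : 8 ≤ S.card) {τ σ : G}
    {a₁ b₁ c₁ a₂ b₂ c₂ : α} (hσ : IsGood π ρ S a₁ b₁ c₁ σ) (ha₂ : a₂ ∈ S) (hb₂ : b₂ ∈ S)
    (hc₂ : c₂ ∈ S) (hab : a₂ ≠ b₂) (hac : a₂ ≠ c₂) (hbc : b₂ ≠ c₂)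
    (ha : a₂ ∉ ({a₁, b₁, c₁} : Finset α)) (hb : b₂ ∉ ({a₁, b₁, c₁} : Finset α))
    (hc : c₂ ∉ ({a₁, b₁, c₁} : Finset α))
    (hτ : ∀ x ∈ ({a₁, b₁, c₁, a₂, b₂, c₂} : Finset α), π τ x = x) {ζ : K}
    (hζ : finrank K (End.eigenspace (ρ τ) ζ) ≤ 3) :
    ∀ w ∈ End.eigenspace (ρ τ) ζ, ρ σ w = w := by
  set F : Finset α := {a₁, b₁, c₁, a₂, b₂, c₂} with hF
  have ha' := ha
  have hb' := hb
  have hc' := hc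
  simp only [Finset.mem_insert, Finset.mem_singleton, not_or] at ha' hb' hc'
  have hab₁ := hσ.hab
  have hac₁ := hσ.hac
  have hbc₁ := hσ.hbc
  have hFS : F ⊆ S := by
    intro x hx
    simp only [hF, Finset.mem_insert, Finset.mem_singleton] at hx
    rcases hx with rfl | rfl | rfl | rfl | rfl | rfl
    exacts [hσ.ha, hσ.hb, hσ.hc, ha₂, hb₂, hc₂]
  have hFc : 5 ≤ F.card := by
    have : F.card = 6 := by
      rw [hF]
      repeat rw [Finset.card_insert_of_notMem (by simp; grind)]
      simp
    omega
  have hW : ∀ p ∈ F, ∀ q ∈ F, ∀ r ∈ F, ∀ s ∈ F, p ≠ q → r ≠ s → ∀ y, π y = swap p q * swap r s →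
      ∀ w ∈ End.eigenspace (ρ τ) ζ, ρ y w ∈ End.eigenspace (ρ τ) ζ := by
    intro p hp q hq r hr s hs hpq hrs y hy w hw
    refine commutant_mapsTo_eigenspace (h.mem_commutant_of_map ?_) hw
    rw [hy]
    exact h.swap_mul_swap_mem_map_commutant hFS hFc hτ hp hq hr hs hpq hrs
  obtain ⟨g₁, hg₁⟩ := h.exists_swap_mul_swap hσ.ha ha₂ ha₂ hσ.hb (Ne.symm ha'.1) ha'.2.1
  obtain ⟨g₂, hg₂⟩ := h.exists_swap_mul_swap hσ.hb hb₂ hσ.hc hc₂ (Ne.symm hb'.2.1) (Ne.symm hc'.2.2)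
  obtain ⟨hga, hgb, hgc, hgg⟩ := swap_prod_mul_self
    (show ([a₁, b₁, c₁, a₂, b₂, c₂] : List α).Nodup by simp; grind)
  rw [← hg₁, ← hg₂, ← map_mul] at hga hgb hgc hgg
  rw [← map_mul] at hgg
  have hgood := hσ.conj h (g₁ * g₂)
  rw [hga, hgb, hgc] at hgood
  have hgW : ∀ w ∈ End.eigenspace (ρ τ) ζ, ρ (g₁ * g₂) w ∈ End.eigenspace (ρ τ) ζ := by
    intro w hw
    rw [map_mul, End.mul_apply]
    exact hW a₁ (by simp [hF]) a₂ (by simp [hF]) a₂ (by simp [hF]) b₁ (by simp [hF])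
      (Ne.symm ha'.1) ha'.2.1 g₁ hg₁ _ (hW b₁ (by simp [hF]) b₂ (by simp [hF]) c₁ (by simp [hF]) c₂
      (by simp [hF]) (Ne.symm hb'.2.1) (Ne.symm hc'.2.2) g₂ hg₂ _ hw)
  generalize g₁ * g₂ = g at *
  refine apply_eq_self_of_finrank_le_three (B := ρ (g * σ * g⁻¹)) (g := ρ g) hζ
    (hW a₁ (by simp [hF]) b₁ (by simp [hF]) b₁ (by simp [hF]) c₁ (by simp [hF]) hab₁ hbc₁ σ
      hσ.map_eq)
    (hW a₂ (by simp [hF]) b₂ (by simp [hF]) b₂ (by simp [hF]) c₂ (by simp [hF]) hab hbc _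
      hgood.map_eq) hgW (hσ.pow_three h hS) (hgood.pow_three h hS) ?_ (rep_injective g) ?_ ?_
  · refine (mem_commutant.1 (h.mem_commutant_of_map ?_)).symm
    rw [hgood.map_eq]
    have hF' : 5 ≤ (S \ {a₁, b₁, c₁}).card := by
      have h1 := Finset.le_card_sdiff ({a₁, b₁, c₁} : Finset α) S
      have h2 : ({a₁, b₁, c₁} : Finset α).card ≤ 3 := Finset.card_le_three
      omega
    refine h.cyc_mem_map_commutant (F := S \ {a₁, b₁, c₁}) Finset.sdiff_subset hF' ?_ _
      (Finset.mem_sdiff.2 ⟨ha₂, ha⟩) _ (Finset.mem_sdiff.2 ⟨hb₂, hb⟩) _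
      (Finset.mem_sdiff.2 ⟨hc₂, hc⟩) hab hac hbc
    intro x hx
    simp only [Finset.mem_sdiff, Finset.mem_insert, Finset.mem_singleton, not_or] at hx
    rw [hσ.map_eq, cyc_apply_of_ne hx.2.1 hx.2.2.1 hx.2.2.2]
  · rw [← map_mul, ← map_mul]
    congr 1
    group
  · have h1 := hσ.sq a₂ ha₂ b₂ hb₂ hab ha hb _ hgg
    have h2 : ρ g * ρ g⁻¹ = 1 := by rw [← map_mul]; simp
    calc ρ g * ρ (g * σ * g⁻¹) = ρ (g * g) * ρ σ * ρ g⁻¹ := by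
          simp only [← map_mul]; congr 1; group
      _ = ρ σ * ρ σ * ρ g := by
          rw [h1, map_mul, mul_assoc, mul_assoc, mul_assoc, h2, mul_one, mul_assoc]

end IsProjAlt

end AltPGL

namespace AltPGL

section LinearAlgebra

variable {K V : Type*} [Field K] [CharP K 2] [IsAlgClosed K] [AddCommGroup V] [Module K V]
  [FiniteDimensional K V]

lemma apply_sub_eq_of_eigenspace {A T : End K V} {k l : ℕ} (hk : Odd k) (hl : Odd l)
    (hA : A ^ k = 1) (hT : T ^ l = 1) (hAT : Commute A T)
    (h : ∀ ζ : K, ζ ≠ 1 → ∀ v ∈ End.eigenspace T ζ, A v = v) (u : V) :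
    A (T u - u) = T u - u := by
  by_contra hne
  have hc : ∀ w, A (T w) = T (A w) := fun w => LinearMap.congr_fun hAT.eq w
  obtain ⟨ζ, v, ⟨w, hw⟩, hv0, hv⟩ := exists_eigenvector_mem T
    (W := LinearMap.range ((A - 1) * (T - 1)))
    (by
      rw [Submodule.ne_bot_iff]
      exact ⟨A (T u - u) - (T u - u), ⟨u, by simp⟩, sub_ne_zero.2 hne⟩)
    (by
      rintro _ ⟨w, rfl⟩
      exact ⟨T w, by simp [hc]⟩)
  have hw' : A (T w - w) - (T w - w) = v := by rw [← hw]; simp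
  have hζ : ζ ≠ 1 := by
    rintro rfl
    refine hv0 (eq_zero_of_fixed_of_odd hl hT (u := A w - w) ?_ (by rw [hv, one_smul]))
    rw [← hw', map_sub, map_sub, hc]
    abel
  exact hv0 (eq_zero_of_fixed_of_odd hk hA hw' (h ζ hζ v (End.mem_eigenspace_iff.2 hv)))

end LinearAlgebra

section Field

variable {K V : Type*} [Field K] [AddCommGroup V] [Module K V] [FiniteDimensional K V]

lemma pow_two_mul_eq_self {M : Type*} [Monoid M] {T : M} {m k : ℕ} (hT : T ^ k = 1)
    (hm : 2 * m = k + 1) : T ^ (2 * m) = T := by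
  rw [hm, pow_succ, hT, one_mul]

lemma two_mul_finrank_eigenspace_add_le {T X : End K V} (hT : T ^ 3 = 1)
    (hX : X * T = T * T * X) (hXi : Function.Injective X) {ζ : K} (hζ : ζ ≠ 1) {v : V} (hv0 : v ≠ 0)
    (hv : v ∈ End.eigenspace T ζ) :
    2 * finrank K (End.eigenspace T ζ) + finrank K (End.eigenspace T 1) ≤ finrank K V := by
  classical
  have h3 : ζ ^ 3 = 1 := pow_eq_one_of_apply_eq_smul hv0 (End.mem_eigenspace_iff.1 hv) hT
  have h1 : ζ ≠ ζ ^ 2 := fun h => hζ (by linear_combination (ζ + 1) * h + h3)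
  have h2 : ζ ^ 2 ≠ 1 := fun h => hζ (by linear_combination h3 - ζ * h)
  have h4 := sum_finrank_eigenspace_le T {ζ, ζ ^ 2, 1}
  rw [Finset.sum_insert (by simp [h1, hζ]), Finset.sum_pair h2] at h4
  have h5 := finrank_eigenspace_le_pow hX hXi (pow_two_mul_eq_self (m := 2) hT rfl) ζ
  omega

lemma three_mul_finrank_eigenspace_le {T X : End K V} (hT : T ^ 5 = 1)
    (hX : X * T = T * T * X) (hXi : Function.Injective X) {ζ : K} (h5 : ζ ^ 5 = 1) (hζ : ζ ≠ 1) :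
    3 * finrank K (End.eigenspace T ζ) ≤ finrank K V := by
  classical
  have h1 : ζ ≠ ζ ^ 3 := fun h => hζ (by linear_combination h5 + (ζ ^ 2 + 1) * h)
  have h2 : ζ ≠ (ζ ^ 3) ^ 3 := fun h =>
    hζ (by linear_combination (ζ ^ 2 + 1) * (h5 + ζ * (h + ζ ^ 4 * h5)) + (h + ζ ^ 4 * h5))
  have h3 : ζ ^ 3 ≠ (ζ ^ 3) ^ 3 := fun h =>
    hζ (by linear_combination (1 - ζ) * h5 - ζ ^ 2 * (h + ζ ^ 4 * h5))
  have h4 := sum_finrank_eigenspace_le T {ζ, ζ ^ 3, (ζ ^ 3) ^ 3}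
  rw [Finset.sum_insert (by simp only [Finset.mem_insert, Finset.mem_singleton]; tauto),
    Finset.sum_pair h3] at h4
  have hT' := pow_two_mul_eq_self (m := 3) hT rfl
  have h6 := finrank_eigenspace_le_pow hX hXi hT' ζ
  have h7 := finrank_eigenspace_le_pow hX hXi hT' (ζ ^ 3)
  omega

end Field

/-- The 5-cycle `i ↦ i + 1` on the first five points. -/
def fiveCycle : Perm (Fin 8) := swap 0 1 * swap 1 2 * (swap 2 3 * swap 3 4)

/-- The permutation `i ↦ 2 * i` modulo five of the first five points, made even. -/
def fiveDoubling : Perm (Fin 8) := swap 1 2 * swap 2 4 * (swap 4 3 * swap 5 6)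

lemma fiveDoubling_mul_fiveCycle :
    fiveDoubling * fiveCycle = fiveCycle * fiveCycle * fiveDoubling := by
  unfold fiveDoubling fiveCycle; decide

lemma fiveCycle_pow_five : fiveCycle ^ 5 = 1 := by
  unfold fiveCycle; decide

lemma fiveCycle_mul_cyc : fiveCycle * cyc 0 1 2 = cyc 0 3 1 * cyc 0 1 2 * fiveCycle := by
  unfold fiveCycle cyc; decide

lemma fiveCycle_apply {i : Fin 8} (hi : i = 5 ∨ i = 6 ∨ i = 7) : fiveCycle i = i := by
  rcases hi with rfl | rfl | rfl <;> rfl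

variable {α G K V : Type*} [DecidableEq α] [Group G] [Field K] [AddCommGroup V]
  [Module K V] {π : G →* Perm α} {ρ : Representation K G V} {S : Finset α}

lemma viaEmbeddingHom_cyc {β : Type*} [DecidableEq β] (f : β ↪ α) (i j k : β) :
    viaEmbeddingHom f (cyc i j k) = cyc (f i) (f j) (f k) := by
  rw [cyc, map_mul, viaEmbeddingHom_swap, viaEmbeddingHom_swap, cyc]

namespace IsGood

lemma commute {a b c x y z : α} {τ σ : G} (h : IsProjAlt π ρ S) (hS : 8 ≤ S.card)
    (hτ : IsGood π ρ S a b c τ) (hσ : IsGood π ρ S x y z σ)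
    (hd : Disjoint ({a, b, c} : Finset α) {x, y, z}) : Commute (ρ σ) (ρ τ) := by
  refine mem_commutant.1 (h.mem_commutant_of_map ?_)
  rw [hσ.map_eq]
  have hF' : 5 ≤ (S \ {a, b, c}).card := by
    have h1 := Finset.le_card_sdiff ({a, b, c} : Finset α) S
    have h2 : ({a, b, c} : Finset α).card ≤ 3 := Finset.card_le_three
    omega
  rw [Finset.disjoint_right] at hd
  refine h.cyc_mem_map_commutant (F := S \ {a, b, c}) Finset.sdiff_subset hF' ?_ _
    (Finset.mem_sdiff.2 ⟨hσ.ha, hd (by simp)⟩) _ (Finset.mem_sdiff.2 ⟨hσ.hb, hd (by simp)⟩) _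
    (Finset.mem_sdiff.2 ⟨hσ.hc, hd (by simp)⟩) hσ.hab hσ.hac hσ.hbc
  intro x hx
  simp only [Finset.mem_sdiff, Finset.mem_insert, Finset.mem_singleton, not_or] at hx
  rw [hτ.map_eq, cyc_apply_of_ne hx.2.1 hx.2.2.1 hx.2.2.2]

variable [CharP K 2] [IsAlgClosed K] [FiniteDimensional K V]

lemma apply_eq_self_of_finrank_eigenspace_le {a b c x y z : α} {τ σ : G} (h : IsProjAlt π ρ S)
    (hS : 9 ≤ S.card) (hτ : IsGood π ρ S a b c τ) (hσ : IsGood π ρ S x y z σ)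
    (hd : Disjoint ({a, b, c} : Finset α) {x, y, z}) {ζ : K}
    (hζ : finrank K (End.eigenspace (ρ τ) ζ) ≤ 3) :
    ∀ w ∈ End.eigenspace (ρ τ) ζ, ρ σ w = w := by
  have hT : ({a, b, c, x, y, z} : Finset α).card ≤ 6 := Finset.card_le_six
  have h3 : 2 < (S \ {a, b, c, x, y, z}).card := by
    have := Finset.le_card_sdiff ({a, b, c, x, y, z} : Finset α) S
    omega
  obtain ⟨u, hu, v, hv, w, hw, huv, huw, hvw⟩ := Finset.two_lt_card.1 h3
  simp only [Finset.mem_sdiff, Finset.mem_insert, Finset.mem_singleton, not_or] at hu hv hw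
  refine h.apply_eq_self_of_mem_eigenspace (by omega) hσ hu.1 hv.1 hw.1 huv huw hvw (by simp; grind)
    (by simp; grind) (by simp; grind) ?_ hζ
  intro p hp
  rw [hτ.map_eq]
  simp only [Finset.disjoint_left, Finset.mem_insert, Finset.mem_singleton] at hd hp
  apply cyc_apply_of_ne <;> grind

/-- In degree eleven and dimension at most nine, a normalized 3-cycle fixes two linearly
independent vectors, namely eigenvectors of a disjoint 5-cycle. -/
lemma two_le_finrank_eigenspace_one {a b c : α} {τ : G} (h : IsProjAlt π ρ S)
    (hS : S.card = 11) (hV : finrank K V ≤ 9) (hτ : IsGood π ρ S a b c τ)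
    (hns : ∀ a ∈ S, ∀ b ∈ S, ∀ c ∈ S, a ≠ b → a ≠ c → b ≠ c → ∀ g, π g = cyc a b c →
      ¬ ∃ r : K, ρ g = r • (1 : End K V)) :
    2 ≤ finrank K (End.eigenspace (ρ τ) 1) := by
  have hcard : (S \ {a, b, c}).card = 8 := by
    have h3 : ({a, b, c} : Finset α).card = 3 :=
      Finset.card_eq_three.2 ⟨a, b, c, hτ.hab, hτ.hac, hτ.hbc, rfl⟩
    rw [Finset.card_sdiff_of_subset, hS, h3]
    simp [Finset.insert_subset_iff, hτ.ha, hτ.hb, hτ.hc]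
  let f : Fin 8 ↪ α :=
    (Finset.equivFinOfCardEq hcard).symm.toEmbedding.trans (Function.Embedding.subtype _)
  have hf : ∀ i, f i ∈ S \ {a, b, c} := fun i => ((Finset.equivFinOfCardEq hcard).symm i).2
  have hfS : ∀ i, f i ∈ S := fun i => (Finset.mem_sdiff.1 (hf i)).1
  have hf' : ∀ i, f i ∉ ({a, b, c} : Finset α) := fun i => (Finset.mem_sdiff.1 (hf i)).2
  have hne : ∀ i j, i ≠ j → f i ≠ f j := fun i j hij => f.injective.ne hij
  have lift : ∀ i j k l, i ≠ j → k ≠ l →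
      ∃ g, π g = viaEmbeddingHom f (swap i j * swap k l) := by
    intro i j k l hij hkl
    rw [map_mul, viaEmbeddingHom_swap, viaEmbeddingHom_swap]
    exact h.exists_swap_mul_swap (hfS i) (hfS j) (hfS k) (hfS l) (hne i j hij) (hne k l hkl)
  obtain ⟨g₁, hg₁⟩ := lift 0 1 1 2 (by decide) (by decide)
  obtain ⟨g₂, hg₂⟩ := lift 2 3 3 4 (by decide) (by decide)
  obtain ⟨g₃, hg₃⟩ := lift 1 2 2 4 (by decide) (by decide)
  obtain ⟨g₄, hg₄⟩ := lift 4 3 5 6 (by decide) (by decide)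
  have hk : π (g₁ * g₂) = viaEmbeddingHom f fiveCycle := by rw [map_mul, hg₁, hg₂, ← map_mul]; rfl
  have hl : π (g₃ * g₄) = viaEmbeddingHom f fiveDoubling := by
    rw [map_mul, hg₃, hg₄, ← map_mul]; rfl
  generalize g₁ * g₂ = γ at hk
  generalize g₃ * g₄ = y at hl
  obtain ⟨hC, hyC⟩ := h.commutator_sq (x := y) (τ := γ) (by
    rw [hk, hl, ← map_mul, fiveDoubling_mul_fiveCycle, map_mul, map_mul, mul_inv_cancel_right])
  generalize y * γ * y⁻¹ * γ⁻¹ = C at hC hyC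
  rw [hk] at hC
  have hC5 : ρ C ^ 5 = 1 := by
    refine h.pow_eq_one_of_sq ?_ hyC
    rw [hC, ← map_pow, fiveCycle_pow_five, map_one]
  have hC1 : ρ C ≠ 1 := by
    intro hC1
    obtain ⟨t, ht⟩ := lift 0 1 1 2 (by decide) (by decide)
    refine hns (f 0) (hfS 0) (f 3) (hfS 3) (f 1) (hfS 1) (hne _ _ (by decide))
      (hne _ _ (by decide)) (hne _ _ (by decide)) (C * t * C⁻¹ * t⁻¹) ?_ ⟨1, ?_⟩
    · rw [← viaEmbeddingHom_cyc]
      rw [map_mul, map_mul, map_mul, map_inv, map_inv, hC, ht, ← map_mul]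
      have := fiveCycle_mul_cyc
      rw [cyc.eq_1 0 1 2] at this
      rw [this, map_mul, map_mul, mul_inv_cancel_right, mul_inv_cancel_right]
    · have h1 : ρ C⁻¹ = 1 := by
        have : ρ C * ρ C⁻¹ = 1 := by rw [← map_mul, mul_inv_cancel, map_one]
        rwa [hC1, one_mul] at this
      rw [map_mul, map_mul, map_mul, hC1, h1, one_mul, mul_one, ← map_mul, mul_inv_cancel,
        map_one, one_smul]
  obtain ⟨w, hw⟩ : ∃ w, ρ C w ≠ w := by
    by_contra! hw
    exact hC1 (LinearMap.ext hw)
  obtain ⟨ζ, v, -, hv0, hv, hζ⟩ := exists_eigenvector_ne_one (k := 5) (by decide) hC5 (W := ⊤)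
    (fun _ _ => Submodule.mem_top) (Submodule.mem_top (x := w)) hw
  have hζ5 := pow_eq_one_of_apply_eq_smul hv0 hv hC5
  have hζ3 : ζ ^ 3 ≠ ζ := fun h => hζ (by linear_combination hζ5 - (ζ ^ 2 + 1) * h)
  have hζ3' : ζ ^ 3 ≠ 1 := fun h => hζ (by linear_combination (ζ ^ 3 + 1) * h - ζ * hζ5)
  have key : ∀ η : K, η ^ 5 = 1 → η ≠ 1 → ∀ u ∈ End.eigenspace (ρ C) η, ρ τ u = u := by
    intro η hη5 hη
    have h1 := three_mul_finrank_eigenspace_le hC5 hyC (rep_injective y) hη5 hη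
    refine h.apply_eq_self_of_mem_eigenspace (by omega) hτ (hfS 5) (hfS 6) (hfS 7)
      (hne _ _ (by decide)) (hne _ _ (by decide)) (hne _ _ (by decide)) (hf' 5) (hf' 6) (hf' 7) ?_
      (by omega)
    intro x hx
    rw [hC, viaEmbeddingHom_apply]
    by_cases hx' : x ∈ Set.range f
    · obtain ⟨i, rfl⟩ := hx'
      rw [viaEmbedding_apply]
      have hi : i = 5 ∨ i = 6 ∨ i = 7 := by
        have := hf' i
        simp only [Finset.mem_insert, Finset.mem_singleton, f.injective.eq_iff] at hx this
        tauto
      rw [fiveCycle_apply hi]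
    · exact viaEmbedding_apply_of_notMem _ _ _ hx'
  have hvC : v ∈ End.eigenspace (ρ C) ζ := End.mem_eigenspace_iff.2 hv
  have hyv := apply_mem_eigenspace_pow hyC (pow_two_mul_eq_self (m := 3) hC5 rfl) hvC
  have hyv0 : ρ y v ≠ 0 := fun h0 =>
    hv0 (rep_injective (ρ := ρ) y (by rw [h0, map_zero]))
  have h1 := key ζ hζ5 hζ v hvC
  have h2 := key (ζ ^ 3) (by rw [← pow_mul, mul_comm, pow_mul, hζ5, one_pow]) hζ3' _ hyv
  have hli : LinearIndependent K (![⟨v, by simpa using h1⟩, ⟨ρ y v, by simpa using h2⟩] :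
      Fin 2 → End.eigenspace (ρ τ) 1) := by
    rw [LinearIndependent.pair_iff' (by simpa using hv0)]
    intro r hr
    have hr' : r • v = ρ y v := congrArg Subtype.val hr
    have h3 := End.mem_eigenspace_iff.1 hyv
    rw [← hr', map_smul, hv, smul_comm, hr'] at h3
    exact hζ3 (smul_left_injective K hyv0 h3).symm
  simpa using hli.fintype_card_le_finrank

end IsGood

end AltPGL

namespace AltPGL

universe u v

/-- All lifts of 3-cycles on `S` act as scalars. -/
def ScalarThreeCycles {α G K V : Type*} [DecidableEq α] [Group G] [Field K] [AddCommGroup V]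
    [Module K V] (π : G →* Perm α) (ρ : Representation K G V) (S : Finset α) : Prop :=
  ∀ a ∈ S, ∀ b ∈ S, ∀ c ∈ S, a ≠ b → a ≠ c → b ≠ c → ∀ g, π g = cyc a b c →
    ∃ r : K, ρ g = r • (1 : End K V)

/-- Projective representations of the alternating group of degree `m` of dimension at most `m - e`
are trivial on 3-cycles. -/
def TrivialInDegree (α K : Type*) [DecidableEq α] [Field K] (m e : ℕ) : Prop :=
  ∀ (G : Type u) [Group G] (V : Type v) [AddCommGroup V] [Module K V] [FiniteDimensional K V]
    (π : G →* Perm α) (ρ : Representation K G V) (S : Finset α), IsProjAlt π ρ S → S.card = m →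
    finrank K V + e ≤ m → ScalarThreeCycles π ρ S

section Restrict

variable {α G K V : Type*} [DecidableEq α] [Group G] [Field K] [AddCommGroup V]
  [Module K V] {π : G →* Perm α} {ρ : Representation K G V} {S : Finset α}

/-- The restriction of a representation to a subgroup and an invariant subspace. -/
def restrictRep (ρ : Representation K G V) (H : Subgroup G) (W : Submodule K V)
    (hW : ∀ g ∈ H, ∀ w ∈ W, ρ g w ∈ W) : Representation K H W :=
  Representation.subrepresentation (ρ.comp H.subtype) W fun g w hw => hW g g.2 w hw

lemma coe_restrictRep_apply {H : Subgroup G} {W : Submodule K V}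
    (hW : ∀ g ∈ H, ∀ w ∈ W, ρ g w ∈ W) (g : H) (w : W) :
    (restrictRep ρ H W hW g w : V) = ρ g w := rfl

lemma IsProjAlt.restrict (h : IsProjAlt π ρ S) {S' : Finset α} (hS : S' ⊆ S) {H : Subgroup G}
    {W : Submodule K V} (hW : ∀ g ∈ H, ∀ w ∈ W, ρ g w ∈ W)
    (hH : ∀ g ∈ H, ∀ x ∈ S, x ∉ S' → π g x = x)
    (hc : ∀ a ∈ S', ∀ b ∈ S', ∀ c ∈ S', a ≠ b → a ≠ c → b ≠ c → ∀ g, π g = cyc a b c → g ∈ H) :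
    IsProjAlt (π.comp H.subtype) (restrictRep ρ H W hW) S' where
  apply_of_notMem g x hx := by
    by_cases hxS : x ∈ S
    · exact hH g g.2 x hxS hx
    · exact h.apply_of_notMem g x hxS
  exists_cyc a ha b hb c hc' hab hac hbc := by
    obtain ⟨g, hg⟩ := h.exists_cyc a (hS ha) b (hS hb) c (hS hc') hab hac hbc
    exact ⟨⟨g, hc a ha b hb c hc' hab hac hbc g hg⟩, hg⟩
  scalar g hg := by
    obtain ⟨r, hr⟩ := h.scalar g hg
    refine ⟨r, LinearMap.ext fun w => Subtype.ext ?_⟩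
    rw [coe_restrictRep_apply, hr]
    rfl

end Restrict

section Induction

variable {α K : Type*} [DecidableEq α] [Field K]

lemma TrivialInDegree.succ {m : ℕ} (hm : 3 ≤ m) (h : TrivialInDegree.{u, v} α K m 2) :
    TrivialInDegree.{u, v} α K (m + 1) 3 := by
  intro G _ V _ _ _ π ρ S hπ hS hV a ha b hb c hc hab hac hbc g hg
  obtain ⟨p, hpS, hp⟩ := Finset.exists_mem_notMem_of_card_lt_card
    (show ({a, b, c} : Finset α).card < S.card from Finset.card_le_three.trans_lt (by omega))
  simp only [Finset.mem_insert, Finset.mem_singleton, not_or] at hp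
  let H : Subgroup G := (MulAction.stabilizer (Perm α) p).comap π
  have hmem : ∀ g, g ∈ H ↔ π g p = p := fun g => by simp [H]
  have hW : ∀ g ∈ H, ∀ w ∈ (⊤ : Submodule K V), ρ g w ∈ (⊤ : Submodule K V) := by simp
  have hr := hπ.restrict (Finset.erase_subset p S) hW
    (by
      intro g hg x hxS hx
      obtain rfl : x = p := by
        by_contra hxp
        exact hx (Finset.mem_erase.2 ⟨hxp, hxS⟩)
      exact (hmem g).1 hg)
    (by
      intro x hx y hy z hz _ _ _ g hg
      rw [hmem, hg]
      exact cyc_apply_of_ne (Ne.symm (Finset.ne_of_mem_erase hx))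
        (Ne.symm (Finset.ne_of_mem_erase hy)) (Ne.symm (Finset.ne_of_mem_erase hz)))
  obtain ⟨r, hr⟩ := h H (⊤ : Submodule K V) _ _ (S.erase p) hr
    (by rw [Finset.card_erase_of_mem hpS, hS]; rfl) (by rw [finrank_top]; omega)
    a (Finset.mem_erase.2 ⟨Ne.symm hp.1, ha⟩) b (Finset.mem_erase.2 ⟨Ne.symm hp.2.1, hb⟩)
    c (Finset.mem_erase.2 ⟨Ne.symm hp.2.2, hc⟩) hab hac hbc
    ⟨g, by rw [hmem, hg, cyc_apply_of_ne hp.1 hp.2.1 hp.2.2]⟩ hg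
  refine ⟨r, LinearMap.ext fun w => ?_⟩
  exact congrArg Subtype.val (LinearMap.congr_fun hr ⟨w, Submodule.mem_top⟩)

/-- Induction step: triviality in degree `m - 3` makes a normalized 3-cycle act trivially on the
eigenspaces of a disjoint 3-cycle. -/
lemma IsGood.apply_eq_self_of_trivialInDegree {m : ℕ} (hm : 7 ≤ m)
    (hT : TrivialInDegree.{u, v} α K m 3) {G : Type u} [Group G] {V : Type v} [AddCommGroup V]
    [Module K V] [FiniteDimensional K V] {π : G →* Perm α} {ρ : Representation K G V}
    {S : Finset α} (h : IsProjAlt π ρ S) (hS : S.card = m + 3) {a b c x y z : α} {τ σ : G}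
    (hτ : IsGood π ρ S a b c τ) (hσ : IsGood π ρ S x y z σ)
    (hd : Disjoint ({a, b, c} : Finset α) {x, y, z}) {ζ : K}
    (hζ : finrank K (End.eigenspace (ρ τ) ζ) + 3 ≤ m) :
    ∀ w ∈ End.eigenspace (ρ τ) ζ, ρ σ w = w := by
  intro w hw
  by_cases hw0 : w = 0
  · rw [hw0, map_zero]
  let S' : Finset α := S \ {a, b, c}
  have hcard : S'.card = m := by
    have h3 : ({a, b, c} : Finset α).card = 3 :=
      Finset.card_eq_three.2 ⟨a, b, c, hτ.hab, hτ.hac, hτ.hbc, rfl⟩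
    rw [Finset.card_sdiff_of_subset, hS, h3]
    · rfl
    · simp [Finset.insert_subset_iff, hτ.ha, hτ.hb, hτ.hc]
  have hS' : S' ⊆ S := Finset.sdiff_subset
  have hτ' : ∀ q ∈ S', π τ q = q := by
    intro q hq
    simp only [S', Finset.mem_sdiff, Finset.mem_insert, Finset.mem_singleton, not_or] at hq
    rw [hτ.map_eq, cyc_apply_of_ne hq.2.1 hq.2.2.1 hq.2.2.2]
  have hne : ∀ q ∈ S', ∀ p ∈ ({a, b, c} : Finset α), p ≠ q := by
    rintro q hq p hp rfl
    exact (Finset.mem_sdiff.1 hq).2 hp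
  let H : Subgroup G := commutant ρ τ ⊓
    (fixingSubgroup (Perm α) (({a, b, c} : Finset α) : Set α)).comap π
  have hmem : ∀ g, g ∈ H ↔ g ∈ commutant ρ τ ∧ ∀ p ∈ ({a, b, c} : Finset α), π g p = p := by
    intro g
    rw [Subgroup.mem_inf, Subgroup.mem_comap, mem_fixingSubgroup_iff]
    rfl
  have hcyc : ∀ a ∈ S', ∀ b ∈ S', ∀ c ∈ S', a ≠ b → a ≠ c → b ≠ c → ∀ g, π g = cyc a b c →
      g ∈ H := by
    intro a ha b hb c hc hab hac hbc g hg
    refine (hmem g).2 ⟨h.mem_commutant_of_map ?_, fun p hp => ?_⟩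
    · rw [hg]
      exact h.cyc_mem_map_commutant hS' (by omega) hτ' a ha b hb c hc hab hac hbc
    · rw [hg, cyc_apply_of_ne (hne a ha p hp) (hne b hb p hp) (hne c hc p hp)]
  have hr := h.restrict hS' (H := H) (W := End.eigenspace (ρ τ) ζ)
    (fun g hg w hw => commutant_mapsTo_eigenspace ((hmem g).1 hg).1 hw)
    (fun g hg q hqS hq => ((hmem g).1 hg).2 q (by
      by_contra hn
      exact hq (Finset.mem_sdiff.2 ⟨hqS, hn⟩))) hcyc
  rw [Finset.disjoint_right] at hd
  have hx : x ∈ S' := Finset.mem_sdiff.2 ⟨hσ.ha, hd (by simp)⟩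
  have hy : y ∈ S' := Finset.mem_sdiff.2 ⟨hσ.hb, hd (by simp)⟩
  have hz : z ∈ S' := Finset.mem_sdiff.2 ⟨hσ.hc, hd (by simp)⟩
  obtain ⟨r, hr⟩ := hT H _ _ _ S' hr hcard hζ x hx y hy z hz hσ.hab hσ.hac hσ.hbc
    ⟨σ, hcyc x hx y hy z hz hσ.hab hσ.hac hσ.hbc σ hσ.map_eq⟩ hσ.map_eq
  have hr' : ∀ w ∈ End.eigenspace (ρ τ) ζ, ρ σ w = r • w := fun w hw =>
    congrArg Subtype.val (LinearMap.congr_fun hr ⟨w, hw⟩)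
  obtain ⟨d, hdS, e, heS, hde⟩ := Finset.one_lt_card.1 (show 1 < (S' \ {x, y, z}).card by
    have h1 := Finset.le_card_sdiff ({x, y, z} : Finset α) S'
    have h2 : ({x, y, z} : Finset α).card ≤ 3 := Finset.card_le_three
    omega)
  rw [Finset.mem_sdiff] at hdS heS
  obtain ⟨X, hX⟩ := h.exists_swap_mul_swap hσ.ha hσ.hb (hS' hdS.1) (hS' heS.1) hσ.hab hde
  have hXσ := LinearMap.congr_fun
    (hσ.sq d (hS' hdS.1) e (hS' heS.1) hde hdS.2 heS.2 X hX) w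
  have hXW : ρ X w ∈ End.eigenspace (ρ τ) ζ := by
    refine commutant_mapsTo_eigenspace (h.mem_commutant_of_map ?_) hw
    rw [hX]
    exact h.swap_mul_swap_mem_map_commutant hS' (by omega) hτ' hx hy hdS.1 heS.1 hσ.hab hde
  have hX0 : ρ X w ≠ 0 := fun h0 =>
    hw0 (rep_injective (ρ := ρ) X (by rw [h0, map_zero]))
  have hr0 : r ≠ 0 := by
    rintro rfl
    exact hw0 (rep_injective (ρ := ρ) σ (by rw [hr' w hw, zero_smul, map_zero]))
  simp only [End.mul_apply] at hXσ
  rw [hr' w hw, map_smul, hr' _ hXW, map_smul, hr' _ hXW, smul_smul] at hXσ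
  have h1 : r = r * r := smul_left_injective K hX0 hXσ
  have h2 : r = 1 := (mul_left_cancel₀ hr0 (by rw [mul_one]; exact h1)).symm
  rw [hr' w hw, h2, one_smul]

variable [CharP K 2] [IsAlgClosed K]

theorem trivialInDegree_of_odd : ∀ m, 9 ≤ m → Odd m → TrivialInDegree.{u, v} α K m 2 := by
  intro m
  induction m using Nat.strong_induction_on with
  | _ m ih =>
  intro hm hodd G _ V _ _ _ π ρ S h hS hV
  by_contra hns
  have hns' : ∀ a ∈ S, ∀ b ∈ S, ∀ c ∈ S, a ≠ b → a ≠ c → b ≠ c → ∀ g, π g = cyc a b c →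
      ¬ ∃ r : K, ρ g = r • (1 : End K V) := by
    intro a ha b hb c hc hab hac hbc g hg hr
    apply hns
    intro x hx y hy z hz hxy hxz hyz g' hg'
    exact h.exists_smul_one_of_exists (by omega) ha hb hc hab hac hbc hg hr hx hy hz hxy hxz hyz hg'
  refine IsSmall.not_odd (π := π) (ρ := ρ) (S := S) ⟨h, by omega, by omega, ?_, ?_⟩ (hS ▸ hodd)
  · intro a b c τ hτ h1
    exact hns' a hτ.ha b hτ.hb c hτ.hc hτ.hab hτ.hac hτ.hbc τ hτ.map_eq ⟨1, by rw [h1, one_smul]⟩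
  · intro a b c τ x y z σ hτ hσ hd
    have hT := hτ.pow_three h (by omega)
    refine apply_sub_eq_of_eigenspace (k := 3) (l := 3) (by decide) (by decide)
      (hσ.pow_three h (by omega)) hT (hτ.commute h (by omega) hσ hd) ?_
    intro ζ hζ w hw
    by_cases hw0 : w = 0
    · rw [hw0, map_zero]
    obtain ⟨X, hX⟩ := hτ.exists_sq h (by omega)
    have hdim := two_mul_finrank_eigenspace_add_le hT hX (rep_injective X) hζ hw0 hw
    by_cases hsmall : finrank K (End.eigenspace (ρ τ) ζ) ≤ 3
    · exact hτ.apply_eq_self_of_finrank_eigenspace_le h (by omega) hσ hd hsmall w hw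
    by_cases h11 : m = 11
    · have := hτ.two_le_finrank_eigenspace_one h (by omega) (by omega) hns'
      omega
    have h13 : 13 ≤ m := by
      obtain ⟨k, hk⟩ := hodd
      omega
    have hIH := (ih (m - 4) (by omega) (by omega) (by
      obtain ⟨k, hk⟩ := hodd
      exact ⟨k - 2, by omega⟩)).succ (by omega)
    rw [show m - 4 + 1 = m - 3 by omega] at hIH
    exact hτ.apply_eq_self_of_trivialInDegree (by omega) hIH h (by omega) hσ hd (by omega) w hw

end Induction

end AltPGL

namespace AltPGL

section Lifts

variable {n a : ℕ} {F : Type*} [Field F]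

/-- The pullback of `GL_a(F) → PGL_a(F)` along a homomorphism from the alternating group. -/
def lifts (φ : alternatingGroup (Fin n) →* ProjGL a F) :
    Subgroup (alternatingGroup (Fin n) × GL (Fin a) F) where
  carrier := {x | φ x.1 = QuotientGroup.mk x.2}
  mul_mem' := by
    intro x y hx hy
    simp only [Set.mem_ofPred_eq, Prod.fst_mul, Prod.snd_mul, map_mul, QuotientGroup.mk_mul] at *
    rw [hx, hy]
  one_mem' := by simp
  inv_mem' := by
    intro x hx
    simp only [Set.mem_ofPred_eq, Prod.fst_inv, Prod.snd_inv, map_inv, QuotientGroup.mk_inv] at *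
    rw [hx]

variable (φ : alternatingGroup (Fin n) →* ProjGL a F)

/-- The permutation underlying an element of `lifts φ`. -/
def liftsPerm : lifts φ →* Perm (Fin n) :=
  (alternatingGroup (Fin n)).subtype.comp ((MonoidHom.fst _ _).comp (lifts φ).subtype)

/-- The tautological representation of `lifts φ` over the algebraic closure. -/
noncomputable def liftsRep :
    Representation (AlgebraicClosure F) (lifts φ) (Fin a → AlgebraicClosure F) :=
  (Matrix.toLinAlgEquiv' : Matrix (Fin a) (Fin a) (AlgebraicClosure F) ≃ₐ[_] _).toMonoidHom.comp
    ((algebraMap F (AlgebraicClosure F)).mapMatrix.toMonoidHom.comp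
      ((Units.coeHom _).comp ((MonoidHom.snd _ _).comp (lifts φ).subtype)))

lemma liftsRep_eq_smul_one_iff (g : lifts φ) :
    (∃ r : AlgebraicClosure F, liftsRep φ g = r • (1 : End _ _)) ↔ φ g.1.1 = 1 := by
  have hg : φ g.1.1 = QuotientGroup.mk g.1.2 := g.2
  have hmap : liftsRep φ g =
      Matrix.toLinAlgEquiv' (g.1.2.1.map (algebraMap F (AlgebraicClosure F))) := rfl
  rw [hg, QuotientGroup.eq_one_iff]
  constructor
  · rintro ⟨r, hr⟩
    have hr' : g.1.2.1.map (algebraMap F (AlgebraicClosure F)) = r • 1 := by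
      apply Matrix.toLinAlgEquiv'.injective
      rw [← hmap, hr, map_smul, map_one]
    refine Subgroup.mem_center_iff.2 fun N => Units.ext ?_
    apply Matrix.map_injective (algebraMap F (AlgebraicClosure F)).injective
    simp only [Units.val_mul, Matrix.map_mul, hr', mul_smul_comm, smul_mul_assoc, mul_one, one_mul]
  · intro hM
    obtain ⟨s, hs⟩ := Matrix.GeneralLinearGroup.mem_center_iff_val_mem_range_scalar.1 hM
    refine ⟨algebraMap F _ s, ?_⟩
    rw [hmap, ← hs, ← map_one Matrix.toLinAlgEquiv', ← map_smul]
    congr 1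
    ext i j
    by_cases hij : i = j <;> simp [hij]

lemma isProjAlt_lifts : IsProjAlt (liftsPerm φ) (liftsRep φ) Finset.univ where
  apply_of_notMem g x hx := absurd (Finset.mem_univ x) hx
  exists_cyc x _ y _ z _ hxy hxz hyz := by
    obtain ⟨M, hM⟩ := QuotientGroup.mk_surjective
      (φ ⟨cyc x y z, by simp [mem_alternatingGroup, cyc, sign_swap hxy, sign_swap hyz]⟩)
    exact ⟨⟨(_, M), hM.symm⟩, rfl⟩
  scalar g hg := by
    rw [liftsRep_eq_smul_one_iff]
    have : g.1.1 = 1 := Subtype.ext hg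
    rw [this, map_one]

end Lifts

end AltPGL

/-- Let `d ≥ 8` be an even integer and let `n` be either `d+1` or `d+2`.
Then every nontrivial projective representation of the alternating group `A_n` in
characteristic `2` has dimension `≥ d`: for every field `F` of characteristic `2` and
every positive integer `a < d`, every group homomorphism `A_n → PGL_a(F)` is trivial. -/
theorem alternating_hom_to_pgl_char_two_trivial
    (d : ℕ) (hd : 8 ≤ d) (hde : Even d) (n : ℕ) (hn : n = d + 1 ∨ n = d + 2)
    (F : Type*) [Field F] [CharP F 2] (a : ℕ) (ha : 0 < a) (had : a < d)
    (φ : alternatingGroup (Fin n) →* ProjGL a F) : φ = 1 := by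
  have : CharP (AlgebraicClosure F) 2 := charP_of_injective_algebraMap (algebraMap F _).injective 2
  have hs : AltPGL.ScalarThreeCycles (AltPGL.liftsPerm φ) (AltPGL.liftsRep φ) Finset.univ := by
    rcases hn with rfl | rfl
    · exact AltPGL.trivialInDegree_of_odd (d + 1) (by omega) hde.add_one _ _ _ _ _
        (AltPGL.isProjAlt_lifts φ) (by simp) (by simp; omega)
    · exact (AltPGL.trivialInDegree_of_odd (d + 1) (by omega) hde.add_one).succ (by omega)
        _ _ _ _ _ (AltPGL.isProjAlt_lifts φ) (by simp) (by simp; omega)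
  have h3 : ∀ σ : alternatingGroup (Fin n), (σ : Perm (Fin n)).IsThreeCycle → φ σ = 1 := by
    intro σ hσ
    obtain ⟨x, y, z, hxy, hxz, hyz, h⟩ : ∃ x y z, x ≠ y ∧ x ≠ z ∧ y ≠ z ∧
        (σ : Perm (Fin n)) = AltPGL.cyc x y z := by
      obtain ⟨x, hx⟩ := Finset.card_pos.1 (by rw [hσ.card_support]; norm_num :
        0 < (σ : Perm (Fin n)).support.card)
      have h1 := hσ.nodup_iff_mem_support.2 hx
      simp only [List.nodup_cons, List.mem_cons, List.not_mem_nil, or_false, not_or] at h1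
      exact ⟨x, _, _, h1.1.1, h1.1.2, h1.2.1, hσ.eq_swap_mul_swap_iff_mem_support.2 hx⟩
    obtain ⟨M, hM⟩ := QuotientGroup.mk_surjective (φ σ)
    exact (AltPGL.liftsRep_eq_smul_one_iff φ ⟨(σ, M), hM.symm⟩).1
      (hs x (by simp) y (by simp) z (by simp) hxy hxz hyz _ h)
  have hker : alternatingGroup (Fin n) ≤ φ.ker.map (alternatingGroup (Fin n)).subtype := by
    refine closure_three_cycles_eq_alternating.ge.trans ((Subgroup.closure_le _).2 ?_)
    intro σ hσ
    exact ⟨⟨σ, hσ.mem_alternatingGroup⟩, h3 _ hσ, rfl⟩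
  ext1 σ
  obtain ⟨σ', hσ', h⟩ := hker σ.2
  rw [← Subtype.ext h]
  exact hσ'
end
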